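/- Let a, b > 0 be constants with a + b < 1/2. Then there exist a constant C > 0 and a threshold N₀ such that for all positive integers m, s, n, t with m, n ≥ N₀, ms = nt, and (writing λ = s/n = t/m and A = λ(1+λ)/2) satisfying ((1+2λ)²/(4λ(1+λ)))·(1 + 5m/(6n) + 5n/(6m)) ≤ a·log n, one has M(m,s;n,t) = (λ^{−λ}(1+λ)^{1+λ})^{mn} / ( (4πA)^{(m+n−1)/2} · m^{(n−1)/2} · n^{(m−1)/2} ) · exp( 1/2 − ((1+2A)/(24A))·(m/n + n/m) + E ) with |E| ≤ C·n^{−b}. -/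

import Mathlib

open Real

/-- `M(m,s;n,t)`: the number of `m × n` matrices with nonnegative integer entries whose
rows each sum to `s` and whose columns each sum to `t`. -/
noncomputable def matCount (m s n t : ℕ) : ℕ :=
  Nat.card {A : Fin m → Fin n → ℕ // (∀ j, ∑ k, A j k = s) ∧ (∀ k, ∑ j, A j k = t)}

namespace ContingencyTable

open MeasureTheory ProbabilityTheory

section Cumulant

/-- The cumulant generating function at `i x` of the centred geometric law of mean `l`. -/
noncomputable def cgf (l x : ℝ) : ℂ :=
  -(Complex.I * l * x) - Complex.log (1 + l - l * Complex.exp (Complex.I * x))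

lemma re_denom (l x : ℝ) :
    (1 + l - l * Complex.exp (Complex.I * x) : ℂ).re = 1 + l * (1 - cos x) := by
  have : (Complex.I * x : ℂ) = (x : ℂ) * Complex.I := mul_comm _ _
  rw [this, Complex.exp_mul_I]
  simp [Complex.cos_ofReal_re, Complex.sin_ofReal_im]
  ring

lemma im_denom (l x : ℝ) :
    (1 + l - l * Complex.exp (Complex.I * x) : ℂ).im = -(l * sin x) := by
  have : (Complex.I * x : ℂ) = (x : ℂ) * Complex.I := mul_comm _ _
  rw [this, Complex.exp_mul_I]
  simp [Complex.cos_ofReal_im, Complex.sin_ofReal_re]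

lemma one_le_re_denom {l : ℝ} (hl : 0 < l) (x : ℝ) :
    1 ≤ (1 + l - l * Complex.exp (Complex.I * x) : ℂ).re := by
  rw [re_denom]
  nlinarith [cos_le_one x]

lemma denom_ne_zero {l : ℝ} (hl : 0 < l) (x : ℝ) :
    (1 + l - l * Complex.exp (Complex.I * x) : ℂ) ≠ 0 := by
  intro h
  have := one_le_re_denom hl x
  rw [h] at this
  norm_num at this

lemma one_le_norm_denom {l : ℝ} (hl : 0 < l) (x : ℝ) :
    1 ≤ ‖(1 + l - l * Complex.exp (Complex.I * x) : ℂ)‖ :=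
  (one_le_re_denom hl x).trans (Complex.re_le_norm _)

lemma norm_denom_sq (l x : ℝ) :
    ‖(1 + l - l * Complex.exp (Complex.I * x) : ℂ)‖ ^ 2
      = 1 + 4 * (l * (1 + l) / 2) * (1 - cos x) := by
  rw [← Complex.normSq_eq_norm_sq, Complex.normSq_apply, re_denom, im_denom]
  linear_combination l ^ 2 * sin_sq_add_cos_sq x

lemma exp_cgf {l : ℝ} (hl : 0 < l) (x : ℝ) :
    Complex.exp (cgf l x)
      = Complex.exp (-(Complex.I * l * x)) / (1 + l - l * Complex.exp (Complex.I * x)) := by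
  rw [cgf, Complex.exp_sub, Complex.exp_log (denom_ne_zero hl x)]

/-- The tilted mean, through which all derivatives of `cgf` are polynomials. -/
noncomputable def tilt (l x : ℝ) : ℂ :=
  l * Complex.exp (Complex.I * x) / (1 + l - l * Complex.exp (Complex.I * x))

lemma tilt_zero (l : ℝ) : tilt l 0 = l := by simp [tilt]

lemma hasDerivAt_exp_I (x : ℝ) : HasDerivAt (fun x : ℝ => Complex.exp (Complex.I * x))
    (Complex.I * Complex.exp (Complex.I * x)) x := by
  have h : HasDerivAt (fun x : ℝ => Complex.I * (x : ℂ)) (Complex.I * 1) x :=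
    (Complex.ofRealCLM.hasDerivAt (x := x)).const_mul Complex.I
  simpa [mul_comm] using h.cexp

lemma hasDerivAt_tilt {l : ℝ} (hl : 0 < l) (x : ℝ) :
    HasDerivAt (tilt l) (Complex.I * (tilt l x * (1 + tilt l x))) x := by
  have hd := denom_ne_zero hl x
  have h1 := (hasDerivAt_exp_I x).const_mul (l : ℂ)
  have h := h1.div (h1.const_sub (1 + l : ℂ)) hd
  refine h.congr_deriv ?_
  rw [tilt]
  field_simp
  ring

lemma hasDerivAt_cgf {l : ℝ} (hl : 0 < l) (x : ℝ) :
    HasDerivAt (cgf l) (Complex.I * (tilt l x - l)) x := by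
  have hd := denom_ne_zero hl x
  have h1 := (hasDerivAt_exp_I x).const_mul (l : ℂ)
  have h2 := h1.const_sub (1 + l : ℂ)
  have hs : (1 + l - l * Complex.exp (Complex.I * x) : ℂ) ∈ Complex.slitPlane :=
    Or.inl (lt_of_lt_of_le one_pos (one_le_re_denom hl x))
  have h3 := h2.clog_real hs
  have h4 : HasDerivAt (fun x : ℝ => -(Complex.I * l * (x : ℂ))) (-(Complex.I * l * 1)) x :=
    ((Complex.ofRealCLM.hasDerivAt (x := x)).const_mul (Complex.I * l)).neg
  refine (h4.sub h3).congr_deriv ?_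
  rw [tilt]
  field_simp
  ring

lemma norm_exp_I (x : ℝ) : ‖Complex.exp (Complex.I * x)‖ = 1 := by
  rw [mul_comm, Complex.norm_exp_ofReal_mul_I]

lemma norm_tilt_mul {l : ℝ} (hl : 0 < l) (x : ℝ) :
    ‖tilt l x * (1 + tilt l x)‖ ≤ l * (1 + l) := by
  have hd := denom_ne_zero hl x
  have h : tilt l x * (1 + tilt l x) = l * (1 + l) * Complex.exp (Complex.I * x)
      / (1 + l - l * Complex.exp (Complex.I * x)) ^ 2 := by
    rw [tilt]; field_simp; ring
  have h0 : ‖(l * (1 + l) : ℂ)‖ = l * (1 + l) := by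
    have : (l * (1 + l) : ℂ) = ((l * (1 + l) : ℝ) : ℂ) := by push_cast; ring
    rw [this, Complex.norm_real, Real.norm_of_nonneg (by positivity)]
  rw [h, norm_div, norm_mul, norm_exp_I, norm_pow, h0, mul_one]
  exact div_le_self (by positivity) (one_le_pow₀ (one_le_norm_denom hl x))

lemma norm_one_add_two_tilt {l : ℝ} (hl : 0 < l) (x : ℝ) :
    ‖1 + 2 * tilt l x‖ ≤ 1 + 2 * l := by
  have hd := denom_ne_zero hl x
  have h : 1 + 2 * tilt l x = (((1 + l : ℝ) : ℂ) + (l : ℂ) * Complex.exp (Complex.I * x))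
      / (1 + l - l * Complex.exp (Complex.I * x)) := by
    rw [tilt]; push_cast; field_simp; ring
  rw [h, norm_div]
  refine (div_le_self (norm_nonneg _) (one_le_norm_denom hl x)).trans ?_
  refine (norm_add_le _ _).trans ?_
  rw [norm_mul, norm_exp_I, Complex.norm_real, Complex.norm_real,
    Real.norm_of_nonneg (by positivity), Real.norm_of_nonneg hl.le]
  linarith

lemma norm_fifth_deriv {l : ℝ} (hl : 0 < l) (x : ℝ) :
    ‖(1 + 2 * tilt l x) * (1 + 12 * (tilt l x * (1 + tilt l x)))
        * (Complex.I * (tilt l x * (1 + tilt l x)))‖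
      ≤ l * (1 + l) * (1 + 2 * l) * (1 + 12 * (l * (1 + l))) := by
  have h1 := norm_tilt_mul hl x
  have h2 := norm_one_add_two_tilt hl x
  have h3 : ‖1 + 12 * (tilt l x * (1 + tilt l x))‖ ≤ 1 + 12 * (l * (1 + l)) := by
    refine (norm_add_le _ _).trans ?_
    rw [norm_mul]
    simp only [norm_one, Complex.norm_ofNat]
    linarith
  rw [norm_mul, norm_mul, norm_mul, Complex.norm_I, one_mul]
  calc _ ≤ (1 + 2 * l) * (1 + 12 * (l * (1 + l))) * (l * (1 + l)) := by gcongr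
    _ = _ := by ring

/-- Integrating a power bound on the derivative. -/
lemma norm_le_pow_succ_of_deriv {R R' : ℝ → ℂ} {C : ℝ} {k : ℕ} (h0 : R 0 = 0)
    (hR : ∀ x, HasDerivAt R (R' x) x) (hb : ∀ x, ‖R' x‖ ≤ C * |x| ^ k) (x : ℝ) :
    ‖R x‖ ≤ C * |x| ^ (k + 1) := by
  have hC : 0 ≤ C := by
    have := (norm_nonneg _).trans (hb 1)
    simpa using this
  have key := (convex_uIcc (0 : ℝ) x).norm_image_sub_le_of_norm_hasDerivWithin_le
    (f := R) (f' := R') (C := C * |x| ^ k) (fun y _ => (hR y).hasDerivWithinAt)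
    (fun y hy => (hb y).trans ?_) Set.left_mem_uIcc Set.right_mem_uIcc
  · rw [h0, sub_zero, sub_zero, Real.norm_eq_abs] at key
    calc _ ≤ _ := key
      _ = _ := by ring
  · have : |y| ≤ |x| := by
      have := Set.abs_sub_left_of_mem_uIcc hy
      simpa using this
    gcongr

lemma hasDerivAt_ofReal_pow (c : ℂ) (k : ℕ) (x : ℝ) :
    HasDerivAt (fun x : ℝ => c * (x : ℂ) ^ (k + 1)) (c * (k + 1) * (x : ℂ) ^ k) x := by
  have h := ((Complex.ofRealCLM.hasDerivAt (x := x)).pow (k + 1)).const_mul c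
  refine h.congr_deriv ?_
  simp
  ring

/-- Fourth order expansion of `cgf` with a remainder bounded uniformly on the line. -/
lemma cgf_taylor {l : ℝ} (hl : 0 < l) (x : ℝ) :
    ‖cgf l x - (-(l * (1 + l) / 2 : ℂ) * (x : ℂ) ^ 2
        - Complex.I * (l * (1 + l) * (1 + 2 * l) / 6) * (x : ℂ) ^ 3
        + (l * (1 + l) * (1 + 6 * (l * (1 + l))) / 24 : ℂ) * (x : ℂ) ^ 4)‖
      ≤ l * (1 + l) * (1 + 2 * l) * (1 + 12 * (l * (1 + l))) * |x| ^ 5 := by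
  set C := l * (1 + l) * (1 + 2 * l) * (1 + 12 * (l * (1 + l)))
  have hT := hasDerivAt_tilt hl
  have B4 : ∀ x : ℝ, ‖tilt l x * (1 + tilt l x) * (1 + 6 * (tilt l x * (1 + tilt l x)))
      - l * (1 + l) * (1 + 6 * (l * (1 + l)))‖ ≤ C * |x| ^ (0 + 1) := by
    refine norm_le_pow_succ_of_deriv (by simp [tilt_zero]) (R' := fun x =>
      (1 + 2 * tilt l x) * (1 + 12 * (tilt l x * (1 + tilt l x)))
        * (Complex.I * (tilt l x * (1 + tilt l x)))) (fun x => ?_) (fun x => ?_)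
    · have h1 := (hT x).mul ((hT x).const_add 1)
      have h2 := h1.mul ((h1.const_mul 6).const_add 1)
      refine (h2.sub_const _).congr_deriv ?_
      simp only [Pi.mul_apply]
      ring
    · simpa using norm_fifth_deriv hl x
  have B3 : ∀ x : ℝ, ‖-Complex.I * (tilt l x * (1 + tilt l x) * (1 + 2 * tilt l x))
      + Complex.I * (l * (1 + l) * (1 + 2 * l))
      - l * (1 + l) * (1 + 6 * (l * (1 + l))) * (x : ℂ) ^ (0 + 1)‖ ≤ C * |x| ^ (1 + 1) := by
    refine norm_le_pow_succ_of_deriv (by simp [tilt_zero]) (fun x => ?_) B4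
    have h1 := ((hT x).mul ((hT x).const_add 1)).mul (((hT x).const_mul 2).const_add 1)
    refine (((h1.const_mul (-Complex.I)).add_const _).sub
      (hasDerivAt_ofReal_pow _ 0 x)).congr_deriv ?_
    simp only [Pi.mul_apply]
    linear_combination (-tilt l x * (1 + tilt l x) * (1 + 6 * (tilt l x * (1 + tilt l x))))
      * Complex.I_sq
  have B2 : ∀ x : ℝ, ‖-(tilt l x * (1 + tilt l x)) + l * (1 + l)
      + Complex.I * (l * (1 + l) * (1 + 2 * l)) * (x : ℂ) ^ (0 + 1)
      - l * (1 + l) * (1 + 6 * (l * (1 + l))) / 2 * (x : ℂ) ^ (1 + 1)‖ ≤ C * |x| ^ (2 + 1) := by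
    refine norm_le_pow_succ_of_deriv (by simp [tilt_zero]) (fun x => ?_) B3
    have h1 := ((hT x).mul ((hT x).const_add 1)).neg
    refine (((h1.add_const _).add (hasDerivAt_ofReal_pow _ 0 x)).sub
      (hasDerivAt_ofReal_pow _ 1 x)).congr_deriv ?_
    push_cast
    ring
  have B1 : ∀ x : ℝ, ‖Complex.I * (tilt l x - l) + l * (1 + l) * (x : ℂ) ^ (0 + 1)
      + Complex.I * (l * (1 + l) * (1 + 2 * l)) / 2 * (x : ℂ) ^ (1 + 1)
      - l * (1 + l) * (1 + 6 * (l * (1 + l))) / 6 * (x : ℂ) ^ (2 + 1)‖ ≤ C * |x| ^ (3 + 1) := by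
    refine norm_le_pow_succ_of_deriv (by simp [tilt_zero]) (fun x => ?_) B2
    refine ((((((hT x).sub_const _).const_mul _).add (hasDerivAt_ofReal_pow _ 0 x)).add
      (hasDerivAt_ofReal_pow _ 1 x)).sub (hasDerivAt_ofReal_pow _ 2 x)).congr_deriv ?_
    push_cast
    linear_combination (tilt l x * (1 + tilt l x)) * Complex.I_sq
  have B0 : ∀ x : ℝ, ‖cgf l x + l * (1 + l) / 2 * (x : ℂ) ^ (1 + 1)
      + Complex.I * (l * (1 + l) * (1 + 2 * l)) / 6 * (x : ℂ) ^ (2 + 1)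
      - l * (1 + l) * (1 + 6 * (l * (1 + l))) / 24 * (x : ℂ) ^ (3 + 1)‖ ≤ C * |x| ^ (4 + 1) := by
    refine norm_le_pow_succ_of_deriv (by simp [cgf]) (fun x => ?_) B1
    refine ((((hasDerivAt_cgf hl x).add (hasDerivAt_ofReal_pow _ 1 x)).add
      (hasDerivAt_ofReal_pow _ 2 x)).sub (hasDerivAt_ofReal_pow _ 3 x)).congr_deriv ?_
    push_cast
    ring
  refine le_trans (le_of_eq ?_) (B0 x)
  congr 1
  ring

end Cumulant

section Gaussian

/-- The standard Gaussian law. -/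
noncomputable abbrev stdG : Measure ℝ := gaussianReal 0 1

lemma stdG_pdf (x : ℝ) : gaussianPDFReal 0 1 x = (√(2 * π))⁻¹ * exp (-(1 / 2) * x ^ 2) := by
  simp only [gaussianPDFReal, NNReal.coe_one, mul_one, sub_zero]
  congr 2
  ring

lemma integrable_stdG_iff {E : Type*} [NormedAddCommGroup E] [NormedSpace ℝ E] {f : ℝ → E} :
    Integrable f stdG ↔ Integrable (fun x => gaussianPDFReal 0 1 x • f x) volume := by
  rw [stdG, gaussianReal_of_var_ne_zero _ one_ne_zero]
  have h := integrable_withDensity_iff_integrable_smul' (μ := (volume : Measure ℝ)) (g := f)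
    (measurable_gaussianPDF 0 1) (Filter.Eventually.of_forall fun x => gaussianPDF_lt_top)
  simpa only [toReal_gaussianPDF] using h

lemma integrable_pow_stdG (k : ℕ) : Integrable (fun x : ℝ => x ^ k) stdG := by
  have h := (memLp_id_gaussianReal (μ := 0) (v := 1) k).integrable_norm_pow'
  refine (integrable_norm_iff (by fun_prop)).1 ?_
  simpa using h

lemma integral_pow_add_two_stdG (k : ℕ) :
    ∫ x, x ^ (k + 2) ∂stdG = (k + 1) * ∫ x, x ^ k ∂stdG := by
  have hd : ∀ x : ℝ, HasDerivAt (gaussianPDFReal 0 1) (-x * gaussianPDFReal 0 1 x) x := by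
    intro x
    have h1 : HasDerivAt (fun x : ℝ => (√(2 * π))⁻¹ * exp (-(1 / 2) * x ^ 2))
        ((√(2 * π))⁻¹ * (exp (-(1 / 2) * x ^ 2) * (-(1 / 2) * (2 * x ^ (2 - 1))))) x :=
      (((hasDerivAt_pow 2 x).const_mul (-(1 / 2 : ℝ))).exp).const_mul _
    have h2 : gaussianPDFReal 0 1 = fun x : ℝ => (√(2 * π))⁻¹ * exp (-(1 / 2) * x ^ 2) :=
      funext stdG_pdf
    rw [h2]
    refine h1.congr_deriv ?_
    simp
    ring
  have hi : ∀ j : ℕ, Integrable (fun x : ℝ => gaussianPDFReal 0 1 x * x ^ j) := fun j => by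
    simpa using integrable_stdG_iff.1 (integrable_pow_stdG j)
  have key := integral_mul_deriv_eq_deriv_mul_of_integrable
    (u := fun x : ℝ => x ^ (k + 1)) (v := gaussianPDFReal 0 1)
    (u' := fun x => (((k + 1 : ℕ) : ℝ) * x ^ k)) (v' := fun x => -x * gaussianPDFReal 0 1 x)
    (fun x _ => by simpa using hasDerivAt_pow (k + 1) x) (fun x _ => hd x)
    (by
      refine ((hi (k + 2)).neg).congr (Filter.Eventually.of_forall fun x => ?_)
      simp; ring)
    (by
      refine ((hi k).const_mul ((k + 1 : ℕ) : ℝ)).congr (Filter.Eventually.of_forall fun x => ?_)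
      simp; ring)
    (by
      refine (hi (k + 1)).congr (Filter.Eventually.of_forall fun x => ?_)
      simp; ring)
  rw [integral_gaussianReal_eq_integral_smul one_ne_zero,
    integral_gaussianReal_eq_integral_smul one_ne_zero, ← integral_const_mul]
  have e1 : ∫ x : ℝ, gaussianPDFReal 0 1 x • x ^ (k + 2)
      = -∫ x : ℝ, x ^ (k + 1) * (-x * gaussianPDFReal 0 1 x) := by
    rw [← integral_neg]
    congr 1; ext x; simp; ring
  rw [e1, key, neg_neg]
  congr 1; ext x; simp; ring

lemma integral_pow_stdG_zero : ∫ x, x ^ 0 ∂stdG = 1 := by simp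

lemma integral_pow_stdG_one : ∫ x, x ^ 1 ∂stdG = 0 := by simp [stdG, integral_id_gaussianReal]

lemma integral_pow_stdG_two : ∫ x, x ^ 2 ∂stdG = 1 := by
  rw [integral_pow_add_two_stdG 0, integral_pow_stdG_zero]; norm_num

lemma integral_pow_stdG_three : ∫ x, x ^ 3 ∂stdG = 0 := by
  rw [integral_pow_add_two_stdG 1, integral_pow_stdG_one]; norm_num

lemma integral_pow_stdG_four : ∫ x, x ^ 4 ∂stdG = 3 := by
  rw [integral_pow_add_two_stdG 2, integral_pow_stdG_two]; norm_num

lemma integral_pow_stdG_six : ∫ x, x ^ 6 ∂stdG = 15 := by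
  rw [integral_pow_add_two_stdG 4, integral_pow_stdG_four]; norm_num

lemma integral_pow_stdG_eight : ∫ x, x ^ 8 ∂stdG = 105 := by
  rw [integral_pow_add_two_stdG 6, integral_pow_stdG_six]; norm_num

lemma mgf_id_stdG (t : ℝ) : ∫ x, exp (t * x) ∂stdG = exp (t ^ 2 / 2) := by
  have := congrFun (mgf_fun_id_gaussianReal (μ := 0) (v := 1)) t
  simpa [mgf] using this

lemma stdG_tail {t : ℝ} (ht : 0 ≤ t) : stdG.real {x | t < |x|} ≤ 2 * exp (-(t ^ 2 / 2)) := by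
  have h1 : stdG.real {x | t ≤ x} ≤ exp (-(t ^ 2 / 2)) := by
    have := measure_ge_le_exp_mul_mgf (μ := stdG) (X := fun x => x) t ht
      (integrable_exp_mul_gaussianReal t)
    refine this.trans (le_of_eq ?_)
    rw [mgf, mgf_id_stdG, ← Real.exp_add]
    congr 1; ring
  have h2 : stdG.real {x | t ≤ -x} ≤ exp (-(t ^ 2 / 2)) := by
    have hi : Integrable (fun x => exp (t * -x)) stdG := by
      simpa using integrable_exp_mul_gaussianReal (μ := 0) (v := 1) (-t)
    have := measure_ge_le_exp_mul_mgf (μ := stdG) (X := fun x => -x) t ht hi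
    refine this.trans (le_of_eq ?_)
    have h3 : ∀ x : ℝ, t * -x = (-t) * x := fun x => by ring
    simp only [mgf, h3]
    rw [mgf_id_stdG, ← Real.exp_add]
    congr 1; ring
  have hsub : {x : ℝ | t < |x|} ⊆ {x | t ≤ x} ∪ {x | t ≤ -x} := by
    intro x hx
    rcases lt_abs.1 (show t < |x| from hx) with h | h
    · exact Or.inl h.le
    · exact Or.inr h.le
  calc _ ≤ _ := measureReal_mono hsub
    _ ≤ _ := measureReal_union_le _ _
    _ ≤ _ := by linarith

/-- The law of `n` independent standard Gaussian variables. -/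
noncomputable abbrev stdGPi (n : ℕ) : Measure (Fin n → ℝ) := Measure.pi fun _ => stdG

lemma integral_sum_sq_stdGPi (n : ℕ) {h : ℝ → ℝ} (h2 : MemLp h 2 stdG)
    (h0 : ∫ x, h x ∂stdG = 0) :
    ∫ u, (∑ i, h (u i)) ^ 2 ∂(stdGPi n) = n * ∫ x, h x ^ 2 ∂stdG := by
  have hv := variance_sum_pi (ι := Fin n) (μ := fun _ => stdG) (X := fun _ => h) (fun _ => h2)
  have hL : ∀ i : Fin n, MemLp (fun u : Fin n → ℝ => h (u i)) 2 (stdGPi n) := fun i =>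
    h2.comp_measurePreserving (measurePreserving_eval (fun _ : Fin n => stdG) i)
  have hm : ∫ u, (∑ i, fun ω : Fin n → ℝ => h (ω i)) u ∂(stdGPi n) = 0 := by
    simp only [Finset.sum_apply]
    rw [integral_finsetSum _ fun i _ => (hL i).integrable (by norm_num)]
    refine Finset.sum_eq_zero fun i _ => ?_
    rw [integral_comp_eval (μ := fun _ : Fin n => stdG) (f := h) h2.aestronglyMeasurable, h0]
  rw [variance_of_integral_eq_zero (memLp_finsetSum' _ fun i _ => hL i).aemeasurable hm] at hv
  simp only [Finset.sum_apply, Finset.sum_const, Finset.card_univ, Fintype.card_fin] at hv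
  rw [variance_of_integral_eq_zero h2.aemeasurable h0] at hv
  simpa using hv

lemma integrable_sum_sq_stdGPi (n : ℕ) {h : ℝ → ℝ} (h2 : MemLp h 2 stdG) :
    Integrable (fun u => (∑ i, h (u i)) ^ 2) (stdGPi n) := by
  have hL : ∀ i : Fin n, MemLp (fun u : Fin n → ℝ => h (u i)) 2 (stdGPi n) := fun i =>
    h2.comp_measurePreserving (measurePreserving_eval (fun _ : Fin n => stdG) i)
  exact (memLp_finsetSum _ fun i _ => hL i).integrable_sq

lemma stdGPi_sum_tail (n : ℕ) (hn : 0 < n) {t : ℝ} (ht : 0 ≤ t) :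
    (stdGPi n).real {u | t * √n < |∑ i, u i|} ≤ 2 * exp (-(t ^ 2 / 2)) := by
  have hsn : 0 < √(n : ℝ) := Real.sqrt_pos.2 (by exact_mod_cast hn)
  have hs2 : √(n : ℝ) ^ 2 = n := Real.sq_sqrt (by positivity)
  have hi : ∀ s : ℝ, Integrable (fun u : Fin n → ℝ => exp (s * ∑ i, u i)) (stdGPi n) := by
    intro s
    have : Integrable (fun u : Fin n → ℝ => ∏ i, exp (s * u i)) (stdGPi n) :=
      Integrable.fintype_prod (f := fun (_ : Fin n) x => exp (s * x))
        (fun _ => integrable_exp_mul_gaussianReal s)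
    simpa only [Finset.mul_sum, Real.exp_sum] using this
  have hm : ∀ s : ℝ, ∫ u, exp (s * ∑ i, u i) ∂(stdGPi n) = exp (n * (s ^ 2 / 2)) := by
    intro s
    simp only [Finset.mul_sum, Real.exp_sum]
    rw [integral_fintype_prod_eq_pow (fun x : ℝ => exp (s * x)), mgf_id_stdG,
      Fintype.card_fin, ← Real.exp_nat_mul]
  have key : ∀ s : ℝ, |s| = t / √n →
      (stdGPi n).real {u | t ^ 2 ≤ s * ∑ i, u i} ≤ exp (-(t ^ 2 / 2)) := by
    intro s hs
    have := measure_ge_le_exp_mul_mgf (μ := stdGPi n) (X := fun u => s * ∑ i, u i)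
      (t := 1) (t ^ 2) zero_le_one (by simpa using hi s)
    refine this.trans (le_of_eq ?_)
    simp only [mgf, one_mul]
    rw [hm, ← Real.exp_add, ← sq_abs s, hs, div_pow, hs2]
    have : (n : ℝ) ≠ 0 := by positivity
    congr 1; field_simp; ring
  have hsub : {u : Fin n → ℝ | t * √n < |∑ i, u i|}
      ⊆ {u | t ^ 2 ≤ (t / √n) * ∑ i, u i} ∪ {u | t ^ 2 ≤ (-(t / √n)) * ∑ i, u i} := by
    intro u hu
    have aux : ∀ x : ℝ, t * √n < x → t ^ 2 ≤ t / √n * x := fun x hx => by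
      calc t ^ 2 = t / √n * (t * √n) := by field_simp
        _ ≤ _ := by gcongr
    rcases lt_abs.1 (show t * √n < |∑ i, u i| from hu) with h | h
    · exact Or.inl (aux _ h)
    · refine Or.inr ?_
      have := aux _ h
      simpa using this
  have h1 := key (t / √n) (abs_of_nonneg (by positivity))
  have h2 := key (-(t / √n)) (by rw [abs_neg, abs_of_nonneg (by positivity)])
  calc _ ≤ _ := measureReal_mono hsub
    _ ≤ _ := measureReal_union_le _ _
    _ ≤ _ := by linarith

end Gaussian

section Algebra

variable {m n : ℕ}

lemma sum_sum_add_pow_three (a : Fin m → ℝ) (w : Fin n → ℝ) (hw : ∑ k, w k = 0) :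
    ∑ j, ∑ k, (a j + w k) ^ 3
      = n * ∑ j, a j ^ 3 + 3 * (∑ j, a j) * ∑ k, w k ^ 2 + m * ∑ k, w k ^ 3 := by
  have h : ∀ j, ∑ k, (a j + w k) ^ 3 = n * a j ^ 3 + 3 * a j * ∑ k, w k ^ 2 + ∑ k, w k ^ 3 := by
    intro j
    have e : ∀ k, (a j + w k) ^ 3
        = a j ^ 3 + 3 * a j ^ 2 * w k + 3 * a j * w k ^ 2 + w k ^ 3 := fun k => by ring
    simp only [e, Finset.sum_add_distrib, ← Finset.mul_sum, hw]
    simp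
  simp only [h, Finset.sum_add_distrib, ← Finset.mul_sum, ← Finset.sum_mul]
  simp

lemma sum_sum_add_pow_four (a : Fin m → ℝ) (w : Fin n → ℝ) (hw : ∑ k, w k = 0) :
    ∑ j, ∑ k, (a j + w k) ^ 4
      = n * ∑ j, a j ^ 4 + 6 * (∑ j, a j ^ 2) * ∑ k, w k ^ 2
        + 4 * (∑ j, a j) * ∑ k, w k ^ 3 + m * ∑ k, w k ^ 4 := by
  have h : ∀ j, ∑ k, (a j + w k) ^ 4 = n * a j ^ 4 + 6 * a j ^ 2 * ∑ k, w k ^ 2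
      + 4 * a j * ∑ k, w k ^ 3 + ∑ k, w k ^ 4 := by
    intro j
    have e : ∀ k, (a j + w k) ^ 4 = a j ^ 4 + 4 * a j ^ 3 * w k + 6 * a j ^ 2 * w k ^ 2
        + 4 * a j * w k ^ 3 + w k ^ 4 := fun k => by ring
    simp only [e, Finset.sum_add_distrib, ← Finset.mul_sum, hw]
    simp
  simp only [h, Finset.sum_add_distrib, ← Finset.mul_sum, ← Finset.sum_mul]
  simp

/-- The mean of a vector. -/
noncomputable def avg (y : Fin n → ℝ) : ℝ := (∑ k, y k) / n

lemma sum_eq_mul_avg (hn : 0 < n) (y : Fin n → ℝ) : ∑ k, y k = n * avg y := by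
  have : (n : ℝ) ≠ 0 := by positivity
  rw [avg]; field_simp

lemma sum_sub_avg (hn : 0 < n) (y : Fin n → ℝ) : ∑ k, (y k - avg y) = 0 := by
  rw [Finset.sum_sub_distrib, sum_eq_mul_avg hn]; simp

lemma sum_sub_avg_sq (hn : 0 < n) (y : Fin n → ℝ) :
    ∑ k, (y k - avg y) ^ 2 = ∑ k, y k ^ 2 - n * avg y ^ 2 := by
  have e : ∀ k, (y k - avg y) ^ 2 = y k ^ 2 - 2 * avg y * y k + avg y ^ 2 := fun k => by ring
  simp only [e, Finset.sum_add_distrib, Finset.sum_sub_distrib, ← Finset.mul_sum]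
  rw [sum_eq_mul_avg hn y]
  simp; ring

lemma sum_sub_avg_pow_three (hn : 0 < n) (y : Fin n → ℝ) :
    ∑ k, (y k - avg y) ^ 3 = ∑ k, y k ^ 3 - 3 * avg y * ∑ k, y k ^ 2 + 2 * n * avg y ^ 3 := by
  have e : ∀ k, (y k - avg y) ^ 3
      = y k ^ 3 - 3 * avg y * y k ^ 2 + 3 * avg y ^ 2 * y k - avg y ^ 3 := fun k => by ring
  simp only [e, Finset.sum_add_distrib, Finset.sum_sub_distrib, ← Finset.mul_sum]
  rw [sum_eq_mul_avg hn y]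
  simp; ring

/-- The rescaled angle attached to the cell `(j, k)`. -/
noncomputable def cell (u : Fin m → ℝ) (y : Fin n → ℝ) (j : Fin m) (k : Fin n) : ℝ :=
  u j / √n + (y k - avg y) / √m

/-- The box on which all cell angles and the mean of `y` are small. -/
def boxSet (m n : ℕ) (L : ℝ) : Set ((Fin m → ℝ) × (Fin n → ℝ)) :=
  {p | (∀ j k, |cell p.1 p.2 j k| ≤ L ^ 3 / √n) ∧ |avg p.2| ≤ L / √n}

lemma sum_cell_pow_three (hm : 0 < m) (hn : 0 < n) (u : Fin m → ℝ) (y : Fin n → ℝ) :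
    ∑ j, ∑ k, cell u y j k ^ 3
      = ((∑ j, (u j ^ 3 + 3 * n / m * u j)) / √n + (∑ k, (y k ^ 3 + (-3) * y k)) / √m)
        + (3 * (∑ j, u j) * (∑ k, (y k ^ 2 - 1) - n * avg y ^ 2) / (√n * m)
          + (-3 * avg y * ∑ k, (y k ^ 2 - 1) + 2 * n * avg y ^ 3) / √m) := by
  have hw : ∑ k, (y k - avg y) / √m = 0 := by rw [← Finset.sum_div, sum_sub_avg hn, zero_div]
  have hsm : √(m : ℝ) ^ 2 = m := Real.sq_sqrt (by positivity)
  have hsn : √(n : ℝ) ^ 2 = n := Real.sq_sqrt (by positivity)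
  have hm0 : (m : ℝ) ≠ 0 := by positivity
  have hn0 : (n : ℝ) ≠ 0 := by positivity
  have hsm0 : √(m : ℝ) ≠ 0 := by positivity
  have hsn0 : √(n : ℝ) ≠ 0 := by positivity
  simp only [cell]
  rw [sum_sum_add_pow_three _ _ hw]
  simp only [div_pow, ← Finset.sum_div, sum_sub_avg_sq hn, sum_sub_avg_pow_three hn,
    Finset.sum_add_distrib, Finset.sum_sub_distrib, ← Finset.mul_sum]
  rw [sum_eq_mul_avg hn y]
  have e1 : √(m : ℝ) ^ 3 = m * √m := by rw [pow_succ, hsm]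
  have e2 : √(n : ℝ) ^ 3 = n * √n := by rw [pow_succ, hsn]
  rw [e1, e2, hsm]
  simp only [Finset.sum_const, Finset.card_univ, Fintype.card_fin, nsmul_eq_mul, mul_one]
  field_simp
  ring

lemma sum_cell_pow_four (hm : 0 < m) (hn : 0 < n) (u : Fin m → ℝ) (y : Fin n → ℝ) :
    ∑ j, ∑ k, cell u y j k ^ 4
      = (∑ j, u j ^ 4) / n + 6 * (∑ j, u j ^ 2) * (∑ k, (y k - avg y) ^ 2) / (n * m)
        + 4 * (∑ j, u j) * (∑ k, (y k - avg y) ^ 3) / (√n * (m * √m))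
        + (∑ k, (y k - avg y) ^ 4) / m := by
  have hw : ∑ k, (y k - avg y) / √m = 0 := by rw [← Finset.sum_div, sum_sub_avg hn, zero_div]
  have hsm : √(m : ℝ) ^ 2 = m := Real.sq_sqrt (by positivity)
  have hsn : √(n : ℝ) ^ 2 = n := Real.sq_sqrt (by positivity)
  have hm0 : (m : ℝ) ≠ 0 := by positivity
  have hn0 : (n : ℝ) ≠ 0 := by positivity
  have hsm0 : √(m : ℝ) ≠ 0 := by positivity
  have hsn0 : √(n : ℝ) ≠ 0 := by positivity
  simp only [cell]
  rw [sum_sum_add_pow_four _ _ hw]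
  simp only [div_pow, ← Finset.sum_div]
  have e1 : √(m : ℝ) ^ 3 = m * √m := by rw [pow_succ, hsm]
  have e3 : √(m : ℝ) ^ 4 = m * m := by rw [show 4 = 2 * 2 from rfl, pow_mul, hsm, sq]
  have e4 : √(n : ℝ) ^ 4 = n * n := by rw [show 4 = 2 * 2 from rfl, pow_mul, hsn, sq]
  rw [e1, hsm, e3, hsn, e4]
  field_simp

end Algebra

section Box

variable {m n : ℕ} {L : ℝ}

lemma sqrt_div_bound (hm : 0 < m) (hL : 1 ≤ L) (hnm : (n : ℝ) ≤ L * m) :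
    √(n : ℝ) ≤ L * √m := by
  have hm' : (0 : ℝ) < m := Nat.cast_pos.2 hm
  have : √(n : ℝ) ≤ √(L ^ 2 * m) := Real.sqrt_le_sqrt (by nlinarith)
  rwa [Real.sqrt_mul (by positivity), Real.sqrt_sq (by linarith)] at this

lemma abs_sub_avg_of_box (hm : 0 < m) (hn : 0 < n) (hL : 1 ≤ L) (hmn : (m : ℝ) ≤ L * n)
    {p : (Fin m → ℝ) × (Fin n → ℝ)} (hp : p ∈ boxSet m n L) :
    (∀ j, |p.1 j| ≤ L ^ 3) ∧ (∀ k, |(p.2 k - avg p.2) / √m| ≤ 2 * L ^ 3 / √n) ∧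
      (∀ k, |p.2 k - avg p.2| ≤ 2 * L ^ 4) ∧ (∀ k, |p.2 k| ≤ 3 * L ^ 4) ∧ |avg p.2| ≤ L / √n := by
  obtain ⟨h1, h2⟩ := hp
  have hsn : 0 < √(n : ℝ) := by positivity
  have hsm : 0 < √(m : ℝ) := by positivity
  have hu' : ∀ j, |p.1 j / √n| ≤ L ^ 3 / √n := by
    intro j
    have e : ∑ k, cell p.1 p.2 j k = n * (p.1 j / √n) := by
      simp only [cell, Finset.sum_add_distrib, ← Finset.sum_div, sum_sub_avg hn]
      simp
      ring
    have h3 : |∑ k, cell p.1 p.2 j k| ≤ n * (L ^ 3 / √n) := by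
      refine (Finset.abs_sum_le_sum_abs _ _).trans ((Finset.sum_le_sum fun k _ => h1 j k).trans ?_)
      simp
    rw [e, abs_mul, abs_of_pos (by positivity : (0 : ℝ) < n)] at h3
    exact le_of_mul_le_mul_left h3 (by positivity)
  have hw : ∀ k, |(p.2 k - avg p.2) / √m| ≤ 2 * L ^ 3 / √n := by
    intro k
    have j : Fin m := ⟨0, hm⟩
    have e : (p.2 k - avg p.2) / √m = cell p.1 p.2 j k - p.1 j / √n := by simp [cell]
    rw [e]
    calc _ ≤ |cell p.1 p.2 j k| + |p.1 j / √n| := abs_sub _ _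
      _ ≤ L ^ 3 / √n + L ^ 3 / √n := add_le_add (h1 j k) (hu' j)
      _ = _ := by ring
  have hd : ∀ k, |p.2 k - avg p.2| ≤ 2 * L ^ 4 := by
    intro k
    have h3 := hw k
    rw [abs_div, abs_of_pos hsm, div_le_div_iff₀ hsm hsn] at h3
    have h4 := sqrt_div_bound hn hL hmn
    have h5 : |p.2 k - avg p.2| * √n ≤ 2 * L ^ 4 * √n := by
      calc _ ≤ 2 * L ^ 3 * √m := h3
        _ ≤ 2 * L ^ 3 * (L * √n) := by gcongr
        _ = _ := by ring
    exact le_of_mul_le_mul_right h5 hsn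
  have hL4 : L ≤ L ^ 4 := le_self_pow₀ hL (by norm_num)
  have h1n : (1 : ℝ) ≤ √n := by
    rw [Real.one_le_sqrt]; exact_mod_cast hn
  refine ⟨fun j => ?_, hw, hd, fun k => ?_, h2⟩
  · have := hu' j
    rw [abs_div, abs_of_pos hsn] at this
    exact (div_le_div_iff_of_pos_right hsn).1 this
  · have h6 : L / √n ≤ L := div_le_self (by linarith) h1n
    have := abs_add_le (p.2 k - avg p.2) (avg p.2)
    rw [sub_add_cancel] at this
    linarith [hd k]

lemma continuous_avg : Continuous (avg : (Fin n → ℝ) → ℝ) := by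
  unfold avg; fun_prop

lemma continuous_cell (j : Fin m) (k : Fin n) :
    Continuous fun p : (Fin m → ℝ) × (Fin n → ℝ) => cell p.1 p.2 j k := by
  have := continuous_avg (n := n)
  unfold cell; fun_prop

lemma isClosed_boxSet : IsClosed (boxSet m n L) := by
  have h : boxSet m n L = (⋂ j, ⋂ k, {p | |cell p.1 p.2 j k| ≤ L ^ 3 / √n})
      ∩ {p | |avg p.2| ≤ L / √n} := by
    ext p; simp [boxSet]
  rw [h]
  refine IsClosed.inter (isClosed_iInter fun j => isClosed_iInter fun k => ?_) ?_
  · exact isClosed_le (continuous_cell j k).abs continuous_const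
  · exact isClosed_le (continuous_avg.comp continuous_snd).abs continuous_const

lemma measurableSet_boxSet : MeasurableSet (boxSet m n L) := isClosed_boxSet.measurableSet

/-- The joint law of the two Gaussian vectors. -/
noncomputable abbrev gaussPair (m n : ℕ) : Measure ((Fin m → ℝ) × (Fin n → ℝ)) :=
  (stdGPi m).prod (stdGPi n)

lemma boxSet_compl_prob (hm : 0 < m) (hn : 0 < n) (hL : 3 ≤ L) (hnm : (n : ℝ) ≤ L * m) :
    (gaussPair m n).real (boxSet m n L)ᶜ ≤ (m + n + 1) * (2 * exp (-(L ^ 2 / 2))) := by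
  have hsn : 0 < √(n : ℝ) := by positivity
  have hsm : 0 < √(m : ℝ) := by positivity
  have hL0 : 0 ≤ L := by linarith
  have hsub : (boxSet m n L)ᶜ ⊆ ((⋃ j, {p | L < |p.1 j|}) ∪ (⋃ k, {p | L < |p.2 k|}))
      ∪ {p : (Fin m → ℝ) × (Fin n → ℝ) | L * √n < |∑ k, p.2 k|} := by
    intro p hp
    by_contra hcon
    simp only [Set.mem_union, Set.mem_iUnion, Set.mem_ofPred_eq, not_or, not_exists, not_lt] at hcon
    obtain ⟨⟨h1, h2⟩, h3⟩ := hcon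
    refine hp ⟨fun j k => ?_, ?_⟩
    swap
    · rw [avg, abs_div, abs_of_pos (by positivity : (0 : ℝ) < n), div_le_div_iff₀ (by positivity) hsn]
      calc _ ≤ L * √n * √n := by gcongr
        _ = _ := by rw [mul_assoc, Real.mul_self_sqrt (by positivity)]
    · have ha : |avg p.2| ≤ L := by
        rw [avg, abs_div, abs_of_pos (by positivity : (0 : ℝ) < n), div_le_iff₀ (by positivity)]
        refine (Finset.abs_sum_le_sum_abs _ _).trans
          ((Finset.sum_le_sum fun k _ => h2 k).trans ?_)
        simp; linarith
      have h4 := sqrt_div_bound hm (by linarith) hnm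
      have h5 : (√(m : ℝ))⁻¹ ≤ L / √n := by
        rw [le_div_iff₀ hsn, inv_mul_le_iff₀ hsm]; linarith
      calc |cell p.1 p.2 j k| ≤ |p.1 j / √n| + |(p.2 k - avg p.2) / √m| := abs_add_le _ _
        _ = |p.1 j| / √n + |p.2 k - avg p.2| * (√m)⁻¹ := by
          rw [abs_div, abs_div, abs_of_pos hsn, abs_of_pos hsm]; rfl
        _ ≤ L / √n + (L + L) * (L / √n) := by
          gcongr
          · exact h1 j
          · exact (abs_sub _ _).trans (add_le_add (h2 k) ha)
        _ = (L + 2 * L ^ 2) / √n := by ring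
        _ ≤ _ := by
          gcongr; nlinarith [sq_nonneg L, mul_nonneg hL0 hL0]
  have t1 : ∀ j, (gaussPair m n).real {p | L < |p.1 j|} ≤ 2 * exp (-(L ^ 2 / 2)) := by
    intro j
    have hp : MeasurePreserving (fun p : (Fin m → ℝ) × (Fin n → ℝ) => p.1 j)
        (gaussPair m n) stdG :=
      (measurePreserving_eval (fun _ : Fin m => stdG) j).comp measurePreserving_fst
    have := hp.measureReal_preimage (s := {x : ℝ | L < |x|})
      (isOpen_lt continuous_const continuous_abs).measurableSet.nullMeasurableSet
    rw [Set.preimage_ofPred_eq] at this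
    rw [this]; exact stdG_tail hL0
  have t2 : ∀ k, (gaussPair m n).real {p | L < |p.2 k|} ≤ 2 * exp (-(L ^ 2 / 2)) := by
    intro k
    have hp : MeasurePreserving (fun p : (Fin m → ℝ) × (Fin n → ℝ) => p.2 k)
        (gaussPair m n) stdG :=
      (measurePreserving_eval (fun _ : Fin n => stdG) k).comp measurePreserving_snd
    have := hp.measureReal_preimage (s := {x : ℝ | L < |x|})
      (isOpen_lt continuous_const continuous_abs).measurableSet.nullMeasurableSet
    rw [Set.preimage_ofPred_eq] at this
    rw [this]; exact stdG_tail hL0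
  have t3 : (gaussPair m n).real {p : (Fin m → ℝ) × (Fin n → ℝ) | L * √n < |∑ k, p.2 k|}
      ≤ 2 * exp (-(L ^ 2 / 2)) := by
    have hp : MeasurePreserving (fun p : (Fin m → ℝ) × (Fin n → ℝ) => p.2)
        (gaussPair m n) (stdGPi n) := measurePreserving_snd
    have := hp.measureReal_preimage (s := {y : Fin n → ℝ | L * √n < |∑ k, y k|})
      (isOpen_lt continuous_const (by fun_prop)).measurableSet.nullMeasurableSet
    rw [Set.preimage_ofPred_eq] at this
    rw [this]; exact stdGPi_sum_tail n hn hL0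
  calc _ ≤ _ := measureReal_mono hsub
    _ ≤ _ := measureReal_union_le _ _
    _ ≤ _ := add_le_add (measureReal_union_le _ _) t3
    _ ≤ (∑ _j : Fin m, 2 * exp (-(L ^ 2 / 2)) + ∑ _k : Fin n, 2 * exp (-(L ^ 2 / 2)))
        + 2 * exp (-(L ^ 2 / 2)) := by
      gcongr
      · exact (measureReal_iUnion_fintype_le _).trans (Finset.sum_le_sum fun j _ => t1 j)
      · exact (measureReal_iUnion_fintype_le _).trans (Finset.sum_le_sum fun j _ => t2 j)
    _ = _ := by simp; ring

end Box

section Mgf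

lemma integral_exp_quartic_le {T α β γ : ℝ}
    (h : ∀ u, |u| ≤ T → |α * u ^ 4 + β * u ^ 2 + γ * u| ≤ 1) :
    ∫ u in Set.Icc (-T) T, exp (α * u ^ 4 + β * u ^ 2 + γ * u) ∂stdG
      ≤ exp (3 * α + β + (315 * α ^ 2 + 9 * β ^ 2 + 3 * γ ^ 2)) := by
  have hp := integrable_pow_stdG
  set g : ℝ → ℝ := fun u => 1 * u ^ 0 + α * u ^ 4 + β * u ^ 2 + γ * u ^ 1
    + 3 * α ^ 2 * u ^ 8 + 3 * β ^ 2 * u ^ 4 + 3 * γ ^ 2 * u ^ 2 with hg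
  have hgi : Integrable g stdG := by
    refine ((((((((hp 0).const_mul _).add ((hp 4).const_mul _)).add ((hp 2).const_mul _)).add
      ((hp 1).const_mul _)).add ((hp 8).const_mul _)).add ((hp 4).const_mul _)).add
      ((hp 2).const_mul _))
  have hge : ∀ u, 1 + (α * u ^ 4 + β * u ^ 2 + γ * u) + (α * u ^ 4 + β * u ^ 2 + γ * u) ^ 2
      ≤ g u := by
    intro u
    have : (α * u ^ 4 + β * u ^ 2 + γ * u) ^ 2
        ≤ 3 * ((α * u ^ 4) ^ 2 + (β * u ^ 2) ^ 2 + (γ * u) ^ 2) := by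
      nlinarith [sq_nonneg (α * u ^ 4 - β * u ^ 2), sq_nonneg (α * u ^ 4 - γ * u),
        sq_nonneg (β * u ^ 2 - γ * u)]
    simp only [hg]; nlinarith
  have hg0 : ∀ u, 0 ≤ g u := fun u => le_trans
    (by nlinarith [sq_nonneg (α * u ^ 4 + β * u ^ 2 + γ * u + 1 / 2)]) (hge u)
  have hint : ∫ u, g u ∂stdG = 1 + 3 * α + β + (315 * α ^ 2 + 9 * β ^ 2 + 3 * γ ^ 2) := by
    simp only [hg]
    rw [integral_add, integral_add, integral_add, integral_add, integral_add, integral_add]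
    · simp only [integral_const_mul, integral_pow_stdG_zero, integral_pow_stdG_one,
        integral_pow_stdG_two, integral_pow_stdG_four, integral_pow_stdG_eight]
      ring
    all_goals
      first
      | exact (hp _).const_mul _
      | exact ((hp _).const_mul _).add ((hp _).const_mul _)
      | exact (((hp _).const_mul _).add ((hp _).const_mul _)).add ((hp _).const_mul _)
      | exact ((((hp _).const_mul _).add ((hp _).const_mul _)).add ((hp _).const_mul _)).add
          ((hp _).const_mul _)
      | exact (((((hp _).const_mul _).add ((hp _).const_mul _)).add ((hp _).const_mul _)).add
          ((hp _).const_mul _)).add ((hp _).const_mul _)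
      | exact ((((((hp _).const_mul _).add ((hp _).const_mul _)).add ((hp _).const_mul _)).add
          ((hp _).const_mul _)).add ((hp _).const_mul _)).add ((hp _).const_mul _)
  have hle : ∀ u ∈ Set.Icc (-T) T, exp (α * u ^ 4 + β * u ^ 2 + γ * u) ≤ g u := by
    intro u hu
    have h1 := Real.abs_exp_sub_one_sub_id_le (h u (abs_le.2 hu))
    refine le_trans ?_ (hge u)
    linarith [le_abs_self (exp (α * u ^ 4 + β * u ^ 2 + γ * u) - 1
      - (α * u ^ 4 + β * u ^ 2 + γ * u))]
  calc _ ≤ ∫ u in Set.Icc (-T) T, g u ∂stdG := by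
        refine setIntegral_mono_on ?_ hgi.integrableOn measurableSet_Icc hle
        exact (by fun_prop : Continuous _).continuousOn.integrableOn_compact isCompact_Icc
    _ ≤ ∫ u, g u ∂stdG :=
        setIntegral_le_integral hgi (Filter.Eventually.of_forall hg0)
    _ ≤ _ := by
        rw [hint]
        have := Real.add_one_le_exp (3 * α + β + (315 * α ^ 2 + 9 * β ^ 2 + 3 * γ ^ 2))
        linarith

lemma integral_exp_sum_quartic_le (n : ℕ) {T α β γ : ℝ}
    (h : ∀ u, |u| ≤ T → |α * u ^ 4 + β * u ^ 2 + γ * u| ≤ 1) :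
    ∫ u in Set.pi Set.univ (fun _ : Fin n => Set.Icc (-T) T),
        exp (∑ j, (α * u j ^ 4 + β * u j ^ 2 + γ * u j)) ∂(stdGPi n)
      ≤ exp (n * (3 * α + β + (315 * α ^ 2 + 9 * β ^ 2 + 3 * γ ^ 2))) := by
  rw [stdGPi, Measure.restrict_pi_pi]
  simp only [Real.exp_sum]
  rw [integral_fintype_prod_eq_pow (fun x : ℝ => exp (α * x ^ 4 + β * x ^ 2 + γ * x)),
    Fintype.card_fin, Real.exp_nat_mul]
  exact pow_le_pow_left₀ (integral_nonneg fun _ => (exp_pos _).le)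
    (integral_exp_quartic_le h) _

end Mgf

section Char

lemma norm_exp_I_sub_le (x : ℝ) :
    ‖Complex.exp (Complex.I * x) - (1 + Complex.I * x - (x : ℂ) ^ 2 / 2)‖ ≤ 4 * |x| ^ 3 := by
  rcases le_or_gt |x| 1 with h | h
  · have h1 := Complex.norm_exp_sub_sum_le_norm_mul_exp (Complex.I * x) 3
    have e : ∑ m ∈ Finset.range 3, (Complex.I * (x : ℂ)) ^ m / (m.factorial : ℂ)
        = 1 + Complex.I * x - (x : ℂ) ^ 2 / 2 := by
      simp [Finset.sum_range_succ, Nat.factorial, mul_pow]; ring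
    rw [e] at h1
    have h2 : ‖Complex.I * (x : ℂ)‖ = |x| := by simp
    rw [h2] at h1
    have h3 : exp |x| ≤ 4 := by
      have := Real.exp_le_exp.2 h
      linarith [Real.exp_one_lt_d9]
    calc _ ≤ _ := h1
      _ ≤ |x| ^ 3 * 4 := by gcongr
      _ = _ := by ring
  · have h1 : ‖Complex.exp (Complex.I * x)‖ = 1 := Complex.norm_exp_I_mul_ofReal x
    have h2 : ‖1 + Complex.I * (x : ℂ) - (x : ℂ) ^ 2 / 2‖ ≤ 1 + |x| + |x| ^ 2 / 2 := by
      refine (norm_sub_le _ _).trans (add_le_add ((norm_add_le _ _).trans ?_) ?_)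
      · simp
      · simp
    have h3 : 1 + (1 + |x| + |x| ^ 2 / 2) ≤ 4 * |x| ^ 3 := by
      have a2 : 1 ≤ |x| ^ 2 := one_le_pow₀ h.le
      nlinarith [mul_nonneg (abs_nonneg x) (sub_nonneg.2 a2), mul_nonneg (sq_nonneg |x|) (sub_nonneg.2 h.le)]
    exact (norm_sub_le _ _).trans (by rw [h1]; linarith)

/-- The characteristic function of `u³ + κ u` for a standard Gaussian `u` is close to the
Gaussian one with variance `15 + 6 κ + κ²`. -/
lemma norm_charfun_cubic_sub_le (α κ : ℝ) :
    ‖∫ u, Complex.exp (Complex.I * ((α * (u ^ 3 + κ * u) : ℝ) : ℂ)) ∂stdG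
        - (exp (-(α ^ 2 * (15 + 6 * κ + κ ^ 2) / 2)) : ℝ)‖
      ≤ |α| ^ 3 * (400000 * (1 + κ ^ 4)) + α ^ 4 * (400000 * (1 + κ ^ 4)) := by
  have hp := integrable_pow_stdG
  set v : ℝ := 15 + 6 * κ + κ ^ 2 with hv
  have hv0 : 0 ≤ v := by rw [hv]; nlinarith [sq_nonneg (κ + 3)]
  have hi1 : Integrable (fun u : ℝ => α * (u ^ 3 + κ * u)) stdG :=
    ((hp 3).add (by simpa using (hp 1).const_mul κ)).const_mul α
  have e2 : ∀ u : ℝ, (α * (u ^ 3 + κ * u)) ^ 2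
      = α ^ 2 * u ^ 6 + (2 * α ^ 2 * κ) * u ^ 4 + (α ^ 2 * κ ^ 2) * u ^ 2 := fun u => by ring
  have hi2 : Integrable (fun u : ℝ => (α * (u ^ 3 + κ * u)) ^ 2) stdG := by
    simp only [e2]
    exact (((hp 6).const_mul _).add ((hp 4).const_mul _)).add ((hp 2).const_mul _)
  have I1 : ∫ u, α * (u ^ 3 + κ * u) ∂stdG = 0 := by
    rw [integral_const_mul, integral_add (hp 3) (by simpa using (hp 1).const_mul κ),
      integral_const_mul, integral_pow_stdG_three]
    have := integral_pow_stdG_one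
    simp only [pow_one] at this
    rw [this]; ring
  have I2 : ∫ u, (α * (u ^ 3 + κ * u)) ^ 2 ∂stdG = α ^ 2 * v := by
    simp only [e2]
    rw [integral_add, integral_add]
    · simp only [integral_const_mul, integral_pow_stdG_two, integral_pow_stdG_four,
        integral_pow_stdG_six]
      rw [hv]; ring
    · exact (hp 6).const_mul _
    · exact (hp 4).const_mul _
    · exact ((hp 6).const_mul _).add ((hp 4).const_mul _)
    · exact (hp 2).const_mul _
  have hexp : Integrable (fun u : ℝ => Complex.exp (Complex.I * ((α * (u ^ 3 + κ * u) : ℝ) : ℂ)))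
      stdG := by
    refine Integrable.of_bound (by fun_prop) 1 (Filter.Eventually.of_forall fun u => ?_)
    rw [Complex.norm_exp_I_mul_ofReal]
  have hi1' : Integrable (fun u : ℝ => Complex.I * ((α * (u ^ 3 + κ * u) : ℝ) : ℂ)) stdG :=
    hi1.ofReal.const_mul _
  have hi2' : Integrable (fun u : ℝ => ((α * (u ^ 3 + κ * u) : ℝ) : ℂ) ^ 2 / 2) stdG := by
    have h : Integrable (fun u : ℝ => (((α * (u ^ 3 + κ * u)) ^ 2 : ℝ) : ℂ)) stdG := hi2.ofReal
    simpa only [Complex.ofReal_pow] using h.div_const 2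
  have hc1 : Integrable (fun u : ℝ => 1 + Complex.I * ((α * (u ^ 3 + κ * u) : ℝ) : ℂ)) stdG :=
    (integrable_const _).add hi1'
  have hc2 : Integrable (fun u : ℝ => 1 + Complex.I * ((α * (u ^ 3 + κ * u) : ℝ) : ℂ)
      - ((α * (u ^ 3 + κ * u) : ℝ) : ℂ) ^ 2 / 2) stdG := hc1.sub hi2'
  have hpoly : ∫ u, (1 + Complex.I * ((α * (u ^ 3 + κ * u) : ℝ) : ℂ)
      - ((α * (u ^ 3 + κ * u) : ℝ) : ℂ) ^ 2 / 2) ∂stdG = ((1 - α ^ 2 * v / 2 : ℝ) : ℂ) := by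
    rw [integral_sub hc1 hi2', integral_add (integrable_const _) hi1',
      integral_const_mul, integral_complex_ofReal, I1, integral_div]
    simp only [← Complex.ofReal_pow]
    rw [integral_complex_ofReal, I2]
    simp
  have hA : ‖∫ u, Complex.exp (Complex.I * ((α * (u ^ 3 + κ * u) : ℝ) : ℂ)) ∂stdG
      - ((1 - α ^ 2 * v / 2 : ℝ) : ℂ)‖ ≤ |α| ^ 3 * (400000 * (1 + κ ^ 4)) := by
    rw [← hpoly, ← integral_sub hexp hc2]
    set g : ℝ → ℝ := fun u => 4 * |α| ^ 3 * (u ^ 6 + κ ^ 2 * u ^ 2 + 4 * u ^ 12 + 4 * κ ^ 4 * u ^ 4)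
      with hg
    have hb : ∀ u : ℝ, ‖Complex.exp (Complex.I * ((α * (u ^ 3 + κ * u) : ℝ) : ℂ))
        - (1 + Complex.I * ((α * (u ^ 3 + κ * u) : ℝ) : ℂ)
          - ((α * (u ^ 3 + κ * u) : ℝ) : ℂ) ^ 2 / 2)‖ ≤ g u := by
      intro u
      refine (norm_exp_I_sub_le _).trans ?_
      rw [abs_mul, mul_pow, ← mul_assoc]
      refine mul_le_mul_of_nonneg_left ?_ (by positivity)
      set a := u ^ 3
      set b := κ * u
      have h3 : |a + b| ^ 3 ≤ ((a + b) ^ 2 + (a + b) ^ 4) / 2 := by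
        rw [← sq_abs (a + b), show (a + b) ^ 4 = |a + b| ^ 4 by
          rw [← abs_pow, abs_of_nonneg (by positivity)]]
        nlinarith [sq_nonneg (|a + b| - |a + b| ^ 2)]
      have h4 : (a + b) ^ 2 ≤ 2 * a ^ 2 + 2 * b ^ 2 := by nlinarith [sq_nonneg (a - b)]
      have h5 : (a + b) ^ 4 ≤ 8 * a ^ 4 + 8 * b ^ 4 := by
        have h6 : (a + b) ^ 4 ≤ (2 * a ^ 2 + 2 * b ^ 2) ^ 2 := by
          rw [show (a + b) ^ 4 = ((a + b) ^ 2) ^ 2 by ring]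
          exact pow_le_pow_left₀ (sq_nonneg _) h4 2
        nlinarith [sq_nonneg (a ^ 2 - b ^ 2)]
      calc _ ≤ a ^ 2 + b ^ 2 + 4 * a ^ 4 + 4 * b ^ 4 := by linarith
        _ = _ := by simp only [a, b]; ring
    have h12 : ∫ x, x ^ 12 ∂stdG = 10395 := by
      rw [integral_pow_add_two_stdG 10, integral_pow_add_two_stdG 8, integral_pow_stdG_eight]
      norm_num
    have hgi : Integrable g stdG :=
      ((((hp 6).add ((hp 2).const_mul _)).add ((hp 12).const_mul _)).add
        ((hp 4).const_mul _)).const_mul _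
    have hgI : ∫ u, g u ∂stdG
        = 4 * |α| ^ 3 * (15 + κ ^ 2 + 4 * 10395 + 4 * κ ^ 4 * 3) := by
      simp only [hg]
      rw [integral_const_mul, integral_add, integral_add, integral_add (hp 6)]
      · simp only [integral_const_mul, integral_pow_stdG_two, integral_pow_stdG_four,
          integral_pow_stdG_six, h12]
        ring
      · exact (hp 2).const_mul _
      · exact (hp 6).add ((hp 2).const_mul _)
      · exact (hp 12).const_mul _
      · exact ((hp 6).add ((hp 2).const_mul _)).add ((hp 12).const_mul _)
      · exact (hp 4).const_mul _
    refine (norm_integral_le_of_norm_le hgi (Filter.Eventually.of_forall hb)).trans ?_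
    rw [hgI]
    have hk : κ ^ 2 ≤ 1 + κ ^ 4 := by nlinarith [sq_nonneg (κ ^ 2 - 1), sq_nonneg κ]
    have h0 : 0 ≤ |α| ^ 3 := by positivity
    have h4 : 0 ≤ κ ^ 4 := by positivity
    calc _ = |α| ^ 3 * (4 * (15 + κ ^ 2 + 4 * 10395 + 4 * κ ^ 4 * 3)) := by ring
      _ ≤ _ := mul_le_mul_of_nonneg_left (by nlinarith) h0
  have hB : ‖((1 - α ^ 2 * v / 2 : ℝ) : ℂ) - (exp (-(α ^ 2 * v / 2)) : ℝ)‖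
      ≤ α ^ 4 * (400000 * (1 + κ ^ 4)) := by
    rw [← Complex.ofReal_sub, Complex.norm_real, Real.norm_eq_abs]
    set x := α ^ 2 * v / 2 with hx
    have hx0 : 0 ≤ x := by positivity
    have h1 : 1 - x ≤ exp (-x) := by linarith [Real.add_one_le_exp (-x)]
    have h2 : exp (-x) ≤ 1 - x + x ^ 2 := by
      rcases le_or_gt x 1 with h | h
      · have := Real.abs_exp_sub_one_sub_id_le (x := -x) (by rw [abs_neg, abs_of_nonneg hx0]; exact h)
        have := (abs_le.1 this).2
        nlinarith
      · have := Real.exp_le_one_iff.2 (by linarith : -x ≤ 0)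
        nlinarith
    have h3 : |1 - x - exp (-x)| ≤ x ^ 2 := by rw [abs_le]; constructor <;> linarith
    refine h3.trans ?_
    have h4 : v ^ 2 ≤ 1000 * (1 + κ ^ 4) := by
      rw [hv]
      nlinarith [sq_nonneg (κ ^ 2 - 1), sq_nonneg (κ ^ 2 - κ), sq_nonneg (κ - 1), sq_nonneg κ,
        sq_nonneg (κ ^ 2)]
    calc x ^ 2 = α ^ 4 * (v ^ 2 / 4) := by rw [hx]; ring
      _ ≤ _ := by
        refine mul_le_mul_of_nonneg_left ?_ (by positivity)
        have : 0 ≤ κ ^ 4 := by positivity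
        linarith
  calc _ ≤ _ := norm_sub_le_norm_sub_add_norm_sub _ _ _
    _ ≤ _ := add_le_add hA hB

lemma norm_pow_sub_pow_le_of_norm_le_one {x y : ℂ} (hx : ‖x‖ ≤ 1) (hy : ‖y‖ ≤ 1) (n : ℕ) :
    ‖x ^ n - y ^ n‖ ≤ n * ‖x - y‖ := by
  induction n with
  | zero => simp
  | succ n ih =>
    have e : x ^ (n + 1) - y ^ (n + 1) = x ^ n * (x - y) + (x ^ n - y ^ n) * y := by ring
    rw [e]
    have h1 : ‖x ^ n * (x - y)‖ ≤ ‖x - y‖ := by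
      rw [norm_mul, norm_pow]
      exact mul_le_of_le_one_left (norm_nonneg _) (pow_le_one₀ (norm_nonneg _) hx)
    have h2 : ‖(x ^ n - y ^ n) * y‖ ≤ n * ‖x - y‖ := by
      rw [norm_mul]
      exact (mul_le_of_le_one_right (norm_nonneg _) hy).trans ih
    calc _ ≤ _ := norm_add_le _ _
      _ ≤ ‖x - y‖ + n * ‖x - y‖ := add_le_add h1 h2
      _ = _ := by push_cast; ring

lemma norm_charfun_cubic_pow_sub_le (n : ℕ) (α κ : ℝ) :
    ‖∫ u, Complex.exp (Complex.I * ((α * ∑ j, (u j ^ 3 + κ * u j) : ℝ) : ℂ)) ∂(stdGPi n)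
        - (exp (-(n * (α ^ 2 * (15 + 6 * κ + κ ^ 2) / 2))) : ℝ)‖
      ≤ n * ((|α| ^ 3 + α ^ 4) * (400000 * (1 + κ ^ 4))) := by
  have e : ∀ u : Fin n → ℝ, Complex.exp (Complex.I * ((α * ∑ j, (u j ^ 3 + κ * u j) : ℝ) : ℂ))
      = ∏ j, Complex.exp (Complex.I * ((α * (u j ^ 3 + κ * u j) : ℝ) : ℂ)) := by
    intro u
    rw [← Complex.exp_sum, ← Finset.mul_sum, ← Complex.ofReal_sum, Finset.mul_sum]
  have hv : 0 ≤ 15 + 6 * κ + κ ^ 2 := by nlinarith [sq_nonneg (κ + 3)]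
  simp only [e]
  rw [integral_fintype_prod_eq_pow
      (fun x : ℝ => Complex.exp (Complex.I * ((α * (x ^ 3 + κ * x) : ℝ) : ℂ))),
    Fintype.card_fin, ← mul_neg, Real.exp_nat_mul, Complex.ofReal_pow]
  refine (norm_pow_sub_pow_le_of_norm_le_one ?_ ?_ n).trans ?_
  · refine (norm_integral_le_of_norm_le_const (C := 1)
      (Filter.Eventually.of_forall fun u => ?_)).trans (by simp)
    rw [Complex.norm_exp_I_mul_ofReal]
  · rw [Complex.norm_real, Real.norm_eq_abs, abs_of_pos (exp_pos _), Real.exp_le_one_iff]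
    have : 0 ≤ α ^ 2 * (15 + 6 * κ + κ ^ 2) / 2 := by positivity
    linarith
  · refine mul_le_mul_of_nonneg_left ((norm_charfun_cubic_sub_le α κ).trans ?_) (by positivity)
    linarith

end Char

section BoxMgf

variable {m n : ℕ} {L b : ℝ}

lemma pow_bound_of_le {L : ℝ} (hL : 1 ≤ L) {c : ℝ} (hc : 0 ≤ c) {i j : ℕ} (hij : i ≤ j) :
    c * L ^ i ≤ c * L ^ j :=
  mul_le_mul_of_nonneg_left (pow_le_pow_right₀ hL hij) hc

/-- The set of column vectors allowed by the box. -/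
def colSet (m n : ℕ) (L : ℝ) : Set (Fin n → ℝ) :=
  (Set.pi Set.univ fun _ => Set.Icc (-(3 * L ^ 4)) (3 * L ^ 4)) ∩
    {y | (∀ k, |y k - avg y| ≤ 2 * L ^ 3 * (√m / √n)) ∧ |avg y| ≤ L / √n}

lemma isCompact_colSet : IsCompact (colSet m n L) := by
  refine IsCompact.inter_right (isCompact_univ_pi fun _ => isCompact_Icc) ?_
  have h : {y : Fin n → ℝ | (∀ k, |y k - avg y| ≤ 2 * L ^ 3 * (√m / √n)) ∧ |avg y| ≤ L / √n}
      = (⋂ k, {y | |y k - avg y| ≤ 2 * L ^ 3 * (√m / √n)}) ∩ {y | |avg y| ≤ L / √n} := by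
    ext p; simp
  rw [h]
  have := continuous_avg (n := n)
  refine IsClosed.inter (isClosed_iInter fun k => ?_) ?_
  · exact isClosed_le (by fun_prop) continuous_const
  · exact isClosed_le this.abs continuous_const

lemma boxSet_subset (hm : 0 < m) (hn : 0 < n) (hL : 1 ≤ L) (hmn : (m : ℝ) ≤ L * n) :
    boxSet m n L ⊆ (Set.pi Set.univ fun _ => Set.Icc (-(L ^ 3)) (L ^ 3)) ×ˢ colSet m n L := by
  intro p hp
  obtain ⟨h1, h2, h3, h4, h5⟩ := abs_sub_avg_of_box hm hn hL hmn hp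
  refine ⟨fun j _ => abs_le.1 (h1 j), fun k _ => abs_le.1 (h4 k), fun k => ?_, h5⟩
  have hsm : 0 < √(m : ℝ) := by positivity
  have := h2 k
  rw [abs_div, abs_of_pos hsm, div_le_iff₀ hsm] at this
  calc _ ≤ _ := this
    _ = _ := by ring

lemma abs_sum_le_mul {ι : Type*} [Fintype ι] {f : ι → ℝ} {c : ℝ} (h : ∀ i, |f i| ≤ c) :
    |∑ i, f i| ≤ Fintype.card ι * c := by
  refine (Finset.abs_sum_le_sum_abs _ _).trans ((Finset.sum_le_sum fun i _ => h i).trans ?_)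
  simp

lemma abs_pow_four_sub_le {x y c : ℝ} (hx : |x| ≤ c) (hy : |y| ≤ c) :
    |x ^ 4 - y ^ 4| ≤ 4 * c ^ 3 * |x - y| := by
  have hc : 0 ≤ c := (abs_nonneg x).trans hx
  have := abs_pow_sub_pow_le (α := ℝ) x y 4
  refine this.trans ?_
  have h : max |x| |y| ^ 3 ≤ c ^ 3 := pow_le_pow_left₀ (by positivity) (max_le hx hy) 3
  push_cast
  have h2 := abs_nonneg (x - y)
  calc |x - y| * 4 * max |x| |y| ^ (4 - 1) ≤ |x - y| * 4 * c ^ 3 := by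
        refine mul_le_mul_of_nonneg_left h (by positivity)
    _ = _ := by ring

lemma abs_sum_pow_four_sub_le (hL : 1 ≤ L) {y : Fin n → ℝ}
    (h1 : ∀ k, |y k| ≤ 3 * L ^ 4) (h2 : ∀ k, |y k - avg y| ≤ 3 * L ^ 4)
    (h3 : |avg y| ≤ L / √n) :
    |∑ k, (y k - avg y) ^ 4 - ∑ k, y k ^ 4| ≤ n * (108 * L ^ 13 / √n) := by
  rw [← Finset.sum_sub_distrib]
  refine (abs_sum_le_mul (c := 108 * L ^ 13 / √n) fun k => ?_).trans (by simp)
  refine (abs_pow_four_sub_le (h2 k) (h1 k)).trans ?_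
  rw [sub_sub_cancel_left, abs_neg]
  calc _ ≤ 4 * (3 * L ^ 4) ^ 3 * (L / √n) := by gcongr
    _ = _ := by ring

lemma colSet_moments (hm : 0 < m) (hn : 0 < n) (hL : 1 ≤ L) {y : Fin n → ℝ}
    (hy : y ∈ colSet m n L) :
    ∑ k, (y k - avg y) ^ 2 ≤ 4 * L ^ 6 * m ∧
    |∑ k, (y k - avg y) ^ 3| ≤ 8 * L ^ 9 * (m * √m) / √n := by
  obtain ⟨hy1, hy2, hy3⟩ := hy
  have hsm : √(m : ℝ) ^ 2 = m := Real.sq_sqrt (by positivity)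
  have hsn : √(n : ℝ) ^ 2 = n := Real.sq_sqrt (by positivity)
  have hm0 : (0 : ℝ) < m := by positivity
  have hn0 : (0 : ℝ) < n := by positivity
  have hsm0 : 0 < √(m : ℝ) := by positivity
  have hsn0 : 0 < √(n : ℝ) := by positivity
  constructor
  · have : ∀ k, |(y k - avg y) ^ 2| ≤ 4 * L ^ 6 * m / n := by
      intro k
      rw [abs_pow]
      calc _ ≤ (2 * L ^ 3 * (√m / √n)) ^ 2 := by gcongr; exact hy2 k
        _ = _ := by rw [mul_pow, div_pow, hsm, hsn]; ring
    calc _ ≤ _ := le_abs_self _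
      _ ≤ _ := abs_sum_le_mul this
      _ = _ := by rw [Fintype.card_fin]; field_simp
  · have : ∀ k, |(y k - avg y) ^ 3| ≤ 8 * L ^ 9 * (m * √m) / (n * √n) := by
      intro k
      rw [abs_pow]
      calc _ ≤ (2 * L ^ 3 * (√m / √n)) ^ 3 := by gcongr; exact hy2 k
        _ = 8 * L ^ 9 * (√m ^ 2 * √m) / (√n ^ 2 * √n) := by ring
        _ = _ := by rw [hsm, hsn]
    calc _ ≤ _ := abs_sum_le_mul this
      _ = _ := by rw [Fintype.card_fin]; field_simp

lemma colSet_abs (hn : 0 < n) (hL : 1 ≤ L) (hmn : (m : ℝ) ≤ L * n) {y : Fin n → ℝ}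
    (hy : y ∈ colSet m n L) :
    (∀ k, |y k| ≤ 3 * L ^ 4) ∧ (∀ k, |y k - avg y| ≤ 3 * L ^ 4) ∧ |avg y| ≤ L / √n := by
  obtain ⟨hy1, hy2, hy3⟩ := hy
  refine ⟨fun k => abs_le.2 (hy1 k trivial), fun k => (hy2 k).trans ?_, hy3⟩
  have h4 := sqrt_div_bound hn hL hmn
  have hsn0 : 0 < √(n : ℝ) := by positivity
  calc 2 * L ^ 3 * (√m / √n) ≤ 2 * L ^ 3 * L := by
        gcongr; rwa [div_le_iff₀ hsn0]
    _ = 2 * L ^ 4 := by ring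
    _ ≤ _ := by gcongr; norm_num

lemma inner_mgf_le (hm : 0 < m) (hn : 0 < n) (hL : 1 ≤ L) (hmn : (m : ℝ) ≤ L * n)
    (hnm : (n : ℝ) ≤ L * m) (hb : 0 ≤ b) (hbL : b ≤ L) (hLn : 200 * L ^ 21 ≤ √n)
    {y : Fin n → ℝ} (hy : y ∈ colSet m n L) :
    ∫ u in Set.pi Set.univ (fun _ : Fin m => Set.Icc (-(L ^ 3)) (L ^ 3)),
        exp (b * ∑ j, ∑ k, cell u y j k ^ 4) ∂(stdGPi m)
      ≤ exp (3 * b * m / n + 9200 * L ^ 21 / √n)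
        * exp (∑ k, (b / m * y k ^ 4 + 6 * b / n * y k ^ 2 + 0 * y k)) := by
  have hsm0 : 0 < √(m : ℝ) := by positivity
  have hsn0 : 0 < √(n : ℝ) := by positivity
  have hm0 : (0 : ℝ) < m := by positivity
  have hn0 : (0 : ℝ) < n := by positivity
  have hL0 : 0 < L := by linarith
  have hsn : √(n : ℝ) * √n = n := Real.mul_self_sqrt (by positivity)
  have h1n : (1 : ℝ) ≤ √n := by rw [Real.one_le_sqrt]; exact_mod_cast hn
  have hsqle : √(n : ℝ) ≤ n := by
    calc √(n : ℝ) ≤ √n * √n := le_mul_of_one_le_left hsn0.le h1n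
      _ = n := hsn
  obtain ⟨hW2, hW3⟩ := colSet_moments hm hn hL hy
  obtain ⟨a1, a2, a3⟩ := colSet_abs hn hL hmn hy
  set W2 := ∑ k, (y k - avg y) ^ 2 with hW2d
  set W3 := ∑ k, (y k - avg y) ^ 3 with hW3d
  set W4 := ∑ k, (y k - avg y) ^ 4 with hW4d
  have hW20 : 0 ≤ W2 := Finset.sum_nonneg fun k _ => sq_nonneg _
  set α := b / n with hα
  set β := 6 * b * W2 / (n * m) with hβ
  set γ := 4 * b * W3 / (√n * (m * √m)) with hγ
  have hαb : |α| ≤ L / n := by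
    rw [hα, abs_of_nonneg (by positivity)]; gcongr
  have hβb : |β| ≤ 24 * L ^ 7 / n := by
    rw [hβ, abs_of_nonneg (by positivity), div_le_div_iff₀ (by positivity) hn0]
    calc 6 * b * W2 * n ≤ 6 * L * (4 * L ^ 6 * m) * n := by gcongr
      _ = _ := by ring
  have hγb : |γ| ≤ 32 * L ^ 10 / n := by
    rw [hγ, abs_div, abs_mul, abs_of_nonneg (by positivity : 0 ≤ 4 * b),
      abs_of_pos (by positivity : 0 < √(n : ℝ) * (m * √m)), div_le_div_iff₀ (by positivity) hn0]
    calc 4 * b * |W3| * n ≤ 4 * L * (8 * L ^ 9 * (m * √m) / √n) * (√n * √n) := by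
          rw [hsn]; gcongr
      _ = _ := by field_simp; ring
  have hcond : ∀ u, |u| ≤ L ^ 3 → |α * u ^ 4 + β * u ^ 2 + γ * u| ≤ 1 := by
    intro u hu
    calc _ ≤ |α * u ^ 4| + |β * u ^ 2| + |γ * u| :=
          (abs_add_le _ _).trans (add_le_add (abs_add_le _ _) le_rfl)
      _ = |α| * |u| ^ 4 + |β| * |u| ^ 2 + |γ| * |u| := by
          simp only [abs_mul, abs_pow]
      _ ≤ L / n * (L ^ 3) ^ 4 + 24 * L ^ 7 / n * (L ^ 3) ^ 2 + 32 * L ^ 10 / n * L ^ 3 := by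
          gcongr
      _ = 57 * L ^ 13 / n := by ring
      _ ≤ 1 := by
          rw [div_le_one hn0]
          calc 57 * L ^ 13 ≤ 57 * L ^ 21 := pow_bound_of_le hL (by norm_num) (by norm_num)
            _ ≤ √n := by linarith [pow_pos hL0 21]
            _ ≤ √n * √n := le_mul_of_one_le_left hsn0.le h1n
            _ = n := hsn
  have e : ∀ u : Fin m → ℝ, exp (b * ∑ j, ∑ k, cell u y j k ^ 4)
      = exp (b * (W4 / m)) * exp (∑ j, (α * u j ^ 4 + β * u j ^ 2 + γ * u j)) := by
    intro u
    rw [← Real.exp_add, sum_cell_pow_four hm hn]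
    congr 1
    simp only [Finset.sum_add_distrib, ← Finset.mul_sum, hα, hβ, hγ]
    ring
  simp only [e]
  rw [integral_const_mul]
  refine (mul_le_mul_of_nonneg_left (integral_exp_sum_quartic_le m hcond)
    (exp_pos _).le).trans ?_
  rw [← Real.exp_add, ← Real.exp_add]
  refine Real.exp_le_exp.2 ?_
  have hmnle : (m : ℝ) / n ≤ L := by rwa [div_le_iff₀ hn0]
  have hnmle : (n : ℝ) / m ≤ L := by rwa [div_le_iff₀ hm0]
  have k1 : m * (315 * α ^ 2 + 9 * β ^ 2 + 3 * γ ^ 2) ≤ 9000 * L ^ 21 / √n := by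
    have s1 : α ^ 2 ≤ (L / n) ^ 2 := sq_le_sq' (by linarith [(abs_le.1 hαb).1]) (abs_le.1 hαb).2
    have s2 : β ^ 2 ≤ (24 * L ^ 7 / n) ^ 2 :=
      sq_le_sq' (by linarith [(abs_le.1 hβb).1]) (abs_le.1 hβb).2
    have s3 : γ ^ 2 ≤ (32 * L ^ 10 / n) ^ 2 :=
      sq_le_sq' (by linarith [(abs_le.1 hγb).1]) (abs_le.1 hγb).2
    calc _ ≤ m * (315 * (L / n) ^ 2 + 9 * (24 * L ^ 7 / n) ^ 2 + 3 * (32 * L ^ 10 / n) ^ 2) := by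
          gcongr
      _ = (m / n) * (315 * L ^ 2 + 5184 * L ^ 14 + 3072 * L ^ 20) / n := by field_simp; ring
      _ ≤ L * (315 * L ^ 20 + 5184 * L ^ 20 + 3072 * L ^ 20) / √n := by
          gcongr
          · norm_num
          · norm_num
      _ = 8571 * L ^ 21 / √n := by ring
      _ ≤ _ := by gcongr; norm_num
  have k2 : m * β ≤ 6 * b / n * ∑ k, y k ^ 2 := by
    have : W2 ≤ ∑ k, y k ^ 2 := by
      rw [hW2d, sum_sub_avg_sq hn]; nlinarith [sq_nonneg (avg y)]
    calc m * β = 6 * b / n * W2 := by rw [hβ]; field_simp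
      _ ≤ _ := by gcongr
  have k3 : b * (W4 / m) ≤ b / m * ∑ k, y k ^ 4 + 108 * L ^ 21 / √n := by
    have h5 := (abs_le.1 (abs_sum_pow_four_sub_le hL a1 a2 a3)).2
    calc b * (W4 / m) = b / m * W4 := by ring
      _ ≤ b / m * (∑ k, y k ^ 4 + n * (108 * L ^ 13 / √n)) := by
          gcongr; linarith
      _ = b / m * ∑ k, y k ^ 4 + b * (n / m) * (108 * L ^ 13 / √n) := by ring
      _ ≤ b / m * ∑ k, y k ^ 4 + L * L * (108 * L ^ 13 / √n) := by gcongr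
      _ = b / m * ∑ k, y k ^ 4 + 108 * L ^ 15 / √n := by ring
      _ ≤ _ := by
          gcongr
          norm_num
  have k4 : (m : ℝ) * (3 * α) = 3 * b * m / n := by rw [hα]; ring
  have k5 : ∑ k, (b / m * y k ^ 4 + 6 * b / n * y k ^ 2 + 0 * y k)
      = b / m * ∑ k, y k ^ 4 + 6 * b / n * ∑ k, y k ^ 2 := by
    simp only [zero_mul, add_zero, Finset.sum_add_distrib, ← Finset.mul_sum]
  rw [k5]
  have k6 : 9000 * L ^ 21 / √n + 108 * L ^ 21 / √n ≤ 9200 * L ^ 21 / √n := by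
    rw [← add_div]; gcongr; linarith [pow_pos hL0 21]
  have k7 : (m : ℝ) * (3 * α + β + (315 * α ^ 2 + 9 * β ^ 2 + 3 * γ ^ 2))
    = m * (3 * α) + m * β + m * (315 * α ^ 2 + 9 * β ^ 2 + 3 * γ ^ 2) := by ring
  linarith

lemma outer_cond (hm : 0 < m) (hn : 0 < n) (hL : 1 ≤ L)
    (hnm : (n : ℝ) ≤ L * m) (hb : 0 ≤ b) (hbL : b ≤ L) (hLn : 200 * L ^ 21 ≤ √n)
    {u : ℝ} (hu : |u| ≤ 3 * L ^ 4) : |b / m * u ^ 4 + 6 * b / n * u ^ 2 + 0 * u| ≤ 1 := by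
  have hm0 : (0 : ℝ) < m := by positivity
  have hn0 : (0 : ℝ) < n := by positivity
  have hL0 : 0 < L := by linarith
  have hm1 : (1 : ℝ) / m ≤ L / n := by
    rw [div_le_div_iff₀ hm0 hn0]; linarith
  have hb1 : b / m ≤ L * (L / n) := by
    rw [div_eq_mul_one_div]; gcongr
  have h1n : (1 : ℝ) ≤ n := by exact_mod_cast hn
  have hsqle : √(n : ℝ) ≤ n := Real.sqrt_le_self_iff.2 (Or.inr h1n)
  rw [zero_mul, add_zero, abs_of_nonneg (by positivity), ← abs_of_nonneg
    (by positivity : 0 ≤ u ^ 4), ← sq_abs u, abs_pow]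
  calc b / m * |u| ^ 4 + 6 * b / n * |u| ^ 2
      ≤ L * (L / n) * (3 * L ^ 4) ^ 4 + 6 * L / n * (3 * L ^ 4) ^ 2 := by gcongr
    _ = (81 * L ^ 18 + 54 * L ^ 9) / n := by ring
    _ ≤ (81 * L ^ 21 + 54 * L ^ 21) / n := by
        gcongr
        · norm_num
        · norm_num
    _ ≤ 1 := by
        rw [div_le_one hn0]
        linarith [pow_pos hL0 21]

lemma outer_exponent_le (hm : 0 < m) (hn : 0 < n) (hL : 1 ≤ L)
    (hnm : (n : ℝ) ≤ L * m) (hb : 0 ≤ b) (hbL : b ≤ L) :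
    (3 * b * m / n + 9200 * L ^ 21 / √n) + n * (3 * (b / m) + 6 * b / n + (315 * (b / m) ^ 2
      + 9 * (6 * b / n) ^ 2 + 3 * 0 ^ 2))
      ≤ b * (3 * m / n + 6 + 3 * n / m) + 10000 * L ^ 21 / √n := by
  have hm0 : (0 : ℝ) < m := by positivity
  have hn0 : (0 : ℝ) < n := by positivity
  have hL0 : 0 < L := by linarith
  have hsn0 : 0 < √(n : ℝ) := by positivity
  have h1n : (1 : ℝ) ≤ n := by exact_mod_cast hn
  have hsqle : √(n : ℝ) ≤ n := Real.sqrt_le_self_iff.2 (Or.inr h1n)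
  have hnmle : (n : ℝ) / m ≤ L := by rwa [div_le_iff₀ hm0]
  have hm1 : (1 : ℝ) / m ≤ L / n := by
    rw [div_le_div_iff₀ hm0 hn0]; linarith
  have e1 : n * (3 * (b / m) + 6 * b / n + (315 * (b / m) ^ 2 + 9 * (6 * b / n) ^ 2
    + 3 * 0 ^ 2)) = b * (3 * n / m) + 6 * b
      + (315 * b ^ 2 * (n / m) * (1 / m) + 324 * b ^ 2 / n) := by
    field_simp; ring
  have e2 : 315 * b ^ 2 * (n / m) * (1 / m) + 324 * b ^ 2 / n ≤ 639 * L ^ 21 / √n := by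
    calc _ ≤ 315 * L ^ 2 * L * (L / n) + 324 * L ^ 2 / n := by gcongr
      _ = (315 * L ^ 4 + 324 * L ^ 2) / n := by ring
      _ ≤ (315 * L ^ 21 + 324 * L ^ 21) / √n := by
          gcongr
          · norm_num
          · norm_num
      _ = _ := by ring
  rw [e1]
  have e3 : 9200 * L ^ 21 / √n + 639 * L ^ 21 / √n ≤ 10000 * L ^ 21 / √n := by
    rw [← add_div]; gcongr; linarith [pow_pos hL0 21]
  have e4 : b * (3 * (m : ℝ) / n + 6 + 3 * n / m)
    = 3 * b * m / n + b * (3 * n / m) + 6 * b := by ring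
  rw [e4]
  linarith

lemma integral_box_swap {f : (Fin m → ℝ) × (Fin n → ℝ) → ℝ} (hf : Continuous f)
    {U : Set (Fin m → ℝ)} (hU : IsCompact U) {Y : Set (Fin n → ℝ)} (hY : IsCompact Y) :
    ∫ p in U ×ˢ Y, f p ∂(gaussPair m n)
      = ∫ y in Y, ∫ u in U, f (u, y) ∂(stdGPi m) ∂(stdGPi n) := by
  have hf2 : Continuous fun p : (Fin n → ℝ) × (Fin m → ℝ) => f p.swap := hf.comp continuous_swap
  rw [← setIntegral_prod_swap]
  exact setIntegral_prod _ (hf2.continuousOn.integrableOn_compact (hY.prod hU))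

lemma integrableOn_inner {f : (Fin m → ℝ) × (Fin n → ℝ) → ℝ} (hf : Continuous f)
    {U : Set (Fin m → ℝ)} (hU : IsCompact U) {Y : Set (Fin n → ℝ)} (hY : IsCompact Y) :
    IntegrableOn (fun y => ∫ u in U, f (u, y) ∂(stdGPi m)) Y (stdGPi n) := by
  have hf2 : Continuous fun p : (Fin n → ℝ) × (Fin m → ℝ) => f p.swap := hf.comp continuous_swap
  have h9 : Integrable (fun p : (Fin n → ℝ) × (Fin m → ℝ) => f p.swap)
      (((stdGPi n).restrict Y).prod ((stdGPi m).restrict U)) := by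
    rw [Measure.prod_restrict]
    exact hf2.continuousOn.integrableOn_compact (hY.prod hU)
  exact h9.integral_prod_left

lemma integral_exp_quartic_box_le (hm : 0 < m) (hn : 0 < n) (hL : 1 ≤ L) (hmn : (m : ℝ) ≤ L * n)
    (hnm : (n : ℝ) ≤ L * m) (hb : 0 ≤ b) (hbL : b ≤ L) (hLn : 200 * L ^ 21 ≤ √n) :
    ∫ p in boxSet m n L, exp (b * ∑ j, ∑ k, cell p.1 p.2 j k ^ 4) ∂(gaussPair m n)
      ≤ exp (b * (3 * m / n + 6 + 3 * n / m) + 10000 * L ^ 21 / √n) := by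
  have hUc : IsCompact (Set.pi Set.univ fun _ : Fin m => Set.Icc (-(L ^ 3)) (L ^ 3)) :=
    isCompact_univ_pi fun _ => isCompact_Icc
  have hYc : IsCompact (colSet m n L) := isCompact_colSet
  have hcont : Continuous fun p : (Fin m → ℝ) × (Fin n → ℝ) =>
      exp (b * ∑ j, ∑ k, cell p.1 p.2 j k ^ 4) := by
    have := continuous_cell (m := m) (n := n)
    fun_prop
  have hcontY : Continuous fun y : Fin n → ℝ =>
      exp (∑ k, (b / m * y k ^ 4 + 6 * b / n * y k ^ 2 + 0 * y k)) := by fun_prop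
  have s1 := setIntegral_mono_set
    (hcont.continuousOn.integrableOn_compact (μ := gaussPair m n) (hUc.prod hYc))
    (Filter.Eventually.of_forall fun _ => (exp_pos _).le) (boxSet_subset hm hn hL hmn).eventuallyLE
  have s2 := integral_box_swap hcont hUc hYc
  have s3 := setIntegral_mono_on (integrableOn_inner hcont hUc hYc)
    ((hcontY.const_mul (exp (3 * b * m / n + 9200 * L ^ 21 / √n))).continuousOn.integrableOn_compact
      hYc) hYc.measurableSet
    fun y hy => inner_mgf_le hm hn hL hmn hnm hb hbL hLn hy
  have s4 := setIntegral_mono_set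
    (hcontY.continuousOn.integrableOn_compact (μ := stdGPi n)
      (isCompact_univ_pi fun _ => isCompact_Icc))
    (Filter.Eventually.of_forall fun _ => (exp_pos _).le)
    (Set.inter_subset_left : colSet m n L ⊆ _).eventuallyLE
  have s5 := integral_exp_sum_quartic_le n (T := 3 * L ^ 4)
    fun u hu => outer_cond hm hn hL hnm hb hbL hLn hu
  rw [integral_const_mul] at s3
  refine s1.trans (s2.le.trans (s3.trans ((mul_le_mul_of_nonneg_left (s4.trans s5)
    (exp_pos _).le).trans ?_)))
  rw [← Real.exp_add]
  exact Real.exp_le_exp.2 (outer_exponent_le hm hn hL hnm hb hbL)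

end BoxMgf

section Quad

variable {m n : ℕ} {L : ℝ}

/-- The quadratic fluctuation functional controlling the error of the cubic-quartic model. -/
def fluct (p : (Fin m → ℝ) × (Fin n → ℝ)) : ℝ :=
  (∑ j, p.1 j) ^ 2 + (∑ j, (p.1 j ^ 2 - 1)) ^ 2 + (∑ j, (p.1 j ^ 4 - 3)) ^ 2
    + (∑ k, (p.2 k ^ 2 - 1)) ^ 2 + (∑ k, (p.2 k ^ 4 - 3)) ^ 2

lemma memLp_pow_stdG (k : ℕ) : MemLp (fun x : ℝ => x ^ k) 2 stdG := by
  rw [memLp_two_iff_integrable_sq (by fun_prop)]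
  simpa only [← pow_mul] using integrable_pow_stdG (k * 2)

lemma integrable_fluct : Integrable (fluct : (Fin m → ℝ) × (Fin n → ℝ) → ℝ) (gaussPair m n) := by
  have h1 : MemLp (fun x : ℝ => x) 2 stdG := by simpa using memLp_pow_stdG 1
  have h2 : MemLp (fun x : ℝ => x ^ 2 - 1) 2 stdG := (memLp_pow_stdG 2).sub (memLp_const 1)
  have h4 : MemLp (fun x : ℝ => x ^ 4 - 3) 2 stdG := (memLp_pow_stdG 4).sub (memLp_const 3)
  exact (((((integrable_sum_sq_stdGPi m h1).comp_fst _).add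
    ((integrable_sum_sq_stdGPi m h2).comp_fst _)).add
    ((integrable_sum_sq_stdGPi m h4).comp_fst _)).add
    ((integrable_sum_sq_stdGPi n h2).comp_snd _)).add
    ((integrable_sum_sq_stdGPi n h4).comp_snd _)

lemma integral_fluct : ∫ p, fluct p ∂(gaussPair m n) = 99 * m + 98 * n := by
  have hp := integrable_pow_stdG
  have h1 : MemLp (fun x : ℝ => x) 2 stdG := by simpa using memLp_pow_stdG 1
  have h2 : MemLp (fun x : ℝ => x ^ 2 - 1) 2 stdG := (memLp_pow_stdG 2).sub (memLp_const 1)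
  have h4 : MemLp (fun x : ℝ => x ^ 4 - 3) 2 stdG := (memLp_pow_stdG 4).sub (memLp_const 3)
  have z1 : ∫ x, x ∂stdG = 0 := by simp
  have z2 : ∫ x, (x ^ 2 - 1) ∂stdG = 0 := by
    rw [integral_sub (hp 2) (integrable_const _), integral_pow_stdG_two]; simp
  have z4 : ∫ x, (x ^ 4 - 3) ∂stdG = 0 := by
    rw [integral_sub (hp 4) (integrable_const _), integral_pow_stdG_four]; simp
  have v2 : ∫ x, (x ^ 2 - 1) ^ 2 ∂stdG = 2 := by
    have e : ∀ x : ℝ, (x ^ 2 - 1) ^ 2 = x ^ 4 - 2 * x ^ 2 + 1 := fun x => by ring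
    simp only [e]
    rw [integral_add, integral_sub (hp 4) ((hp 2).const_mul _), integral_const_mul,
      integral_pow_stdG_two, integral_pow_stdG_four]
    · simp; norm_num
    · exact (hp 4).sub ((hp 2).const_mul _)
    · exact integrable_const _
  have v4 : ∫ x, (x ^ 4 - 3) ^ 2 ∂stdG = 96 := by
    have e : ∀ x : ℝ, (x ^ 4 - 3) ^ 2 = x ^ 8 - 6 * x ^ 4 + 9 := fun x => by ring
    simp only [e]
    rw [integral_add, integral_sub (hp 8) ((hp 4).const_mul _), integral_const_mul,
      integral_pow_stdG_four, integral_pow_stdG_eight]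
    · simp; norm_num
    · exact (hp 8).sub ((hp 4).const_mul _)
    · exact integrable_const _
  have i1 := (integrable_sum_sq_stdGPi m h1).comp_fst (stdGPi n)
  have i2 := (integrable_sum_sq_stdGPi m h2).comp_fst (stdGPi n)
  have i3 := (integrable_sum_sq_stdGPi m h4).comp_fst (stdGPi n)
  have i4 := (integrable_sum_sq_stdGPi n h2).comp_snd (stdGPi m)
  have i5 := (integrable_sum_sq_stdGPi n h4).comp_snd (stdGPi m)
  unfold fluct
  rw [integral_add, integral_add, integral_add, integral_add i1 i2,
    integral_fun_fst (fun u : Fin m → ℝ => (∑ j, u j) ^ 2),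
    integral_fun_fst (fun u : Fin m → ℝ => (∑ j, (u j ^ 2 - 1)) ^ 2),
    integral_fun_fst (fun u : Fin m → ℝ => (∑ j, (u j ^ 4 - 3)) ^ 2),
    integral_fun_snd (fun u : Fin n → ℝ => (∑ j, (u j ^ 2 - 1)) ^ 2),
    integral_fun_snd (fun u : Fin n → ℝ => (∑ j, (u j ^ 4 - 3)) ^ 2),
    integral_sum_sq_stdGPi m h1 z1, integral_sum_sq_stdGPi m h2 z2, integral_sum_sq_stdGPi m h4 z4,
    integral_sum_sq_stdGPi n h2 z2, integral_sum_sq_stdGPi n h4 z4, v2, v4, integral_pow_stdG_two]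
  · simp
    ring
  · exact i1.add i2
  · exact i3
  · exact (i1.add i2).add i3
  · exact i4
  · exact ((i1.add i2).add i3).add i4
  · exact i5

lemma abs_div_le_fluct (hn : 0 < n) {S Q : ℝ} (h : S ^ 2 ≤ Q) :
    |S| / n ≤ (Q / n + 1) / √n := by
  have hsn0 : 0 < √(n : ℝ) := by positivity
  have hsn : √(n : ℝ) * √n = n := Real.mul_self_sqrt (by positivity)
  have h1 : |S| / √n ≤ Q / n + 1 := by
    have e : S ^ 2 / n = (|S| / √n) ^ 2 := by
      rw [div_pow, sq_abs, Real.sq_sqrt (by positivity)]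
    have h2 : S ^ 2 / n ≤ Q / n := by gcongr
    nlinarith [sq_nonneg (|S| / √n - 1)]
  calc |S| / n = (|S| / √n) / √n := by rw [div_div, hsn]
    _ ≤ _ := by gcongr

lemma cubic_error_le (hm : 0 < m) (hn : 0 < n) (hL : 1 ≤ L)
    (hnm : (n : ℝ) ≤ L * m) {S1 R2 v Q : ℝ} (hv : |v| ≤ L / √n) (hQ : S1 ^ 2 + R2 ^ 2 ≤ Q) :
    |3 * S1 * (R2 - n * v ^ 2) / (√n * m) + (-3 * v * R2 + 2 * n * v ^ 3) / √m|
      ≤ 8 * L ^ 5 * (Q / n + 1) / √n := by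
  have hsm0 : 0 < √(m : ℝ) := by positivity
  have hsn0 : 0 < √(n : ℝ) := by positivity
  have hm0 : (0 : ℝ) < m := by positivity
  have hn0 : (0 : ℝ) < n := by positivity
  have hL0 : 0 < L := by linarith
  have hsn : √(n : ℝ) * √n = n := Real.mul_self_sqrt (by positivity)
  have h1n : (1 : ℝ) ≤ n := by exact_mod_cast hn
  have hsqle : √(n : ℝ) ≤ n := Real.sqrt_le_self_iff.2 (Or.inr h1n)
  have hQ0 : 0 ≤ Q := le_trans (by positivity) hQ
  have hsmle : 1 / √(m : ℝ) ≤ L / √n := by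
    rw [div_le_div_iff₀ hsm0 hsn0]; linarith [sqrt_div_bound hm hL hnm]
  have hmle : 1 / (m : ℝ) ≤ L / n := by
    rw [div_le_div_iff₀ hm0 hn0]; linarith
  have hv2 : n * v ^ 2 ≤ L ^ 2 := by
    rw [← sq_abs v]
    calc n * |v| ^ 2 ≤ n * (L / √n) ^ 2 := by gcongr
      _ = L ^ 2 := by rw [div_pow, Real.sq_sqrt (by positivity)]; field_simp
  have hQn : 0 ≤ Q / n := by positivity
  have t1 : |3 * S1 * (R2 - n * v ^ 2) / (√n * m)| ≤ 3 * L ^ 5 * (Q / n + 1) / √n := by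
    have h2 : |S1 * (R2 - n * v ^ 2)| ≤ Q + L ^ 4 := by
      have h3 : (n * v ^ 2) ^ 2 ≤ L ^ 4 := by
        calc _ ≤ (L ^ 2) ^ 2 := by gcongr
          _ = _ := by ring
      rw [abs_le]; constructor
      · nlinarith [sq_nonneg (S1 + (R2 - n * v ^ 2)), sq_nonneg (R2 + n * v ^ 2)]
      · nlinarith [sq_nonneg (S1 - (R2 - n * v ^ 2)), sq_nonneg (R2 + n * v ^ 2)]
    have e : 3 * S1 * (R2 - n * v ^ 2) / (√n * m)
        = 3 * (S1 * (R2 - n * v ^ 2)) * (1 / m) / √n := by field_simp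
    rw [e, abs_div, abs_mul, abs_mul, abs_of_pos hsn0, abs_of_pos (by positivity : 0 < 1 / (m : ℝ)),
      abs_of_pos (by norm_num : (0 : ℝ) < 3)]
    calc _ ≤ 3 * (Q + L ^ 4) * (L / n) / √n := by gcongr
      _ = 3 * (L * (Q / n) + L ^ 5 / n) / √n := by field_simp
      _ ≤ 3 * (L ^ 5 * (Q / n) + L ^ 5) / √n := by
          gcongr
          · exact le_self_pow₀ hL (by norm_num)
          · exact div_le_self (by positivity) h1n
      _ = _ := by ring
  have t2 : |(-3 * v * R2 + 2 * n * v ^ 3) / √m| ≤ 5 * L ^ 5 * (Q / n + 1) / √n := by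
    have h3 : |R2| / n ≤ (Q / n + 1) / √n := abs_div_le_fluct hn (by nlinarith)
    have h4 : |(-3 * v * R2 + 2 * n * v ^ 3)| ≤ 3 * (L / √n) * |R2| + 2 * (L ^ 2 * (L / √n)) := by
      have e : -3 * v * R2 + 2 * n * v ^ 3 = -(3 * v * R2) + 2 * ((n * v ^ 2) * v) := by ring
      rw [e]
      refine (abs_add_le _ _).trans (add_le_add ?_ ?_)
      · rw [abs_neg, abs_mul, abs_mul, abs_of_pos (by norm_num : (0 : ℝ) < 3)]; gcongr
      · rw [abs_mul, abs_mul, abs_of_nonneg (by positivity : 0 ≤ n * v ^ 2),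
          abs_of_pos (by norm_num : (0 : ℝ) < 2)]
        gcongr
    rw [abs_div, abs_of_pos hsm0, div_eq_mul_one_div]
    calc _ ≤ (3 * (L / √n) * |R2| + 2 * (L ^ 2 * (L / √n))) * (L / √n) := by gcongr
      _ = 3 * L ^ 2 * (|R2| / (√n * √n)) + 2 * L ^ 4 / (√n * √n) := by field_simp
      _ = 3 * L ^ 2 * (|R2| / n) + 2 * L ^ 4 / n := by rw [hsn]
      _ ≤ 3 * L ^ 2 * ((Q / n + 1) / √n) + 2 * L ^ 4 / √n := by gcongr
      _ = (3 * L ^ 2 * (Q / n + 1) + 2 * L ^ 4 * 1) / √n := by ring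
      _ ≤ (3 * L ^ 5 * (Q / n + 1) + 2 * L ^ 5 * (Q / n + 1)) / √n := by
          gcongr
          · norm_num
          · norm_num
          · linarith
      _ = _ := by ring
  calc _ ≤ _ := abs_add_le _ _
    _ ≤ _ := add_le_add t1 t2
    _ = _ := by ring

lemma quartic_error_eq (hm : 0 < m) (hn : 0 < n) {S1 S2 S4 R2 R4 v W2 W3 W4 Y4 : ℝ}
    (hW2e : W2 = (R2 + n) - n * v ^ 2) (hR4 : Y4 = R4 + 3 * n) :
    ((S4 + 3 * m) / n + 6 * (S2 + m) * W2 / (n * m) + 4 * S1 * W3 / (√n * (m * √m)) + W4 / m)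
      - (3 * m / n + 6 + 3 * n / m)
      = S4 / n + 6 * (S2 * (W2 / m)) / n + 6 * (R2 / n - n * v ^ 2 / n)
        + 4 * (S1 * (W3 * √n / (m * √m))) / n + ((W4 - Y4) / m + R4 * (1 / m)) := by
  have hsm0 : 0 < √(m : ℝ) := by positivity
  have hsn0 : 0 < √(n : ℝ) := by positivity
  have hm0 : (0 : ℝ) < m := by positivity
  have hn0 : (0 : ℝ) < n := by positivity
  have hsn : √(n : ℝ) * √n = n := Real.mul_self_sqrt (by positivity)
  have e2 : 6 * (S2 + m) * W2 / (n * m) = 6 * (S2 * (W2 / m)) / n + 6 * (W2 / n) := by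
    field_simp
  have e3 : W2 / n = (R2 / n - n * v ^ 2 / n) + 1 := by rw [hW2e]; field_simp; ring
  have e4 : 4 * S1 * W3 / (√n * (m * √m)) = 4 * (S1 * (W3 * √n / (m * √m))) / n := by
    nth_rw 3 [← hsn]
    field_simp
  have e5 : W4 / m = (W4 - Y4) / m + R4 * (1 / m) + 3 * n / m := by
    rw [hR4]; field_simp; ring
  have e6 : (S4 + 3 * m) / n = S4 / n + 3 * m / n := by rw [add_div]
  rw [e2, e4, e5, e6, e3]
  ring

lemma quartic_terms_le (hm : 0 < m) (hn : 0 < n) (hL : 1 ≤ L)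
    (hnm : (n : ℝ) ≤ L * m) {S1 S2 S4 R2 R4 v W2 W3 W4 Y4 X : ℝ} (hv : |v| ≤ L / √n)
    (hX1 : 1 / √n ≤ X) (b1 : |S1| / n ≤ X) (b2 : |S2| / n ≤ X) (b4 : |S4| / n ≤ X)
    (r2 : |R2| / n ≤ X) (r4 : |R4| / n ≤ X)
    (hW2 : |W2| ≤ 4 * L ^ 6 * m) (hW3 : |W3| ≤ 8 * L ^ 9 * (m * √m) / √n)
    (hW4 : |W4 - Y4| ≤ n * (108 * L ^ 13 / √n)) :
    |S4 / n + 6 * (S2 * (W2 / m)) / n + 6 * (R2 / n - n * v ^ 2 / n)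
        + 4 * (S1 * (W3 * √n / (m * √m))) / n + ((W4 - Y4) / m + R4 * (1 / m))|
      ≤ (1 + 24 * L ^ 6 + 6 + 6 * L ^ 2 + 32 * L ^ 9 + 108 * L ^ 14 + L) * X := by
  have hsm0 : 0 < √(m : ℝ) := by positivity
  have hsn0 : 0 < √(n : ℝ) := by positivity
  have hm0 : (0 : ℝ) < m := by positivity
  have hn0 : (0 : ℝ) < n := by positivity
  have hL0 : 0 < L := by linarith
  have h1n : (1 : ℝ) ≤ n := by exact_mod_cast hn
  have hsqle : √(n : ℝ) ≤ n := Real.sqrt_le_self_iff.2 (Or.inr h1n)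
  have hmle : 1 / (m : ℝ) ≤ L / n := by
    rw [div_le_div_iff₀ hm0 hn0]; linarith
  have hX0 : 0 ≤ X := le_trans (by positivity) hX1
  have p1 : |S4 / n| ≤ X := by rw [abs_div, abs_of_pos hn0]; exact b4
  have p2 : |6 * (S2 * (W2 / m)) / n| ≤ 24 * L ^ 6 * X := by
    have h6 : |W2 / m| ≤ 4 * L ^ 6 := by
      rw [abs_div, abs_of_pos hm0, div_le_iff₀ hm0]; exact hW2
    rw [abs_div, abs_mul, abs_mul, abs_of_pos hn0, abs_of_pos (by norm_num : (0 : ℝ) < 6)]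
    calc _ = 6 * |W2 / m| * (|S2| / n) := by ring
      _ ≤ 6 * (4 * L ^ 6) * X := by gcongr
      _ = _ := by ring
  have p3 : |6 * (R2 / n - n * v ^ 2 / n)| ≤ 6 * X + 6 * L ^ 2 * X := by
    have hv2 : n * v ^ 2 ≤ L ^ 2 := by
      rw [← sq_abs v]
      calc n * |v| ^ 2 ≤ n * (L / √n) ^ 2 := by gcongr
        _ = L ^ 2 := by rw [div_pow, Real.sq_sqrt (by positivity)]; field_simp
    rw [abs_mul, abs_of_pos (by norm_num : (0 : ℝ) < 6)]
    have h7 : |n * v ^ 2 / n| ≤ L ^ 2 * X := by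
      rw [abs_of_nonneg (by positivity)]
      calc _ ≤ L ^ 2 / √n := by gcongr
        _ = L ^ 2 * (1 / √n) := by ring
        _ ≤ _ := by gcongr
    have h5 := abs_sub (R2 / n) (n * v ^ 2 / n)
    rw [abs_div R2, abs_of_pos hn0] at h5
    linarith
  have p4 : |4 * (S1 * (W3 * √n / (m * √m))) / n| ≤ 32 * L ^ 9 * X := by
    have h8 : |W3 * √n / (m * √m)| ≤ 8 * L ^ 9 := by
      rw [abs_div, abs_mul, abs_of_pos hsn0, abs_of_pos (by positivity : 0 < (m : ℝ) * √m),
        div_le_iff₀ (by positivity), ← le_div_iff₀ hsn0]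
      exact hW3
    rw [abs_div, abs_mul, abs_mul, abs_of_pos hn0, abs_of_pos (by norm_num : (0 : ℝ) < 4)]
    calc _ = 4 * |W3 * √n / (m * √m)| * (|S1| / n) := by ring
      _ ≤ 4 * (8 * L ^ 9) * X := by gcongr
      _ = _ := by ring
  have p5 : |(W4 - Y4) / m| ≤ 108 * L ^ 14 * X := by
    rw [abs_div, abs_of_pos hm0, div_eq_mul_one_div]
    calc _ ≤ n * (108 * L ^ 13 / √n) * (L / n) := by gcongr
      _ = 108 * L ^ 14 * (1 / √n) := by field_simp
      _ ≤ _ := by gcongr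
  have p6 : |R4 * (1 / m)| ≤ L * X := by
    rw [abs_mul, abs_of_pos (by positivity : 0 < 1 / (m : ℝ))]
    calc _ ≤ |R4| * (L / n) := by gcongr
      _ = L * (|R4| / n) := by ring
      _ ≤ _ := by gcongr
  calc _ ≤ |S4 / n| + |6 * (S2 * (W2 / m)) / n| + |6 * (R2 / n - n * v ^ 2 / n)|
        + |4 * (S1 * (W3 * √n / (m * √m))) / n| + (|(W4 - Y4) / m| + |R4 * (1 / m)|) := by
        refine (abs_add_le _ _).trans (add_le_add ((abs_add_le _ _).trans (add_le_add
          ((abs_add_le _ _).trans (add_le_add (abs_add_le _ _) le_rfl)) le_rfl)) (abs_add_le _ _))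
    _ ≤ _ := by linarith

lemma quartic_error_le (hm : 0 < m) (hn : 0 < n) (hL : 1 ≤ L)
    (hnm : (n : ℝ) ≤ L * m) {S1 S2 S4 R2 R4 v W2 W3 W4 Y4 Q : ℝ} (hv : |v| ≤ L / √n)
    (hQ : S1 ^ 2 + S2 ^ 2 + S4 ^ 2 + R2 ^ 2 + R4 ^ 2 ≤ Q)
    (hW2 : |W2| ≤ 4 * L ^ 6 * m) (hW2e : W2 = (R2 + n) - n * v ^ 2)
    (hW3 : |W3| ≤ 8 * L ^ 9 * (m * √m) / √n)
    (hW4 : |W4 - Y4| ≤ n * (108 * L ^ 13 / √n)) (hR4 : Y4 = R4 + 3 * n) :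
    |((S4 + 3 * m) / n + 6 * (S2 + m) * W2 / (n * m) + 4 * S1 * W3 / (√n * (m * √m)) + W4 / m)
      - (3 * m / n + 6 + 3 * n / m)| ≤ 178 * L ^ 14 * (Q / n + 1) / √n := by
  have hQ0 : 0 ≤ Q := le_trans (by positivity) hQ
  have hQn : 0 ≤ Q / n := by positivity
  rw [quartic_error_eq hm hn hW2e hR4]
  have hX1 : 1 / √(n : ℝ) ≤ (Q / n + 1) / √n := by gcongr; linarith
  refine (quartic_terms_le hm hn hL hnm hv hX1
    (abs_div_le_fluct hn (by linarith [sq_nonneg S2, sq_nonneg S4, sq_nonneg R2, sq_nonneg R4]))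
    (abs_div_le_fluct hn (by linarith [sq_nonneg S1, sq_nonneg S4, sq_nonneg R2, sq_nonneg R4]))
    (abs_div_le_fluct hn (by linarith [sq_nonneg S2, sq_nonneg S1, sq_nonneg R2, sq_nonneg R4]))
    (abs_div_le_fluct hn (by linarith [sq_nonneg S2, sq_nonneg S4, sq_nonneg S1, sq_nonneg R4]))
    (abs_div_le_fluct hn (by linarith [sq_nonneg S2, sq_nonneg S4, sq_nonneg R2, sq_nonneg S1]))
    hW2 hW3 hW4).trans ?_
  have q1 : (1 : ℝ) ≤ L ^ 14 := one_le_pow₀ hL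
  have q2 : L ≤ L ^ 14 := le_self_pow₀ hL (by norm_num)
  have q3 : L ^ 2 ≤ L ^ 14 := pow_le_pow_right₀ hL (by norm_num)
  have q4 : L ^ 6 ≤ L ^ 14 := pow_le_pow_right₀ hL (by norm_num)
  have q5 : L ^ 9 ≤ L ^ 14 := pow_le_pow_right₀ hL (by norm_num)
  rw [mul_div_assoc]
  refine mul_le_mul_of_nonneg_right ?_ (by positivity)
  linarith

end Quad

section BoxError

variable {m n : ℕ} {L : ℝ}

/-- The leading part of the cubic form on the box. -/
noncomputable def cubicMain (p : (Fin m → ℝ) × (Fin n → ℝ)) : ℝ :=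
  (∑ j, (p.1 j ^ 3 + 3 * n / m * p.1 j)) / √n + (∑ k, (p.2 k ^ 3 + (-3) * p.2 k)) / √m

lemma fluct_nonneg (p : (Fin m → ℝ) × (Fin n → ℝ)) : 0 ≤ fluct p := by
  unfold fluct; positivity

lemma cubic_box_error_le (hm : 0 < m) (hn : 0 < n) (hL : 1 ≤ L)
    (hnm : (n : ℝ) ≤ L * m) {p : (Fin m → ℝ) × (Fin n → ℝ)} (hp : p ∈ boxSet m n L) :
    |∑ j, ∑ k, cell p.1 p.2 j k ^ 3 - cubicMain p| ≤ 8 * L ^ 5 * (fluct p / n + 1) / √n := by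
  rw [sum_cell_pow_three hm hn, cubicMain, add_sub_cancel_left]
  refine cubic_error_le hm hn hL hnm hp.2 ?_
  unfold fluct
  linarith [sq_nonneg (∑ j, (p.1 j ^ 2 - 1)), sq_nonneg (∑ j, (p.1 j ^ 4 - 3)),
    sq_nonneg (∑ k, (p.2 k ^ 4 - 3))]

lemma quartic_box_error_le (hm : 0 < m) (hn : 0 < n) (hL : 1 ≤ L) (hmn : (m : ℝ) ≤ L * n)
    (hnm : (n : ℝ) ≤ L * m) {p : (Fin m → ℝ) × (Fin n → ℝ)} (hp : p ∈ boxSet m n L) :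
    |∑ j, ∑ k, cell p.1 p.2 j k ^ 4 - (3 * m / n + 6 + 3 * n / m)|
      ≤ 178 * L ^ 14 * (fluct p / n + 1) / √n := by
  obtain ⟨h1, h2, h3, h4, h5⟩ := abs_sub_avg_of_box hm hn hL hmn hp
  obtain ⟨hW2, hW3⟩ := colSet_moments hm hn hL (boxSet_subset hm hn hL hmn hp).2
  have hsq : L ^ 4 ≥ 0 := by positivity
  rw [sum_cell_pow_four hm hn]
  have e4 : ∑ j, p.1 j ^ 4 = ∑ j, (p.1 j ^ 4 - 3) + 3 * m := by
    rw [Finset.sum_sub_distrib]; simp; ring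
  have e2 : ∑ j, p.1 j ^ 2 = ∑ j, (p.1 j ^ 2 - 1) + m := by
    rw [Finset.sum_sub_distrib]; simp
  rw [e4, e2]
  refine quartic_error_le hm hn hL hnm (R2 := ∑ k, (p.2 k ^ 2 - 1)) (R4 := ∑ k, (p.2 k ^ 4 - 3))
    (Y4 := ∑ k, p.2 k ^ 4) h5 le_rfl ?_ ?_ hW3 ?_ ?_
  · rwa [abs_of_nonneg (by positivity)]
  · rw [sum_sub_avg_sq hn, Finset.sum_sub_distrib]; simp
  · exact abs_sum_pow_four_sub_le hL h4 (fun k => (h3 k).trans (by linarith)) h5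
  · rw [Finset.sum_sub_distrib]; simp; ring

variable {Φ : ℝ → ℂ} {b3 b4 b5 : ℝ}

lemma norm_sum_cell_sub_le (hn : 0 < n) (hL : 1 ≤ L) (hmn : (m : ℝ) ≤ L * n)
    (hΦ : ∀ z : ℝ, ‖Φ z + Complex.I * b3 * (z : ℂ) ^ 3 - b4 * (z : ℂ) ^ 4‖ ≤ b5 * |z| ^ 5)
    (hb5L : b5 ≤ L ^ 2)
    {p : (Fin m → ℝ) × (Fin n → ℝ)} (hp : p ∈ boxSet m n L) :
    ‖∑ j, ∑ k, Φ (cell p.1 p.2 j k) - (((b4 * ∑ j, ∑ k, cell p.1 p.2 j k ^ 4 : ℝ) : ℂ)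
      - Complex.I * ((b3 * ∑ j, ∑ k, cell p.1 p.2 j k ^ 3 : ℝ) : ℂ))‖ ≤ L ^ 18 / √n := by
  have hsn0 : 0 < √(n : ℝ) := by positivity
  have hn0 : (0 : ℝ) < n := by positivity
  have hsn : √(n : ℝ) ^ 2 = n := Real.sq_sqrt (by positivity)
  have e : ∑ j, ∑ k, Φ (cell p.1 p.2 j k) - (((b4 * ∑ j, ∑ k, cell p.1 p.2 j k ^ 4 : ℝ) : ℂ)
      - Complex.I * ((b3 * ∑ j, ∑ k, cell p.1 p.2 j k ^ 3 : ℝ) : ℂ))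
      = ∑ j, ∑ k, (Φ (cell p.1 p.2 j k) + Complex.I * b3 * (cell p.1 p.2 j k : ℂ) ^ 3
        - b4 * (cell p.1 p.2 j k : ℂ) ^ 4) := by
    simp only [Finset.sum_add_distrib, Finset.sum_sub_distrib, ← Finset.mul_sum]
    push_cast
    ring
  rw [e]
  have hterm : ∀ j k, ‖Φ (cell p.1 p.2 j k) + Complex.I * b3 * (cell p.1 p.2 j k : ℂ) ^ 3
        - b4 * (cell p.1 p.2 j k : ℂ) ^ 4‖ ≤ L ^ 2 * (L ^ 3 / √n) ^ 5 := by
    intro j k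
    refine (hΦ _).trans ?_
    have := hp.1 j k
    gcongr
  calc _ ≤ ∑ j, ∑ k, L ^ 2 * (L ^ 3 / √(n : ℝ)) ^ 5 :=
        (norm_sum_le _ _).trans (Finset.sum_le_sum fun j _ => (norm_sum_le _ _).trans
          (Finset.sum_le_sum fun k _ => hterm j k))
    _ = m * (n * (L ^ 17 / (√n ^ 2 * √n ^ 2 * √n))) := by
        simp only [Finset.sum_const, Finset.card_univ, Fintype.card_fin, nsmul_eq_mul]
        rw [div_pow]; ring
    _ = m * (L ^ 17 / (n * √n)) := by rw [hsn]; field_simp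
    _ ≤ (L * n) * (L ^ 17 / (n * √n)) := by gcongr
    _ = L ^ 18 / √n := by field_simp

lemma norm_box_error_le (hm : 0 < m) (hn : 0 < n) (hL : 1 ≤ L) (hmn : (m : ℝ) ≤ L * n)
    (hnm : (n : ℝ) ≤ L * m)
    (hΦ : ∀ z : ℝ, ‖Φ z + Complex.I * b3 * (z : ℂ) ^ 3 - b4 * (z : ℂ) ^ 4‖ ≤ b5 * |z| ^ 5)
    (hb3 : |b3| ≤ L) (hb4 : 0 ≤ b4) (hb4L : b4 ≤ L) (hb5L : b5 ≤ L ^ 2)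
    {p : (Fin m → ℝ) × (Fin n → ℝ)} (hp : p ∈ boxSet m n L) :
    ‖∑ j, ∑ k, Φ (cell p.1 p.2 j k) - (((b4 * (3 * m / n + 6 + 3 * n / m) : ℝ) : ℂ)
      + Complex.I * ((-b3 * cubicMain p : ℝ) : ℂ))‖ ≤ 187 * L ^ 18 * (fluct p / n + 1) / √n := by
  have h0 := norm_sum_cell_sub_le hn hL hmn hΦ hb5L hp
  have h3 := cubic_box_error_le hm hn hL hnm hp
  have h4 := quartic_box_error_le hm hn hL hmn hnm hp
  have hQ : 0 ≤ fluct p / n := div_nonneg (fluct_nonneg p) (by positivity)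
  have h3' : ‖(b3 : ℂ) * ((∑ j, ∑ k, cell p.1 p.2 j k ^ 3 - cubicMain p : ℝ) : ℂ)‖
      ≤ L * (8 * L ^ 5 * (fluct p / n + 1) / √n) := by
    rw [norm_mul, Complex.norm_real, Complex.norm_real]
    exact mul_le_mul hb3 h3 (abs_nonneg _) (by linarith)
  have h4' : ‖(b4 : ℂ) * ((∑ j, ∑ k, cell p.1 p.2 j k ^ 4
      - (3 * m / n + 6 + 3 * n / m) : ℝ) : ℂ)‖ ≤ L * (178 * L ^ 14 * (fluct p / n + 1) / √n) := by
    rw [norm_mul, Complex.norm_real, Complex.norm_real]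
    exact mul_le_mul (by rwa [Real.norm_of_nonneg hb4]) h4 (abs_nonneg _) (by linarith)
  generalize ∑ j, ∑ k, cell p.1 p.2 j k ^ 3 = T3 at *
  generalize ∑ j, ∑ k, cell p.1 p.2 j k ^ 4 = T4 at *
  generalize ∑ j, ∑ k, Φ (cell p.1 p.2 j k) = F at *
  have e : F - (((b4 * (3 * m / n + 6 + 3 * n / m) : ℝ) : ℂ)
      + Complex.I * ((-b3 * cubicMain p : ℝ) : ℂ))
      = (F - (((b4 * T4 : ℝ) : ℂ) - Complex.I * ((b3 * T3 : ℝ) : ℂ)))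
        + (b4 : ℂ) * ((T4 - (3 * m / n + 6 + 3 * n / m) : ℝ) : ℂ)
        - Complex.I * ((b3 : ℂ) * ((T3 - cubicMain p : ℝ) : ℂ)) := by
    push_cast; ring
  rw [e]
  have hI : ‖Complex.I * ((b3 : ℂ) * ((T3 - cubicMain p : ℝ) : ℂ))‖
      = ‖(b3 : ℂ) * ((T3 - cubicMain p : ℝ) : ℂ)‖ := by
    rw [norm_mul, Complex.norm_I, one_mul]
  have k1 : 1 * L ^ 6 ≤ 1 * L ^ 18 := pow_bound_of_le hL (by norm_num) (by norm_num)
  have k2 : 1 * L ^ 15 ≤ 1 * L ^ 18 := pow_bound_of_le hL (by norm_num) (by norm_num)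
  calc _ ≤ ‖F - (((b4 * T4 : ℝ) : ℂ) - Complex.I * ((b3 * T3 : ℝ) : ℂ))‖
        + ‖(b4 : ℂ) * ((T4 - (3 * m / n + 6 + 3 * n / m) : ℝ) : ℂ)‖
        + ‖(b3 : ℂ) * ((T3 - cubicMain p : ℝ) : ℂ)‖ := by
        rw [← hI]; exact (norm_sub_le _ _).trans (add_le_add (norm_add_le _ _) le_rfl)
    _ ≤ L ^ 18 / √n + L * (178 * L ^ 14 * (fluct p / n + 1) / √n)
        + L * (8 * L ^ 5 * (fluct p / n + 1) / √n) := by gcongr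
    _ = (L ^ 18 * 1 + (178 * L ^ 15 + 8 * L ^ 6) * (fluct p / n + 1)) / √n := by ring
    _ ≤ (L ^ 18 * (fluct p / n + 1) + (178 * L ^ 18 + 8 * L ^ 18) * (fluct p / n + 1)) / √n := by
        gcongr
        · linarith
        · linarith
        · linarith
    _ = _ := by ring

lemma re_sum_cell_le (hn : 0 < n) (hL : 1 ≤ L) (hmn : (m : ℝ) ≤ L * n)
    (hΦ : ∀ z : ℝ, ‖Φ z + Complex.I * b3 * (z : ℂ) ^ 3 - b4 * (z : ℂ) ^ 4‖ ≤ b5 * |z| ^ 5)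
    (hb5L : b5 ≤ L ^ 2)
    {p : (Fin m → ℝ) × (Fin n → ℝ)} (hp : p ∈ boxSet m n L) :
    (∑ j, ∑ k, Φ (cell p.1 p.2 j k)).re ≤ b4 * ∑ j, ∑ k, cell p.1 p.2 j k ^ 4 + L ^ 18 / √n := by
  have h := (Complex.re_le_norm _).trans (norm_sum_cell_sub_le hn hL hmn hΦ hb5L hp)
  rw [Complex.sub_re, Complex.sub_re, Complex.ofReal_re, Complex.I_mul_re, Complex.ofReal_im] at h
  linarith

lemma norm_exp_sub_exp_I_le (z : ℂ) (c h : ℝ) :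
    ‖Complex.exp (z - c) - Complex.exp (Complex.I * h)‖
      ≤ (exp (z.re - c) - 1) + 3 * ‖z - (c + Complex.I * h)‖ := by
  set w := z - (c + Complex.I * h) with hw
  have e1 : Complex.exp (z - c) - Complex.exp (Complex.I * h)
      = Complex.exp (Complex.I * h) * (Complex.exp (w.im * Complex.I) *
        ((exp w.re - 1 : ℝ) : ℂ) + (Complex.exp (Complex.I * w.im) - 1)) := by
    have e2 : z - c = Complex.I * h + (w.im * Complex.I + w.re) := by
      rw [add_comm (_ * Complex.I), Complex.re_add_im, hw]; ring
    rw [e2, Complex.exp_add, Complex.exp_add]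
    push_cast
    rw [mul_comm Complex.I (w.im : ℂ)]
    ring
  have e3 : w.re = z.re - c := by rw [hw]; simp
  rw [e1, norm_mul, mul_comm Complex.I, Complex.norm_exp_ofReal_mul_I, one_mul, ← e3]
  have h1 : ‖Complex.exp (Complex.I * w.im) - 1‖ ≤ |w.im| := by
    have := Real.norm_exp_I_mul_ofReal_sub_one_le (x := w.im)
    simpa using this
  have h2 : ‖Complex.exp (w.im * Complex.I) * ((exp w.re - 1 : ℝ) : ℂ)‖ ≤ exp w.re - 1 + 2 * |w.re| := by
    rw [norm_mul, Complex.norm_exp_ofReal_mul_I, one_mul, Complex.norm_real, Real.norm_eq_abs,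
      abs_le]
    have := Real.add_one_le_exp w.re
    have := neg_abs_le w.re
    have := abs_nonneg w.re
    constructor <;> linarith
  have := Complex.abs_re_le_norm w
  have := Complex.abs_im_le_norm w
  refine (norm_add_le _ _).trans ?_
  linarith

end BoxError

section GaussMain

variable {m n : ℕ} {L : ℝ} {Φ : ℝ → ℂ} {b3 b4 b5 : ℝ}

lemma isCompact_boxSet (hm : 0 < m) (hn : 0 < n) (hL : 1 ≤ L) (hmn : (m : ℝ) ≤ L * n) :
    IsCompact (boxSet m n L) :=
  ((isCompact_univ_pi fun _ => isCompact_Icc).prod isCompact_colSet).of_isClosed_subset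
    isClosed_boxSet (boxSet_subset hm hn hL hmn)

lemma integral_re_box_le (hm : 0 < m) (hn : 0 < n) (hL : 1 ≤ L) (hmn : (m : ℝ) ≤ L * n)
    (hnm : (n : ℝ) ≤ L * m) (hΦc : Continuous Φ)
    (hΦ : ∀ z : ℝ, ‖Φ z + Complex.I * b3 * (z : ℂ) ^ 3 - b4 * (z : ℂ) ^ 4‖ ≤ b5 * |z| ^ 5)
    (hb4 : 0 ≤ b4) (hb4L : b4 ≤ L) (hb5L : b5 ≤ L ^ 2) (hLn : 20002 * L ^ 21 ≤ √n) :
    ∫ p in boxSet m n L, exp (∑ j, ∑ k, Φ (cell p.1 p.2 j k)).re ∂(gaussPair m n)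
      ≤ exp (b4 * (3 * m / n + 6 + 3 * n / m)) * (1 + 20002 * L ^ 21 / √n) := by
  have hsn0 : 0 < √(n : ℝ) := by positivity
  have hK := isCompact_boxSet hm hn hL hmn
  have hcell : ∀ j k, Continuous fun p : (Fin m → ℝ) × (Fin n → ℝ) => cell p.1 p.2 j k :=
    continuous_cell
  have h1 : IntegrableOn (fun p : (Fin m → ℝ) × (Fin n → ℝ) =>
      exp (∑ j, ∑ k, Φ (cell p.1 p.2 j k)).re) (boxSet m n L) (gaussPair m n) := by
    refine ContinuousOn.integrableOn_compact hK (Continuous.continuousOn ?_)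
    refine continuous_exp.comp (Complex.continuous_re.comp ?_)
    exact continuous_finsetSum _ fun j _ => continuous_finsetSum _ fun k _ =>
      hΦc.comp (hcell j k)
  have h2 : IntegrableOn (fun p : (Fin m → ℝ) × (Fin n → ℝ) =>
      exp (L ^ 18 / √n) * exp (b4 * ∑ j, ∑ k, cell p.1 p.2 j k ^ 4))
      (boxSet m n L) (gaussPair m n) := by
    refine ContinuousOn.integrableOn_compact hK (Continuous.continuousOn ?_)
    refine continuous_const.mul (continuous_exp.comp (continuous_const.mul ?_))
    exact continuous_finsetSum _ fun j _ => continuous_finsetSum _ fun k _ => (hcell j k).pow 4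
  have hx : 10001 * L ^ 21 / √n ≤ 1 := by
    rw [div_le_one hsn0]; linarith [pow_pos (by linarith : 0 < L) 21]
  have k1 : 1 * L ^ 18 ≤ 1 * L ^ 21 := pow_bound_of_le hL (by norm_num) (by norm_num)
  calc _ ≤ ∫ p in boxSet m n L, exp (L ^ 18 / √n) *
          exp (b4 * ∑ j, ∑ k, cell p.1 p.2 j k ^ 4) ∂(gaussPair m n) := by
        refine setIntegral_mono_on h1 h2 measurableSet_boxSet fun p hp => ?_
        rw [← exp_add, exp_le_exp]
        linarith [re_sum_cell_le hn hL hmn hΦ hb5L hp]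
    _ ≤ exp (L ^ 18 / √n) * exp (b4 * (3 * m / n + 6 + 3 * n / m) + 10000 * L ^ 21 / √n) := by
        rw [integral_const_mul]
        gcongr
        exact integral_exp_quartic_box_le hm hn hL hmn hnm hb4 hb4L
          (by linarith [pow_pos (by linarith : 0 < L) 21])
    _ ≤ exp (b4 * (3 * m / n + 6 + 3 * n / m) + 10001 * L ^ 21 / √n) := by
        rw [← exp_add, exp_le_exp]
        have : L ^ 18 / √n ≤ L ^ 21 / √n := by gcongr; linarith
        have e : 10001 * L ^ 21 / √n = L ^ 21 / √n + 10000 * L ^ 21 / √n := by ring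
        linarith
    _ = exp (b4 * (3 * m / n + 6 + 3 * n / m)) * exp (10001 * L ^ 21 / √n) := exp_add _ _
    _ ≤ _ := by
        gcongr
        have h0 : 0 ≤ 10001 * L ^ 21 / √n := by positivity
        have := Real.abs_exp_sub_one_le (x := 10001 * L ^ 21 / √n) (by rwa [abs_of_nonneg h0])
        rw [abs_of_nonneg h0] at this
        have h3 := (abs_le.1 this).2
        have e : 20002 * L ^ 21 / √n = 2 * (10001 * L ^ 21 / √n) := by ring
        linarith

lemma charfun_error_le (hn : 0 < n) (hL : 1 ≤ L) (hmn : (m : ℝ) ≤ L * n) {α κ : ℝ}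
    (hα : |α| ≤ L ^ 2 / √n) (hκ : |κ| ≤ 3 * L) :
    m * ((|α| ^ 3 + α ^ 4) * (400000 * (1 + κ ^ 4))) ≤ 65600000 * L ^ 13 / √n := by
  have hsn0 : 0 < √(n : ℝ) := by positivity
  have hn0 : (0 : ℝ) < n := by positivity
  have hsn : √(n : ℝ) ^ 2 = n := Real.sq_sqrt (by positivity)
  have h1n : (1 : ℝ) ≤ √n := Real.one_le_sqrt.2 (by exact_mod_cast hn)
  have h1 : κ ^ 4 ≤ 81 * L ^ 4 := by
    calc κ ^ 4 = |κ| ^ 4 := ((Even.pow_abs (by decide) κ)).symm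
      _ ≤ (3 * L) ^ 4 := by gcongr
      _ = _ := by ring
  have h2 : (1 : ℝ) ≤ L ^ 4 := one_le_pow₀ hL
  have h4 : 1 * L ^ 6 ≤ 1 * L ^ 8 := pow_bound_of_le hL (by norm_num) (by norm_num)
  have h3 : |α| ^ 3 + α ^ 4 ≤ 2 * L ^ 8 / (n * √n) := by
    calc |α| ^ 3 + α ^ 4 = |α| ^ 3 + |α| ^ 4 := by rw [show |α| ^ 4 = α ^ 4 from Even.pow_abs (by decide) α]
      _ ≤ (L ^ 2 / √n) ^ 3 + (L ^ 2 / √n) ^ 4 := by gcongr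
      _ = L ^ 6 / (√n ^ 2 * √n) + L ^ 8 / (√n ^ 2 * √n) / √n := by rw [div_pow, div_pow]; field_simp
      _ = L ^ 6 / (n * √n) + L ^ 8 / (n * √n) / √n := by rw [hsn]
      _ ≤ L ^ 8 / (n * √n) + L ^ 8 / (n * √n) := by
          have h5 : L ^ 8 / (n * √n) / √n ≤ L ^ 8 / (n * √n) := div_le_self (by positivity) h1n
          have h6 : L ^ 6 / (n * √n) ≤ L ^ 8 / (n * √n) := by gcongr; linarith
          linarith
      _ = _ := by ring
  calc _ ≤ (L * n) * (2 * L ^ 8 / (n * √n) * (400000 * (L ^ 4 + 81 * L ^ 4))) := by gcongr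
    _ = _ := by field_simp; norm_num

lemma integrable_cexp_I_mul {α : Type*} [MeasurableSpace α] {μ : Measure α} [IsFiniteMeasure μ]
    {f : α → ℝ} (hf : Measurable f) :
    Integrable (fun x => Complex.exp (Complex.I * (f x : ℂ))) μ := by
  refine Integrable.of_bound (C := 1) ?_ (Filter.Eventually.of_forall fun x => ?_)
  · exact (Measurable.aestronglyMeasurable (by fun_prop))
  · rw [mul_comm, Complex.norm_exp_ofReal_mul_I]

lemma norm_integral_cubicMain_sub_le (hm : 0 < m) (hn : 0 < n) (hL : 1 ≤ L)
    (hmn : (m : ℝ) ≤ L * n) (hnm : (n : ℝ) ≤ L * m) (hb3 : |b3| ≤ L) :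
    ‖∫ p, Complex.exp (Complex.I * ((-b3 * cubicMain p : ℝ) : ℂ)) ∂(gaussPair m n)
      - (exp (-(b3 ^ 2 * (15 * m / n + 18 + 15 * n / m) / 2)) : ℝ)‖
      ≤ 131200000 * L ^ 14 / √n := by
  have hsn0 : 0 < √(n : ℝ) := by positivity
  have hsm0 : 0 < √(m : ℝ) := by positivity
  have hn0 : (0 : ℝ) < n := by positivity
  have hm0 : (0 : ℝ) < m := by positivity
  have hL0 : 0 < L := by linarith
  have hsn : √(n : ℝ) ^ 2 = n := Real.sq_sqrt (by positivity)
  have hsm : √(m : ℝ) ^ 2 = m := Real.sq_sqrt (by positivity)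
  set κ : ℝ := 3 * n / m with hκ
  have e : ∀ p : (Fin m → ℝ) × (Fin n → ℝ),
      Complex.exp (Complex.I * ((-b3 * cubicMain p : ℝ) : ℂ))
      = Complex.exp (Complex.I * (((-b3 / √n) * ∑ j, (p.1 j ^ 3 + κ * p.1 j) : ℝ) : ℂ))
        * Complex.exp (Complex.I * (((-b3 / √m) * ∑ k, (p.2 k ^ 3 + (-3) * p.2 k) : ℝ) : ℂ)) := by
    intro p
    rw [← Complex.exp_add, ← mul_add, ← Complex.ofReal_add, cubicMain]
    congr 3
    ring
  simp only [e]
  rw [gaussPair, integral_prod_mul (fun u : Fin m → ℝ =>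
      Complex.exp (Complex.I * (((-b3 / √n) * ∑ j, (u j ^ 3 + κ * u j) : ℝ) : ℂ)))
    (fun y : Fin n → ℝ =>
      Complex.exp (Complex.I * (((-b3 / √m) * ∑ k, (y k ^ 3 + (-3) * y k) : ℝ) : ℂ)))]
  have h1 := norm_charfun_cubic_pow_sub_le m (-b3 / √n) κ
  have h2 := norm_charfun_cubic_pow_sub_le n (-b3 / √m) (-3)
  have hLL : L ≤ L ^ 2 := le_self_pow₀ hL (by norm_num)
  have a1 : |(-b3 / √(n : ℝ))| ≤ L ^ 2 / √n := by
    rw [abs_div, abs_neg, abs_of_pos hsn0]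
    gcongr
    linarith
  have a2 : |(-b3 / √(m : ℝ))| ≤ L ^ 2 / √n := by
    rw [abs_div, abs_neg, abs_of_pos hsm0, div_le_div_iff₀ hsm0 hsn0]
    calc |b3| * √n ≤ L * (L * √m) := by gcongr; exact sqrt_div_bound hm hL hnm
      _ = _ := by ring
  have k1 : |κ| ≤ 3 * L := by
    rw [hκ, abs_of_nonneg (by positivity), div_le_iff₀ hm0]; linarith
  have k2 : |(-3 : ℝ)| ≤ 3 * L := by rw [abs_neg, abs_of_pos (by norm_num)]; linarith
  have h1' := h1.trans (charfun_error_le hn hL hmn a1 k1)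
  have h2' := h2.trans (charfun_error_le (m := n) hn hL (by nlinarith) a2 k2)
  have b1 : 0 ≤ m * ((-b3 / √(n : ℝ)) ^ 2 * (15 + 6 * κ + κ ^ 2) / 2) := by positivity
  have b2 : 0 ≤ n * ((-b3 / √(m : ℝ)) ^ 2 * (15 + 6 * (-3) + (-3) ^ 2) / 2) := by
    norm_num; positivity
  have ev : exp (-(b3 ^ 2 * (15 * m / n + 18 + 15 * n / m) / 2))
      = exp (-(m * ((-b3 / √(n : ℝ)) ^ 2 * (15 + 6 * κ + κ ^ 2) / 2)))
        * exp (-(n * ((-b3 / √(m : ℝ)) ^ 2 * (15 + 6 * (-3) + (-3) ^ 2) / 2))) := by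
    rw [← exp_add]
    congr 1
    rw [div_pow _ √(n : ℝ), div_pow _ √(m : ℝ), hsn, hsm, hκ]
    field_simp
    ring
  rw [ev]
  set X := ∫ u, Complex.exp (Complex.I * (((-b3 / √n) * ∑ j, (u j ^ 3 + κ * u j) : ℝ) : ℂ))
    ∂(stdGPi m)
  set Y := ∫ u, Complex.exp (Complex.I * (((-b3 / √m) * ∑ k, (u k ^ 3 + (-3) * u k) : ℝ) : ℂ))
    ∂(stdGPi n)
  set x := exp (-(m * ((-b3 / √(n : ℝ)) ^ 2 * (15 + 6 * κ + κ ^ 2) / 2)))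
  set y := exp (-(n * ((-b3 / √(m : ℝ)) ^ 2 * (15 + 6 * (-3) + (-3) ^ 2) / 2)))
  have hx : x ≤ 1 := exp_le_one_iff.2 (by linarith)
  have hx0 : 0 ≤ x := exp_nonneg _
  have hY : ‖Y‖ ≤ 1 := by
    refine (norm_integral_le_integral_norm _).trans ?_
    simp_rw [mul_comm Complex.I, Complex.norm_exp_ofReal_mul_I]
    unfold stdGPi
    simp
  have e3 : X * Y - ((x * y : ℝ) : ℂ) = (X - x) * Y + x * (Y - y) := by push_cast; ring
  rw [e3]
  have e4 : ‖(x : ℂ)‖ ≤ 1 := by rw [Complex.norm_real, Real.norm_of_nonneg hx0]; exact hx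
  have k3 : 65600000 * L ^ 13 ≤ 65600000 * L ^ 14 := pow_bound_of_le hL (by norm_num) (by norm_num)
  calc _ ≤ ‖X - x‖ * ‖Y‖ + ‖(x : ℂ)‖ * ‖Y - y‖ := by
        rw [← norm_mul, ← norm_mul]; exact norm_add_le _ _
    _ ≤ (65600000 * L ^ 13 / √n) * 1 + 1 * (65600000 * L ^ 13 / √n) := by gcongr
    _ ≤ (65600000 * L ^ 14 / √n) * 1 + 1 * (65600000 * L ^ 14 / √n) := by gcongr
    _ = _ := by ring

end GaussMain

section GaussMain

variable {m n : ℕ} {L : ℝ} {Φ : ℝ → ℂ} {b3 b4 b5 : ℝ}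

lemma setIntegral_fluct_le (hn : 0 < n) (hL : 1 ≤ L) (hmn : (m : ℝ) ≤ L * n)
    (S : Set ((Fin m → ℝ) × (Fin n → ℝ))) :
    ∫ p in S, (fluct p / n + 1) ∂(gaussPair m n) ≤ 198 * L := by
  have hn0 : (0 : ℝ) < n := by positivity
  have : IsProbabilityMeasure (gaussPair m n) := by unfold gaussPair stdGPi; infer_instance
  have hi : Integrable (fun p : (Fin m → ℝ) × (Fin n → ℝ) => fluct p / n + 1) (gaussPair m n) :=
    (integrable_fluct.div_const _).add (integrable_const _)
  calc _ ≤ ∫ p, (fluct p / n + 1) ∂(gaussPair m n) := by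
        refine setIntegral_le_integral hi (Filter.Eventually.of_forall fun p => ?_)
        have := div_nonneg (fluct_nonneg p) hn0.le
        simpa using by linarith
    _ = (99 * m + 98 * n) / n + 1 := by
        rw [integral_add (integrable_fluct.div_const _) (integrable_const _), integral_div,
          integral_fluct]
        simp
    _ ≤ (99 * (L * n) + 98 * n) / n + 1 := by gcongr
    _ = 99 * L + 99 := by field_simp; ring
    _ ≤ _ := by linarith

lemma integrable_exp_norm_aux (hm : 0 < m) (hn : 0 < n) (hL : 1 ≤ L) (hmn : (m : ℝ) ≤ L * n)
    {f : (Fin m → ℝ) × (Fin n → ℝ) → ℂ} (hf : Continuous f) :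
    IntegrableOn f (boxSet m n L) (gaussPair m n) :=
  hf.continuousOn.integrableOn_compact (isCompact_boxSet hm hn hL hmn)

lemma continuous_cubicMain :
    Continuous (cubicMain : (Fin m → ℝ) × (Fin n → ℝ) → ℝ) := by
  unfold cubicMain; fun_prop

lemma continuous_sum_cell (hΦc : Continuous Φ) :
    Continuous fun p : (Fin m → ℝ) × (Fin n → ℝ) => ∑ j, ∑ k, Φ (cell p.1 p.2 j k) :=
  continuous_finsetSum _ fun j _ => continuous_finsetSum _ fun k _ =>
    hΦc.comp (continuous_cell j k)

lemma norm_integral_box_sub_le (hm : 0 < m) (hn : 0 < n) (hL : 3 ≤ L) (hmn : (m : ℝ) ≤ L * n)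
    (hnm : (n : ℝ) ≤ L * m) (hΦc : Continuous Φ)
    (hΦ : ∀ z : ℝ, ‖Φ z + Complex.I * b3 * (z : ℂ) ^ 3 - b4 * (z : ℂ) ^ 4‖ ≤ b5 * |z| ^ 5)
    (hb3 : |b3| ≤ L) (hb4 : 0 ≤ b4) (hb4L : b4 ≤ L) (hb5L : b5 ≤ L ^ 2)
    (hLn : 20002 * L ^ 21 ≤ √n) (htail : (m + n + 1) * (2 * exp (-(L ^ 2 / 2))) ≤ 1 / √n)
    {c : ℝ} (hc : c = b4 * (3 * m / n + 6 + 3 * n / m)) :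
    ‖∫ p in boxSet m n L, (Complex.exp (∑ j, ∑ k, Φ (cell p.1 p.2 j k) - c)
        - Complex.exp (Complex.I * ((-b3 * cubicMain p : ℝ) : ℂ))) ∂(gaussPair m n)‖
      ≤ 140000 * L ^ 21 / √n := by
  have hL1 : 1 ≤ L := by linarith
  have hL0 : 0 < L := by linarith
  have hsn0 : 0 < √(n : ℝ) := by positivity
  have : IsProbabilityMeasure (gaussPair m n) := by unfold gaussPair stdGPi; infer_instance
  have hcs := continuous_sum_cell (m := m) (n := n) hΦc
  have hK := isCompact_boxSet hm hn hL1 hmn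
  have i1 : IntegrableOn (fun p : (Fin m → ℝ) × (Fin n → ℝ) =>
      exp ((∑ j, ∑ k, Φ (cell p.1 p.2 j k)).re - c) - 1) (boxSet m n L) (gaussPair m n) := by
    refine ContinuousOn.integrableOn_compact hK (Continuous.continuousOn ?_)
    exact (continuous_exp.comp ((Complex.continuous_re.comp hcs).sub continuous_const)).sub
      continuous_const
  have i2 : Integrable (fun p : (Fin m → ℝ) × (Fin n → ℝ) =>
      561 * L ^ 18 / √n * (fluct p / n + 1)) (gaussPair m n) :=
    ((integrable_fluct.div_const _).add (integrable_const _)).const_mul _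
  have hpt : ∀ p ∈ boxSet m n L, ‖Complex.exp (∑ j, ∑ k, Φ (cell p.1 p.2 j k) - c)
        - Complex.exp (Complex.I * ((-b3 * cubicMain p : ℝ) : ℂ))‖
      ≤ (exp ((∑ j, ∑ k, Φ (cell p.1 p.2 j k)).re - c) - 1)
        + 561 * L ^ 18 / √n * (fluct p / n + 1) := by
    intro p hp
    refine (norm_exp_sub_exp_I_le _ _ _).trans ?_
    have := norm_box_error_le hm hn hL1 hmn hnm hΦ hb3 hb4 hb4L hb5L hp
    rw [← hc] at this
    have e : 561 * L ^ 18 / √n * (fluct p / n + 1)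
      = 3 * (187 * L ^ 18 * (fluct p / n + 1) / √n) := by ring
    rw [e]
    gcongr
  have hB : (gaussPair m n).real (boxSet m n L)ᶜ ≤ 1 / √n :=
    (boxSet_compl_prob hm hn hL hnm).trans htail
  have hre := integral_re_box_le hm hn hL1 hmn hnm hΦc hΦ hb4 hb4L hb5L hLn
  rw [← hc] at hre
  have k1 : 1 ≤ L ^ 21 := one_le_pow₀ hL1
  have k2 : 111078 * L ^ 19 ≤ 111078 * L ^ 21 := pow_bound_of_le hL1 (by norm_num) (by norm_num)
  have hfirst : ∫ p in boxSet m n L, (exp ((∑ j, ∑ k, Φ (cell p.1 p.2 j k)).re - c) - 1)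
      ∂(gaussPair m n) ≤ 20002 * L ^ 21 / √n + 1 / √n := by
    have i3 : IntegrableOn (fun p : (Fin m → ℝ) × (Fin n → ℝ) =>
        exp ((∑ j, ∑ k, Φ (cell p.1 p.2 j k)).re - c)) (boxSet m n L) (gaussPair m n) := by
      refine ContinuousOn.integrableOn_compact hK (Continuous.continuousOn ?_)
      exact (continuous_exp.comp ((Complex.continuous_re.comp hcs).sub continuous_const))
    rw [integral_sub i3 (integrable_const _)]
    simp only [exp_sub, integral_div]
    have h5 : (∫ p in boxSet m n L, exp (∑ j, ∑ k, Φ (cell p.1 p.2 j k)).re ∂(gaussPair m n))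
        / exp c ≤ 1 + 20002 * L ^ 21 / √n := by
      rw [div_le_iff₀ (exp_pos _)]; linarith
    have h6 : 1 - 1 / √(n : ℝ) ≤ (gaussPair m n).real (boxSet m n L) := by
      rw [probReal_compl_eq_one_sub measurableSet_boxSet] at hB
      linarith
    have h7 : ∫ _ in boxSet m n L, (1 : ℝ) ∂(gaussPair m n)
        = (gaussPair m n).real (boxSet m n L) := by simp
    rw [h7]
    linarith
  calc _ ≤ ∫ p in boxSet m n L, ((exp ((∑ j, ∑ k, Φ (cell p.1 p.2 j k)).re - c) - 1)
        + 561 * L ^ 18 / √n * (fluct p / n + 1)) ∂(gaussPair m n) := by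
        refine (norm_integral_le_integral_norm _).trans ?_
        refine setIntegral_mono_on ?_ (i1.add i2.integrableOn) measurableSet_boxSet hpt
        refine ContinuousOn.integrableOn_compact hK (Continuous.continuousOn ?_)
        have := continuous_cubicMain (m := m) (n := n)
        fun_prop
    _ = ∫ p in boxSet m n L, (exp ((∑ j, ∑ k, Φ (cell p.1 p.2 j k)).re - c) - 1) ∂(gaussPair m n)
        + 561 * L ^ 18 / √n * ∫ p in boxSet m n L, (fluct p / n + 1) ∂(gaussPair m n) := by
        rw [integral_add i1 i2.integrableOn, integral_const_mul]
    _ ≤ (20002 * L ^ 21 / √n + 1 / √n) + 561 * L ^ 18 / √n * (198 * L) := by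
        gcongr
        exact setIntegral_fluct_le hn hL1 hmn _
    _ = (20002 * L ^ 21 + 1 + 111078 * L ^ 19) / √n := by ring
    _ ≤ (20002 * L ^ 21 + L ^ 21 + 111078 * L ^ 21) / √n := by gcongr
    _ ≤ _ := by gcongr; linarith

/-- The Gaussian integral over the box, with an explicit error. -/
lemma norm_gauss_box_sub_le (hm : 0 < m) (hn : 0 < n) (hL : 3 ≤ L) (hmn : (m : ℝ) ≤ L * n)
    (hnm : (n : ℝ) ≤ L * m) (hΦc : Continuous Φ)
    (hΦ : ∀ z : ℝ, ‖Φ z + Complex.I * b3 * (z : ℂ) ^ 3 - b4 * (z : ℂ) ^ 4‖ ≤ b5 * |z| ^ 5)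
    (hb3 : |b3| ≤ L) (hb4 : 0 ≤ b4) (hb4L : b4 ≤ L) (hb5L : b5 ≤ L ^ 2)
    (hLn : 20002 * L ^ 21 ≤ √n) (htail : (m + n + 1) * (2 * exp (-(L ^ 2 / 2))) ≤ 1 / √n)
    {c : ℝ} (hc : c = b4 * (3 * m / n + 6 + 3 * n / m)) :
    ‖∫ p in boxSet m n L, Complex.exp (∑ j, ∑ k, Φ (cell p.1 p.2 j k)) ∂(gaussPair m n)
      - (exp (c - b3 ^ 2 * (15 * m / n + 18 + 15 * n / m) / 2) : ℝ)‖
      ≤ exp c * (200000000 * L ^ 21 / √n) := by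
  have hL1 : 1 ≤ L := by linarith
  have hsn0 : 0 < √(n : ℝ) := by positivity
  have : IsProbabilityMeasure (gaussPair m n) := by unfold gaussPair stdGPi; infer_instance
  have hcs := continuous_sum_cell (m := m) (n := n) hΦc
  have hcm := continuous_cubicMain (m := m) (n := n)
  have h1 := norm_integral_box_sub_le hm hn hL hmn hnm hΦc hΦ hb3 hb4 hb4L hb5L hLn htail hc
  have h2 := norm_integral_cubicMain_sub_le hm hn hL1 hmn hnm hb3
  have hB : (gaussPair m n).real (boxSet m n L)ᶜ ≤ 1 / √n :=
    (boxSet_compl_prob hm hn hL hnm).trans htail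
  have i2 : Integrable (fun p : (Fin m → ℝ) × (Fin n → ℝ) =>
      Complex.exp (Complex.I * ((-b3 * cubicMain p : ℝ) : ℂ))) (gaussPair m n) :=
    integrable_cexp_I_mul (by fun_prop)
  have i1 : IntegrableOn (fun p : (Fin m → ℝ) × (Fin n → ℝ) =>
      Complex.exp (∑ j, ∑ k, Φ (cell p.1 p.2 j k) - c)) (boxSet m n L) (gaussPair m n) :=
    integrable_exp_norm_aux hm hn hL1 hmn (by fun_prop)
  rw [integral_sub i1 i2.integrableOn] at h1
  have h3 : ‖∫ p in (boxSet m n L)ᶜ,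
      Complex.exp (Complex.I * ((-b3 * cubicMain p : ℝ) : ℂ)) ∂(gaussPair m n)‖ ≤ 1 / √n := by
    refine (norm_setIntegral_le_of_norm_le_const (C := 1) (measure_lt_top _ _)
      fun p _ => ?_).trans ?_
    · rw [mul_comm, Complex.norm_exp_ofReal_mul_I]
    · rw [one_mul]; exact hB
  have h4 := integral_add_compl (measurableSet_boxSet (m := m) (n := n) (L := L)) i2
  set T := ∫ p, Complex.exp (Complex.I * ((-b3 * cubicMain p : ℝ) : ℂ)) ∂(gaussPair m n)
  set T1 := ∫ p in boxSet m n L, Complex.exp (Complex.I * ((-b3 * cubicMain p : ℝ) : ℂ))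
    ∂(gaussPair m n)
  set T2 := ∫ p in (boxSet m n L)ᶜ, Complex.exp (Complex.I * ((-b3 * cubicMain p : ℝ) : ℂ))
    ∂(gaussPair m n)
  have e1 : ∫ p in boxSet m n L, Complex.exp (∑ j, ∑ k, Φ (cell p.1 p.2 j k)) ∂(gaussPair m n)
      = Complex.exp c * ∫ p in boxSet m n L, Complex.exp (∑ j, ∑ k, Φ (cell p.1 p.2 j k) - c)
        ∂(gaussPair m n) := by
    rw [← integral_const_mul]
    congr 1
    ext p
    rw [← Complex.exp_add]; congr 1; ring
  have e2 : exp (c - b3 ^ 2 * (15 * m / n + 18 + 15 * n / m) / 2)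
      = exp c * exp (-(b3 ^ 2 * (15 * m / n + 18 + 15 * n / m) / 2)) := by
    rw [← exp_add]; congr 1
  rw [e1, e2]
  set V := exp (-(b3 ^ 2 * (15 * m / n + 18 + 15 * n / m) / 2))
  set J := ∫ p in boxSet m n L, Complex.exp (∑ j, ∑ k, Φ (cell p.1 p.2 j k) - c) ∂(gaussPair m n)
  rw [Complex.ofReal_mul, Complex.ofReal_exp, ← mul_sub, norm_mul, Complex.norm_exp,
    Complex.ofReal_re]
  gcongr
  have e3 : J - V = (J - T1) + (T - V) - T2 := by rw [← h4]; ring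
  rw [e3]
  have k1 : 1 ≤ L ^ 21 := one_le_pow₀ hL1
  have k2 : 131200000 * L ^ 14 ≤ 131200000 * L ^ 21 :=
    pow_bound_of_le hL1 (by norm_num) (by norm_num)
  calc _ ≤ ‖J - T1‖ + ‖T - V‖ + ‖T2‖ :=
        (norm_sub_le _ _).trans (add_le_add (norm_add_le _ _) le_rfl)
    _ ≤ 140000 * L ^ 21 / √n + 131200000 * L ^ 14 / √n + 1 / √n := by gcongr
    _ ≤ 140000 * L ^ 21 / √n + 131200000 * L ^ 21 / √n + L ^ 21 / √n := by gcongr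
    _ = 131340001 * L ^ 21 / √n := by ring
    _ ≤ _ := by gcongr; norm_num

end GaussMain

section FourierInversion

instance : IsProbabilityMeasure (volume : Measure UnitAddCircle) := ⟨by simp⟩

/-- The geometric kernel on the circle. -/
noncomputable def geomKernel (l : ℝ) (x : UnitAddCircle) : ℂ := 1 / (1 + l - l * fourier 1 x)

lemma geomKernel_coe (l x : ℝ) :
    geomKernel l (x : UnitAddCircle)
      = 1 / (1 + l - l * Complex.exp (Complex.I * (2 * π * x : ℝ))) := by
  rw [geomKernel, fourier_coe_apply]
  congr 5
  push_cast
  simp only [mul_one, div_one]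
  ring

lemma geomKernel_denom_ne_zero {l : ℝ} (hl : 0 < l) (x : UnitAddCircle) :
    (1 + l - l * fourier 1 x : ℂ) ≠ 0 := by
  obtain ⟨y, rfl⟩ := QuotientAddGroup.mk_surjective x
  have h := geomKernel_coe l y
  have h2 := denom_ne_zero hl (2 * π * y)
  intro h0
  rw [geomKernel, h0, div_zero] at h
  exact one_div_ne_zero h2 h.symm

lemma continuous_geomKernel {l : ℝ} (hl : 0 < l) : Continuous (geomKernel l) := by
  unfold geomKernel
  refine Continuous.div continuous_const ?_ (geomKernel_denom_ne_zero hl)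
  exact continuous_const.sub (continuous_const.mul (map_continuous (fourier 1)))

lemma integral_fourier_eq_ite (k : ℤ) :
    ∫ x : UnitAddCircle, (fourier k x : ℂ) = if k = 0 then 1 else 0 := by
  split_ifs with h
  · simp [h]
  · exact integral_eq_zero_of_add_right_eq_neg (μ := volume) (fourier_add_half_inv_index h one_pos)

lemma norm_fourier_apply (k : ℤ) (x : UnitAddCircle) : ‖(fourier k x : ℂ)‖ = 1 := by
  rw [fourier_apply]; exact Circle.norm_coe _

/-- The geometric law of mean `l`. -/
noncomputable def geomLaw (l : ℝ) (hl : 0 < l) : Measure ℕ :=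
  geometricMeasure ⟨1 / (1 + l), by positivity, by
    rw [div_le_one (by positivity)]; linarith⟩

instance (l : ℝ) (hl : 0 < l) : IsProbabilityMeasure (geomLaw l hl) := by
  unfold geomLaw; infer_instance

lemma geomLaw_real_singleton {l : ℝ} (hl : 0 < l) (k : ℕ) :
    (geomLaw l hl).real {k} = (l / (1 + l)) ^ k * (1 / (1 + l)) := by
  rw [geomLaw, geometricMeasure_real_singleton]
  · congr 2
    field_simp
    ring
  · intro h
    have := congrArg Subtype.val h
    simp only [Set.Icc.coe_zero] at this
    have h2 : 0 < 1 / (1 + l) := by positivity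
    linarith

lemma integral_geomLaw {l : ℝ} (hl : 0 < l) (x : UnitAddCircle) :
    ∫ k : ℕ, (fourier k x : ℂ) ∂(geomLaw l hl) = geomKernel l x := by
  rw [geomLaw, integral_geometricMeasure]
  · have hq : (1 - 1 / (1 + l) : ℝ) = l / (1 + l) := by field_simp; ring
    have h1 : ∀ k : ℕ, (fourier (k : ℤ) x : ℂ) = (fourier 1 x) ^ k := by
      intro k
      induction k with
      | zero => simp
      | succ k ih =>
        push_cast
        rw [fourier_add, ih, pow_succ]
    have hl' : (1 + l : ℂ) ≠ 0 := by exact_mod_cast (by positivity : (1 + l : ℝ) ≠ 0)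
    have hs : ∀ k : ℕ, ((1 - 1 / (1 + l) : ℝ) ^ k * (1 / (1 + l))) • (fourier (k : ℤ) x : ℂ)
        = (1 / (1 + l) : ℂ) * ((l / (1 + l) : ℂ) * fourier 1 x) ^ k := by
      intro k
      rw [h1, hq, Complex.real_smul]
      push_cast
      rw [mul_pow]; ring
    simp only [hs]
    rw [tsum_mul_left, tsum_geometric_of_norm_lt_one, geomKernel]
    · have := geomKernel_denom_ne_zero hl x
      rw [one_div, ← mul_inv, one_div]
      congr 1
      field_simp
    · rw [norm_mul, norm_fourier_apply, mul_one]
      have : ‖(l / (1 + l) : ℂ)‖ = l / (1 + l) := by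
        rw [show (l / (1 + l) : ℂ) = ((l / (1 + l) : ℝ) : ℂ) by push_cast; rfl,
          Complex.norm_real, norm_of_nonneg (by positivity)]
      rw [this, div_lt_one (by positivity)]
      linarith
  · intro h
    have := congrArg Subtype.val h
    simp only [Set.Icc.coe_zero] at this
    have h2 : 0 < 1 / (1 + l) := by positivity
    linarith

/-- The integrand on the torus whose mean counts matrices. -/
noncomputable def torusFun (m n : ℕ) (l : ℝ) (s t : ℕ)
    (p : (Fin m → UnitAddCircle) × (Fin n → UnitAddCircle)) : ℂ :=
  (∏ j, ∏ k, geomKernel l (p.1 j + p.2 k)) *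
    ((∏ j, fourier (-(s : ℤ)) (p.1 j)) * ∏ k, fourier (-(t : ℤ)) (p.2 k))

lemma continuous_torusFun (m n : ℕ) {l : ℝ} (hl : 0 < l) (s t : ℕ) :
    Continuous (torusFun m n l s t) := by
  unfold torusFun
  refine Continuous.mul ?_ (Continuous.mul ?_ ?_)
  · refine continuous_finsetProd _ fun j _ => continuous_finsetProd _ fun k _ => ?_
    exact (continuous_geomKernel hl).comp (by fun_prop)
  · exact continuous_finsetProd _ fun j _ => (map_continuous (fourier _)).comp (by fun_prop)
  · exact continuous_finsetProd _ fun k _ => (map_continuous (fourier _)).comp (by fun_prop)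

/-- The law of a matrix with independent geometric entries. -/
noncomputable def matLaw (m n : ℕ) (l : ℝ) (hl : 0 < l) : Measure (Fin m → Fin n → ℕ) :=
  Measure.pi fun _ => Measure.pi fun _ => geomLaw l hl

instance (m n : ℕ) (l : ℝ) (hl : 0 < l) : IsProbabilityMeasure (matLaw m n l hl) := by
  unfold matLaw; infer_instance

/-- The character attached to a matrix, twisted by the prescribed margins. -/
noncomputable def matChar (m n s t : ℕ) (X : Fin m → Fin n → ℕ)
    (p : (Fin m → UnitAddCircle) × (Fin n → UnitAddCircle)) : ℂ :=
  (∏ j, ∏ k, (fourier (X j k : ℤ) (p.1 j + p.2 k) : ℂ)) *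
    ((∏ j, fourier (-(s : ℤ)) (p.1 j)) * ∏ k, fourier (-(t : ℤ)) (p.2 k))

lemma integral_matChar_matLaw (m n s t : ℕ) {l : ℝ} (hl : 0 < l)
    (p : (Fin m → UnitAddCircle) × (Fin n → UnitAddCircle)) :
    ∫ X, matChar m n s t X p ∂(matLaw m n l hl) = torusFun m n l s t p := by
  unfold matChar torusFun matLaw
  rw [integral_mul_const]
  congr 1
  rw [integral_fintype_prod_eq_prod
    (f := fun j (x : Fin n → ℕ) => ∏ k, (fourier (x k : ℤ) (p.1 j + p.2 k) : ℂ))]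
  refine Finset.prod_congr rfl fun j _ => ?_
  rw [integral_fintype_prod_eq_prod
    (f := fun k (x : ℕ) => (fourier (x : ℤ) (p.1 j + p.2 k) : ℂ))]
  exact Finset.prod_congr rfl fun k _ => integral_geomLaw hl _

lemma fourier_add_apply (k : ℤ) (x y : UnitAddCircle) :
    (fourier k (x + y) : ℂ) = fourier k x * fourier k y := by
  simp only [fourier_apply, zsmul_add, AddCircle.toCircle_add, Circle.coe_mul]

lemma fourier_sum_apply {ι : Type*} (S : Finset ι) (f : ι → ℤ) (x : UnitAddCircle) :
    (fourier (∑ i ∈ S, f i) x : ℂ) = ∏ i ∈ S, fourier (f i) x := by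
  classical
  induction S using Finset.induction_on with
  | empty => simp
  | insert i S hi ih => rw [Finset.sum_insert hi, Finset.prod_insert hi, fourier_add, ih]

lemma matChar_eq (m n s t : ℕ) (X : Fin m → Fin n → ℕ)
    (p : (Fin m → UnitAddCircle) × (Fin n → UnitAddCircle)) :
    matChar m n s t X p
      = (∏ j, (fourier ((∑ k, (X j k : ℤ)) + -(s : ℤ)) (p.1 j) : ℂ)) *
        ∏ k, (fourier ((∑ j, (X j k : ℤ)) + -(t : ℤ)) (p.2 k) : ℂ) := by
  unfold matChar
  simp only [fourier_add_apply, fourier_add, fourier_sum_apply, Finset.prod_mul_distrib]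
  rw [Finset.prod_comm (f := fun j k => (fourier (X j k : ℤ) (p.2 k) : ℂ))]
  ring

open Classical in
lemma integral_matChar (m n s t : ℕ) (X : Fin m → Fin n → ℕ) :
    ∫ p, matChar m n s t X p
      = if (∀ j, ∑ k, X j k = s) ∧ (∀ k, ∑ j, X j k = t) then 1 else 0 := by
  simp only [matChar_eq]
  rw [Measure.volume_eq_prod, integral_prod_mul
    (fun x : Fin m → UnitAddCircle =>
      ∏ j, (fourier ((∑ k, (X j k : ℤ)) + -(s : ℤ)) (x j) : ℂ))
    (fun y : Fin n → UnitAddCircle =>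
      ∏ k, (fourier ((∑ j, (X j k : ℤ)) + -(t : ℤ)) (y k) : ℂ)),
    integral_fintype_prod_volume_eq_prod
      (fun j x => (fourier ((∑ k, (X j k : ℤ)) + -(s : ℤ)) x : ℂ)),
    integral_fintype_prod_volume_eq_prod
      (fun k x => (fourier ((∑ j, (X j k : ℤ)) + -(t : ℤ)) x : ℂ))]
  simp only [integral_fourier_eq_ite]
  have h1 : ∀ j, (∑ k, (X j k : ℤ)) + -(s : ℤ) = 0 ↔ ∑ k, X j k = s := by
    intro j; rw [← Nat.cast_sum]; omega
  have h2 : ∀ k, (∑ j, (X j k : ℤ)) + -(t : ℤ) = 0 ↔ ∑ j, X j k = t := by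
    intro k; rw [← Nat.cast_sum]; omega
  simp only [h1, h2, Finset.prod_ite_zero, Finset.prod_const_one, Finset.mem_univ, true_imp_iff]
  split_ifs <;> simp_all

lemma norm_matChar (m n s t : ℕ) (X : Fin m → Fin n → ℕ)
    (p : (Fin m → UnitAddCircle) × (Fin n → UnitAddCircle)) : ‖matChar m n s t X p‖ = 1 := by
  rw [matChar_eq]
  simp only [norm_mul, norm_prod, norm_fourier_apply, Finset.prod_const_one, mul_one]

lemma continuous_matChar (m n s t : ℕ) (X : Fin m → Fin n → ℕ) :
    Continuous (matChar m n s t X) := by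
  have : matChar m n s t X = fun p => matChar m n s t X p := rfl
  rw [this]
  simp only [matChar_eq]
  refine Continuous.mul ?_ ?_
  · exact continuous_finsetProd _ fun j _ => (map_continuous (fourier _)).comp (by fun_prop)
  · exact continuous_finsetProd _ fun k _ => (map_continuous (fourier _)).comp (by fun_prop)

lemma integrable_matChar (m n s t : ℕ) {l : ℝ} (hl : 0 < l) :
    Integrable (fun q : ((Fin m → UnitAddCircle) × (Fin n → UnitAddCircle)) ×
      (Fin m → Fin n → ℕ) => matChar m n s t q.2 q.1) (volume.prod (matLaw m n l hl)) := by
  refine Integrable.of_bound (Measurable.aestronglyMeasurable ?_) 1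
    (ae_of_all _ fun q => (norm_matChar m n s t q.2 q.1).le)
  exact measurable_from_prod_countable_left fun X => (continuous_matChar m n s t X).measurable

/-- The set of matrices with the prescribed margins. -/
def marginSet (m n s t : ℕ) : Set (Fin m → Fin n → ℕ) :=
  {X | (∀ j, ∑ k, X j k = s) ∧ (∀ k, ∑ j, X j k = t)}

lemma finite_marginSet (m n s t : ℕ) : (marginSet m n s t).Finite := by
  refine (Set.finite_Iic (fun (_ : Fin m) (_ : Fin n) => s)).subset fun X hX j k => ?_
  rw [← hX.1 j]
  exact Finset.single_le_sum (fun _ _ => Nat.zero_le _) (Finset.mem_univ k)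

lemma matLaw_real_singleton {m n s t : ℕ} {l : ℝ} (hl : 0 < l) {X : Fin m → Fin n → ℕ}
    (hX : X ∈ marginSet m n s t) :
    (matLaw m n l hl).real {X} = (l / (1 + l)) ^ (m * s) * (1 / (1 + l)) ^ (m * n) := by
  have h : (matLaw m n l hl).real {X} = ∏ j, ∏ k, (geomLaw l hl).real {X j k} := by
    simp only [measureReal_def, matLaw, Measure.pi_singleton, ENNReal.toReal_prod]
  rw [h]
  simp only [geomLaw_real_singleton hl, Finset.prod_mul_distrib, Finset.prod_pow_eq_pow_sum]
  rw [Finset.sum_congr rfl fun j _ => hX.1 j]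
  simp [← pow_mul, mul_comm]

lemma integral_torusFun (m n s t : ℕ) {l : ℝ} (hl : 0 < l) :
    ∫ p, torusFun m n l s t p
      = ((matCount m s n t * ((l / (1 + l)) ^ (m * s) * (1 / (1 + l)) ^ (m * n)) : ℝ) : ℂ) := by
  classical
  have h1 : ∫ p, torusFun m n l s t p
      = ∫ X, (∫ p, matChar m n s t X p) ∂(matLaw m n l hl) := by
    rw [← integral_integral_swap (integrable_matChar m n s t hl)]
    simp only [integral_matChar_matLaw]
  have hfin := finite_marginSet m n s t
  have h2 : ∀ X, ∫ p, matChar m n s t X p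
      = (((marginSet m n s t).indicator (fun _ => (1 : ℝ)) X : ℝ) : ℂ) := by
    intro X
    rw [integral_matChar]
    by_cases h : X ∈ marginSet m n s t
    · rw [Set.indicator_of_mem h]; exact (if_pos h).trans (by simp)
    · rw [Set.indicator_of_notMem h]; exact (if_neg h).trans (by simp)
  rw [h1]
  simp only [h2]
  rw [integral_complex_ofReal]
  congr 1
  rw [integral_indicator_const _ hfin.measurableSet, smul_eq_mul, mul_one, ← hfin.coe_toFinset,
    ← sum_measureReal_singleton, Finset.sum_congr rfl fun X hX =>
      matLaw_real_singleton hl (hfin.mem_toFinset.1 hX), Finset.sum_const, nsmul_eq_mul]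
  congr 2
  rw [← Set.ncard_eq_toFinset_card _ hfin]
  rfl

end FourierInversion

section Kernel

lemma integral_geomKernel {l : ℝ} (hl : 0 < l) :
    ∫ x, geomKernel l x = ((1 / (1 + l) : ℝ) : ℂ) := by
  have hi : Integrable (fun q : UnitAddCircle × ℕ => (fourier (q.2 : ℤ) q.1 : ℂ))
      (volume.prod (geomLaw l hl)) := by
    have hm : Measurable fun q : UnitAddCircle × ℕ => (fourier (q.2 : ℤ) q.1 : ℂ) :=
      measurable_from_prod_countable_left fun k => (map_continuous (fourier (k : ℤ))).measurable
    exact Integrable.of_bound hm.aestronglyMeasurable 1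
      (ae_of_all _ fun q => (norm_fourier_apply (q.2 : ℤ) q.1).le)
  have h := integral_integral_swap
    (f := fun (x : UnitAddCircle) (k : ℕ) => (fourier (k : ℤ) x : ℂ)) hi
  simp only [integral_geomLaw, integral_fourier_eq_ite] at h
  rw [h]
  have h2 : ∀ k : ℕ, (if (k : ℤ) = 0 then 1 else 0 : ℂ)
      = ((({0} : Set ℕ).indicator (fun _ => (1 : ℝ)) k : ℝ) : ℂ) := by
    intro k
    by_cases hk : k = 0 <;> simp [hk]
  simp only [h2]
  rw [integral_complex_ofReal, integral_indicator_const _ (measurableSet_singleton 0),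
    geomLaw_real_singleton]
  simp

lemma sq_norm_geomKernel_coe (l x : ℝ) :
    ‖geomKernel l (x : UnitAddCircle)‖ ^ 2
      = 1 / (1 + 4 * (l * (1 + l) / 2) * (1 - cos (2 * π * x))) := by
  rw [geomKernel_coe, norm_div, norm_one, div_pow, one_pow, norm_denom_sq]

lemma norm_geomKernel_le_one {l : ℝ} (hl : 0 < l) (x : UnitAddCircle) :
    ‖geomKernel l x‖ ≤ 1 := by
  obtain ⟨y, rfl⟩ := QuotientAddGroup.mk_surjective x
  have h := geomKernel_coe l y
  rw [show (QuotientAddGroup.mk y : UnitAddCircle) = (y : UnitAddCircle) from rfl, h, norm_div,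
    norm_one]
  exact (div_le_one (by linarith [one_le_norm_denom hl (2 * π * y)])).2 (one_le_norm_denom hl _)

lemma norm_geomKernel_pos {l : ℝ} (hl : 0 < l) (x : UnitAddCircle) :
    0 < ‖geomKernel l x‖ := by
  rw [norm_pos_iff, geomKernel]
  exact one_div_ne_zero (geomKernel_denom_ne_zero hl x)

lemma sq_norm_geomKernel_eq {l : ℝ} (hl : 0 < l) (x : UnitAddCircle) :
    ‖geomKernel l x‖ ^ 2 = (1 / (1 + 2 * l)) * (2 * (1 + l) * (geomKernel l x).re - 1) := by
  obtain ⟨y, rfl⟩ := QuotientAddGroup.mk_surjective x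
  rw [show (QuotientAddGroup.mk y : UnitAddCircle) = (y : UnitAddCircle) from rfl,
    sq_norm_geomKernel_coe, geomKernel_coe, one_div (_ - _ : ℂ), Complex.inv_re, re_denom,
    Complex.normSq_eq_norm_sq, norm_denom_sq]
  have h1 : 0 < 1 + 4 * (l * (1 + l) / 2) * (1 - cos (2 * π * y)) := by
    have := cos_le_one (2 * π * y)
    have : 0 ≤ 4 * (l * (1 + l) / 2) * (1 - cos (2 * π * y)) :=
      mul_nonneg (by positivity) (by linarith)
    linarith
  have h2 : 0 < 1 + 2 * l := by linarith
  set D := 1 + 4 * (l * (1 + l) / 2) * (1 - cos (2 * π * y)) with hD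
  have h3 : l * (1 - cos (2 * π * y)) * (2 * (1 + l)) = D - 1 := by rw [hD]; ring
  generalize l * (1 - cos (2 * π * y)) = r at h3
  have h4 : 2 * (1 + l) * ((1 + r) / D) - 1 = (1 + 2 * l) / D := by
    field_simp
    linarith
  rw [h4]
  field_simp

lemma integral_sq_norm_geomKernel {l : ℝ} (hl : 0 < l) :
    ∫ x, ‖geomKernel l x‖ ^ 2 = 1 / (1 + 2 * l) := by
  simp only [sq_norm_geomKernel_eq hl]
  have hc : Integrable (geomKernel l) :=
    (continuous_geomKernel hl).integrable_of_hasCompactSupport (HasCompactSupport.of_compactSpace _)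
  have hr : ∫ x, (geomKernel l x).re = 1 / (1 + l) := by
    have h := integral_re hc
    rw [integral_geomKernel hl] at h
    exact h.trans (Complex.ofReal_re _)
  have hre : Integrable (fun x => (geomKernel l x).re) := hc.re
  rw [integral_const_mul, integral_sub (hre.const_mul _) (integrable_const _),
    integral_const_mul, hr]
  have : 0 < 1 + l := by linarith
  simp
  field_simp
  ring

lemma sq_norm_geomKernel_le {l : ℝ} (hl : 0 < l) (x : UnitAddCircle) :
    ‖geomKernel l x‖ ^ 2 ≤ 1 / (1 + 32 * (l * (1 + l) / 2) * ‖x‖ ^ 2) := by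
  obtain ⟨y, hy, rfl⟩ : ∃ y : ℝ, |y| ≤ 1 / 2 ∧ (y : UnitAddCircle) = x := by
    obtain ⟨y, rfl⟩ := QuotientAddGroup.mk_surjective x
    refine ⟨y - round y, abs_sub_round y, ?_⟩
    have h1 : ((round y : ℝ) : UnitAddCircle) = 0 := by
      have h2 : ((round y : ℝ) : UnitAddCircle) = (round y) • ((1 : ℝ) : UnitAddCircle) := by
        rw [← AddCircle.coe_zsmul]; simp
      rw [h2, AddCircle.coe_period, smul_zero]
    rw [AddCircle.coe_sub, h1, sub_zero]
  rw [sq_norm_geomKernel_coe, (AddCircle.norm_coe_eq_abs_iff 1 one_ne_zero).2 (by simpa using hy),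
    sq_abs]
  have h := cos_le_one_sub_mul_cos_sq (x := 2 * π * y) (by
    rw [abs_mul, abs_of_pos (by positivity : 0 < 2 * π)]
    nlinarith [pi_pos])
  have h2 : 8 * y ^ 2 ≤ 1 - cos (2 * π * y) := by
    have : 2 / π ^ 2 * (2 * π * y) ^ 2 = 8 * y ^ 2 := by
      field_simp; ring
    linarith
  have hA : 0 < l * (1 + l) / 2 := by positivity
  refine one_div_le_one_div_of_le (by positivity) ?_
  nlinarith

/-- Decay of the kernel away from the origin. -/
lemma norm_geomKernel_le_exp {l : ℝ} (hl : 0 < l) {z : ℝ} (hz : z ^ 2 ≤ 1) {d : ℝ} (hd : 0 ≤ d)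
    (hdz : z ^ 2 = 8 * π ^ 2 * (l * (1 + l) / 2) * d ^ 2) {x : UnitAddCircle}
    (hx : d / 3 ≤ ‖x‖) : ‖geomKernel l x‖ ≤ exp (-(z ^ 2 / 100)) := by
  have hA : 0 < l * (1 + l) / 2 := by positivity
  set A := l * (1 + l) / 2
  have h1 := sq_norm_geomKernel_le hl x
  have h2 : z ^ 2 / 25 ≤ 32 * A * ‖x‖ ^ 2 := by
    have h3 : d ^ 2 / 9 ≤ ‖x‖ ^ 2 := by nlinarith
    have h4 : π ^ 2 ≤ 10 := by nlinarith [pi_lt_d2, pi_pos]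
    have h5 : A * d ^ 2 * (10 - π ^ 2) ≥ 0 := mul_nonneg (by positivity) (by linarith)
    nlinarith
  have h6 : ‖geomKernel l x‖ ^ 2 ≤ exp (-(z ^ 2 / 50)) := by
    refine h1.trans ?_
    rw [exp_neg, ← one_div]
    refine one_div_le_one_div_of_le (exp_pos _) (le_trans ?_ (add_le_add_right h2 1))
    have h7 := abs_exp_sub_one_sub_id_le (x := z ^ 2 / 50) (by
      rw [abs_of_nonneg (by positivity)]; linarith)
    nlinarith [(abs_le.1 h7).2, sq_nonneg z]
  have h8 : exp (-(z ^ 2 / 50)) = exp (-(z ^ 2 / 100)) ^ 2 := by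
    rw [← exp_nat_mul]; congr 1; push_cast; ring
  rw [h8] at h6
  exact (sq_le_sq₀ (norm_nonneg _) (exp_pos _).le).1 h6

end Kernel

section Lift

lemma torusFun_coe {m n s t : ℕ} (hn : 0 < n) (hs : 0 < s) (hms : m * s = n * t)
    (x : Fin m → ℝ) (y : Fin n → ℝ) :
    torusFun m n ((s : ℝ) / n) s t ((fun j => (x j : UnitAddCircle)), fun k => (y k : UnitAddCircle))
      = ∏ j, ∏ k, Complex.exp (cgf ((s : ℝ) / n) (2 * π * (x j + y k))) := by
  have hl : 0 < (s : ℝ) / n := by positivity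
  set l := (s : ℝ) / n with hldef
  have hnl : (n : ℝ) * l = s := by rw [hldef]; field_simp
  have hml : (m : ℝ) * l = t := by
    rw [hldef]; field_simp; exact_mod_cast hms
  unfold torusFun
  have h1 : ∀ j k, Complex.exp (cgf l (2 * π * (x j + y k)))
      = geomKernel l ((x j : UnitAddCircle) + (y k : UnitAddCircle)) *
        (Complex.exp (-(2 * π * Complex.I * l * x j)) *
          Complex.exp (-(2 * π * Complex.I * l * y k))) := by
    intro j k
    rw [exp_cgf hl, ← Complex.exp_add, ← AddCircle.coe_add, geomKernel_coe, div_eq_mul_one_div,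
      mul_comm]
    congr 2
    push_cast
    ring
  simp only [h1, Finset.prod_mul_distrib, Finset.prod_const, Finset.card_univ, Fintype.card_fin]
  congr 1
  rw [← Finset.prod_pow]
  congr 1
  · refine Finset.prod_congr rfl fun j _ => ?_
    rw [fourier_coe_apply, ← Complex.exp_nat_mul]
    congr 1
    have : (n : ℂ) * (l : ℂ) = s := by exact_mod_cast hnl
    push_cast
    linear_combination 2 * π * Complex.I * x j * this
  · rw [Finset.prod_pow, ← Finset.prod_pow]
    refine Finset.prod_congr rfl fun k _ => ?_
    rw [fourier_coe_apply, ← Complex.exp_nat_mul]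
    congr 1
    have : (m : ℂ) * (l : ℂ) = t := by exact_mod_cast hml
    push_cast
    linear_combination 2 * π * Complex.I * y k * this

lemma norm_torusFun (m n s t : ℕ) (l : ℝ)
    (p : (Fin m → UnitAddCircle) × (Fin n → UnitAddCircle)) :
    ‖torusFun m n l s t p‖ = ∏ j, ∏ k, ‖geomKernel l (p.1 j + p.2 k)‖ := by
  unfold torusFun
  simp only [norm_mul, norm_prod, norm_fourier_apply, Finset.prod_const_one, mul_one]

end Lift

section LatticeProduct

lemma le_mean_of_pow_le_prod {ι : Type*} [Fintype ι] [Nonempty ι] {z : ι → ℝ}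
    (hz : ∀ i, 0 ≤ z i) {P : ℝ} (hP : 0 ≤ P) (hP1 : P ≤ 1) {d : ℕ} (hd : d ≤ Fintype.card ι)
    (h : P ^ d ≤ ∏ i, z i) : P ≤ (∑ i, z i) / Fintype.card ι := by
  have h1 := geom_mean_le_arith_mean Finset.univ (fun _ : ι => (1 : ℝ)) z
    (fun _ _ => zero_le_one) (by simp [Fintype.card_pos]) (fun i _ => hz i)
  simp only [rpow_one, Finset.sum_const, Finset.card_univ, nsmul_eq_mul, mul_one, one_mul] at h1
  refine le_trans ?_ h1
  have h2 : P ^ Fintype.card ι ≤ ∏ i, z i := (pow_le_pow_of_le_one hP hP1 hd).trans h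
  calc P = (P ^ Fintype.card ι) ^ ((Fintype.card ι : ℝ)⁻¹) :=
        (pow_rpow_inv_natCast hP Fintype.card_ne_zero).symm
    _ ≤ _ := rpow_le_rpow (pow_nonneg hP _) h2 (by positivity)

lemma integral_torus_pair {m n : ℕ}
    {f : (Fin m → UnitAddCircle) × (Fin n → UnitAddCircle) → ℝ} (hf : Continuous f) :
    ∫ p, f p = ∫ y, ∫ x, f (x, y) := by
  rw [Measure.volume_eq_prod]
  refine integral_prod_symm f ?_
  exact hf.integrable_of_hasCompactSupport (HasCompactSupport.of_compactSpace _)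

lemma integrable_torus {X : Type*} [TopologicalSpace X] [CompactSpace X] [MeasureSpace X]
    [OpensMeasurableSpace X] [IsFiniteMeasureOnCompacts (volume : Measure X)] {f : X → ℝ}
    (hf : Continuous f) : Integrable f :=
  hf.integrable_of_hasCompactSupport (HasCompactSupport.of_compactSpace _)

/-- The product of `v` over all sums of coordinates. -/
noncomputable def latticeProd (m n : ℕ) (v : UnitAddCircle → ℝ)
    (p : (Fin m → UnitAddCircle) × (Fin n → UnitAddCircle)) : ℝ :=
  ∏ j, ∏ k, v (p.1 j + p.2 k)

/-- The integral of one row of `latticeProd`. -/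
noncomputable def rowInt {n : ℕ} (v : UnitAddCircle → ℝ) (y : Fin n → UnitAddCircle) : ℝ :=
  ∫ x, ∏ k, v (x + y k)

lemma continuous_latticeProd (m n : ℕ) {v : UnitAddCircle → ℝ} (hv : Continuous v) :
    Continuous (latticeProd m n v) := by
  unfold latticeProd
  exact continuous_finsetProd _ fun j _ => continuous_finsetProd _ fun k _ =>
    hv.comp (by fun_prop)

lemma integral_latticeProd (m n : ℕ) {v : UnitAddCircle → ℝ} (hv : Continuous v) :
    ∫ p, latticeProd m n v p = ∫ y : Fin n → UnitAddCircle, rowInt v y ^ m := by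
  rw [integral_torus_pair (continuous_latticeProd m n hv)]
  refine integral_congr_ae (ae_of_all _ fun y => ?_)
  simp only [latticeProd]
  rw [integral_fintype_prod_volume_eq_prod (fun (_ : Fin m) x => ∏ k, v (x + y k))]
  simp [rowInt]

lemma continuous_rowInt {n : ℕ} {v : UnitAddCircle → ℝ} (hv : Continuous v) :
    Continuous (rowInt v : (Fin n → UnitAddCircle) → ℝ) := by
  unfold rowInt
  have h := continuous_parametric_integral_of_continuous (μ := (volume : Measure UnitAddCircle))
    (f := fun (y : Fin n → UnitAddCircle) x => ∏ k, v (x + y k))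
    (continuous_finsetProd _ fun k _ => hv.comp (by fun_prop)) isCompact_univ
  simpa using h

/-- The double star at `(j₀, k₀)`. -/
noncomputable def starProd {m n : ℕ} (a : UnitAddCircle → ℝ) (q : Fin m × Fin n)
    (p : (Fin m → UnitAddCircle) × (Fin n → UnitAddCircle)) : ℝ :=
  ∏ k, if k = q.2 then ∏ j, a (p.1 j + p.2 k) else a (p.1 q.1 + p.2 k)

lemma continuous_starProd {m n : ℕ} {a : UnitAddCircle → ℝ} (ha : Continuous a)
    (q : Fin m × Fin n) : Continuous (starProd a q) := by
  unfold starProd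
  refine continuous_finsetProd _ fun k _ => ?_
  split_ifs
  · exact continuous_finsetProd _ fun j _ => ha.comp (by fun_prop)
  · exact ha.comp (by fun_prop)

lemma prod_ite_eq_mul_pow {ι : Type*} [Fintype ι] [DecidableEq ι] (i : ι) (b c : ℝ) :
    ∏ k, (if k = i then b else c) = b * c ^ (Fintype.card ι - 1) := by
  rw [← Finset.mul_prod_erase _ _ (Finset.mem_univ i), if_pos rfl]
  congr 1
  rw [Finset.prod_congr rfl fun k hk => if_neg (Finset.ne_of_mem_erase hk), Finset.prod_const,
    Finset.card_erase_of_mem (Finset.mem_univ i), Finset.card_univ]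

lemma integral_starProd {m n : ℕ} {a : UnitAddCircle → ℝ} (ha : Continuous a)
    (q : Fin m × Fin n) : ∫ p, starProd a q p = (∫ x, a x) ^ (m + n - 1) := by
  have hn : 1 ≤ n := q.2.pos
  have h1 : ∫ p, starProd a q p = ∫ x, ∫ y, starProd a q (x, y) := by
    rw [Measure.volume_eq_prod]
    refine integral_prod _ ?_
    exact (continuous_starProd ha q).integrable_of_hasCompactSupport
      (HasCompactSupport.of_compactSpace _)
  have h2 : ∀ x : Fin m → UnitAddCircle, ∫ y, starProd a q (x, y)
      = (∫ z, ∏ j, a (x j + z)) * (∫ z, a z) ^ (n - 1) := by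
    intro x
    simp only [starProd]
    rw [integral_fintype_prod_volume_eq_prod
      (fun k z => if k = q.2 then ∏ j, a (x j + z) else a (x q.1 + z))]
    have h := prod_ite_eq_mul_pow q.2 (∫ z, ∏ j, a (x j + z)) (∫ z, a z)
    rw [Fintype.card_fin] at h
    rw [← h]
    refine Finset.prod_congr rfl fun k _ => ?_
    split_ifs
    · rfl
    · exact integral_add_left_eq_self a _
  rw [h1]
  simp only [h2]
  rw [integral_mul_const]
  have h3 : ∫ x : Fin m → UnitAddCircle, ∫ z, ∏ j, a (x j + z) = (∫ z, a z) ^ m := by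
    rw [integral_integral_swap]
    · have : ∀ z, ∫ x : Fin m → UnitAddCircle, ∏ j, a (x j + z) = (∫ z, a z) ^ m := by
        intro z
        rw [integral_fintype_prod_volume_eq_prod (fun (_ : Fin m) x => a (x + z))]
        simp only [integral_add_right_eq_self a z, Finset.prod_const, Finset.card_univ,
          Fintype.card_fin]
      simp [this]
    · refine Continuous.integrable_of_hasCompactSupport ?_ (HasCompactSupport.of_compactSpace _)
      exact continuous_finsetProd _ fun j _ => ha.comp (by fun_prop)
  rw [h3, ← pow_add]
  congr 1
  omega

lemma starProd_mul {m n : ℕ} (a : UnitAddCircle → ℝ) (q : Fin m × Fin n)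
    (p : (Fin m → UnitAddCircle) × (Fin n → UnitAddCircle)) :
    starProd a q p * a (p.1 q.1 + p.2 q.2)
      = (∏ j, a (p.1 j + p.2 q.2)) * ∏ k, a (p.1 q.1 + p.2 k) := by
  unfold starProd
  rw [← Finset.mul_prod_erase _ _ (Finset.mem_univ q.2), if_pos rfl,
    ← Finset.mul_prod_erase Finset.univ (fun k => a (p.1 q.1 + p.2 k)) (Finset.mem_univ q.2),
    Finset.prod_congr rfl fun k hk => if_neg (Finset.ne_of_mem_erase hk)]
  ring

lemma prod_starProd {m n : ℕ} {a : UnitAddCircle → ℝ} (ha : ∀ x, 0 < a x)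
    (hm : 0 < m) (p : (Fin m → UnitAddCircle) × (Fin n → UnitAddCircle)) :
    ∏ q : Fin m × Fin n, starProd a q p = latticeProd m n a p ^ (m + n - 1) := by
  have h1 : (∏ q : Fin m × Fin n, starProd a q p) * latticeProd m n a p
      = latticeProd m n a p ^ m * latticeProd m n a p ^ n := by
    have h2 : latticeProd m n a p = ∏ q : Fin m × Fin n, a (p.1 q.1 + p.2 q.2) := by
      rw [latticeProd, ← Finset.univ_product_univ, Finset.prod_product]
    nth_rewrite 1 [h2]
    rw [← Finset.prod_mul_distrib]
    simp only [starProd_mul]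
    rw [Finset.prod_mul_distrib, ← Finset.univ_product_univ, Finset.prod_product,
      Finset.prod_product]
    simp only [Finset.prod_const, Finset.card_univ, Fintype.card_fin, Finset.prod_pow]
    rw [Finset.prod_comm]
    simp only [latticeProd]
  have hpos : 0 < latticeProd m n a p :=
    Finset.prod_pos fun j _ => Finset.prod_pos fun k _ => ha _
  have h3 : latticeProd m n a p ^ m * latticeProd m n a p ^ n
      = latticeProd m n a p ^ (m + n - 1) * latticeProd m n a p := by
    rw [← pow_add, ← pow_succ]; congr 1; omega
  rw [h3] at h1
  exact mul_right_cancel₀ hpos.ne' h1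

/-- Comparison of a complete bipartite product with its double stars. -/
lemma integral_latticeProd_le {m n d : ℕ} (hm : 0 < m) (hn : 0 < n)
    (hd : d * (m + n - 1) ≤ m * n) {v : UnitAddCircle → ℝ} (hvc : Continuous v)
    (hv : ∀ x, 0 < v x) (hv1 : ∀ x, v x ≤ 1) :
    ∫ p, latticeProd m n v p ≤ (∫ x, v x ^ d) ^ (m + n - 1) := by
  have : Nonempty (Fin m × Fin n) := ⟨(⟨0, hm⟩, ⟨0, hn⟩)⟩
  have hac : Continuous fun x => v x ^ d := hvc.pow d
  have hpt : ∀ p, latticeProd m n v p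
      ≤ (∑ q : Fin m × Fin n, starProd (fun x => v x ^ d) q p) / (m * n) := by
    intro p
    have hP : 0 ≤ latticeProd m n v p :=
      Finset.prod_nonneg fun j _ => Finset.prod_nonneg fun k _ => (hv _).le
    have h := le_mean_of_pow_le_prod (z := fun q : Fin m × Fin n =>
      starProd (fun x => v x ^ d) q p) (P := latticeProd m n v p)
      (d := d * (m + n - 1)) ?_ hP ?_ ?_ ?_
    · simpa using h
    · intro q
      refine Finset.prod_nonneg fun k _ => ?_
      split_ifs
      · exact Finset.prod_nonneg fun j _ => pow_nonneg (hv _).le _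
      · exact pow_nonneg (hv _).le _
    · exact Finset.prod_le_one (fun j _ => Finset.prod_nonneg fun k _ => (hv _).le) fun j _ =>
        Finset.prod_le_one (fun k _ => (hv _).le) fun k _ => hv1 _
    · simpa using hd
    · rw [prod_starProd (fun x => pow_pos (hv x) d) hm, pow_mul]
      simp [latticeProd, Finset.prod_pow]
  have hint : ∀ q : Fin m × Fin n, Integrable (starProd (fun x => v x ^ d) q) :=
    fun q => integrable_torus (continuous_starProd hac q)
  calc ∫ p, latticeProd m n v p
      ≤ ∫ p, (∑ q : Fin m × Fin n, starProd (fun x => v x ^ d) q p) / (m * n) := by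
        refine integral_mono (integrable_torus (continuous_latticeProd m n hvc)) ?_ hpt
        exact (integrable_finsetSum _ fun q _ => hint q).div_const _
    _ = _ := by
        rw [integral_div, integral_finsetSum _ fun q _ => hint q]
        simp only [integral_starProd hac, Finset.sum_const, Finset.card_univ,
          Fintype.card_prod, Fintype.card_fin, nsmul_eq_mul]
        push_cast
        field_simp

end LatticeProduct

section Outside

/-- `latticeProd` with the factors of one row replaced by a mean of fourth powers. -/
noncomputable def rowProd {m n : ℕ} (w : UnitAddCircle → ℝ) (i : Fin m)
    (p : (Fin m → UnitAddCircle) × (Fin n → UnitAddCircle)) : ℝ :=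
  ∏ j, if j = i then (∑ k, w (p.1 j + p.2 k) ^ 4) / n else ∏ k, w (p.1 j + p.2 k) ^ 2

lemma continuous_rowProd {m n : ℕ} {w : UnitAddCircle → ℝ} (hw : Continuous w) (i : Fin m) :
    Continuous (rowProd w i : (Fin m → UnitAddCircle) × (Fin n → UnitAddCircle) → ℝ) := by
  unfold rowProd
  refine continuous_finsetProd _ fun j _ => ?_
  split_ifs
  · exact (continuous_finsetSum _ fun k _ => (hw.comp (by fun_prop)).pow 4).div_const _
  · exact continuous_finsetProd _ fun k _ => (hw.comp (by fun_prop)).pow 2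

lemma rowProd_nonneg {m n : ℕ} {w : UnitAddCircle → ℝ} (hw : ∀ x, 0 < w x) (i : Fin m)
    (p : (Fin m → UnitAddCircle) × (Fin n → UnitAddCircle)) : 0 ≤ rowProd w i p := by
  refine Finset.prod_nonneg fun j _ => ?_
  split_ifs
  · exact div_nonneg (Finset.sum_nonneg fun k _ => pow_nonneg (hw _).le _) (Nat.cast_nonneg n)
  · exact Finset.prod_nonneg fun k _ => pow_nonneg (hw _).le _

lemma integral_rowProd {m n : ℕ} (hn : 0 < n) {w : UnitAddCircle → ℝ} (hw : Continuous w)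
    (i : Fin m) :
    ∫ p : (Fin m → UnitAddCircle) × (Fin n → UnitAddCircle), rowProd w i p
      = (∫ x, w x ^ 4) * ∫ y : Fin n → UnitAddCircle, rowInt (fun x => w x ^ 2) y ^ (m - 1) := by
  rw [integral_torus_pair (continuous_rowProd hw i), ← integral_const_mul]
  refine integral_congr_ae (ae_of_all _ fun y => ?_)
  simp only [rowProd]
  rw [integral_fintype_prod_volume_eq_prod (fun j x =>
    if j = i then (∑ k, w (x + y k) ^ 4) / (n : ℝ) else ∏ k, w (x + y k) ^ 2)]
  have h := prod_ite_eq_mul_pow i (∫ x, w x ^ 4) (rowInt (fun x => w x ^ 2) y)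
  rw [Fintype.card_fin] at h
  rw [← h]
  refine Finset.prod_congr rfl fun j _ => ?_
  split_ifs
  · have hk : ∀ k, Integrable fun x => w (x + y k) ^ 4 := fun k =>
      integrable_torus ((hw.comp (by fun_prop)).pow 4)
    rw [integral_div, integral_finsetSum _ fun k _ => hk k]
    simp only [integral_add_right_eq_self (fun x => w x ^ 4), Finset.sum_const, Finset.card_univ,
      Fintype.card_fin, nsmul_eq_mul]
    field_simp
  · rfl

lemma pow_pred_le {H r : ℝ} (hH : 0 ≤ H) (hr : 0 < r) {m : ℕ} (hm : 5 ≤ m) :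
    H ^ (m - 1) ≤ H ^ m / r + r ^ (m - 5) * H ^ 4 := by
  obtain ⟨k, rfl⟩ := Nat.exists_eq_add_of_le hm
  have h1 : 5 + k - 1 = k + 4 := by omega
  have h2 : 5 + k - 5 = k := by omega
  rw [h1, h2]
  rcases le_total r H with h | h
  · have : H ^ (k + 4) ≤ H ^ (5 + k) / r := by
      rw [le_div_iff₀ hr, show 5 + k = (k + 4) + 1 by ring, pow_succ H (k + 4)]
      gcongr
    have : 0 ≤ r ^ k * H ^ 4 := by positivity
    linarith
  · have : H ^ (k + 4) ≤ r ^ k * H ^ 4 := by rw [pow_add]; gcongr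
    have : 0 ≤ H ^ (5 + k) / r := by positivity
    linarith

/-- Replacing a row costs little unless the whole integral is tiny. -/
lemma integral_rowProd_le {m n : ℕ} (hm : 5 ≤ m) (hn : 3 ≤ n) {w : UnitAddCircle → ℝ}
    (hwc : Continuous w) (hw : ∀ x, 0 < w x) (hw1 : ∀ x, w x ≤ 1) {r : ℝ} (hr : 0 < r)
    (i : Fin m) :
    ∫ p : (Fin m → UnitAddCircle) × (Fin n → UnitAddCircle), rowProd w i p
      ≤ (∫ x, w x ^ 4) * ((∫ p, latticeProd m n (fun x => w x ^ 2) p) / r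
          + r ^ (m - 5) * (∫ x, w x ^ 4) ^ (n + 3)) := by
  have hvc : Continuous fun x => w x ^ 2 := hwc.pow 2
  rw [integral_rowProd (by omega) hwc]
  have h0 : 0 ≤ ∫ x, w x ^ 4 := integral_nonneg fun x => pow_nonneg (hw x).le 4
  refine mul_le_mul_of_nonneg_left ?_ h0
  have hc := continuous_rowInt (n := n) hvc
  have hnn : ∀ y : Fin n → UnitAddCircle, 0 ≤ rowInt (fun x => w x ^ 2) y := fun y =>
    integral_nonneg fun x => Finset.prod_nonneg fun k _ => pow_nonneg (hw _).le 2
  have h4 : ∫ y : Fin n → UnitAddCircle, rowInt (fun x => w x ^ 2) y ^ 4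
      ≤ (∫ x, w x ^ 4) ^ (n + 3) := by
    rw [← integral_latticeProd 4 n hvc]
    have h := integral_latticeProd_le (m := 4) (n := n) (d := 2) (by norm_num) (by omega)
      (by omega) hvc (fun x => pow_pos (hw x) 2) (fun x => pow_le_one₀ (hw x).le (hw1 x))
    simp only [← pow_mul] at h
    convert h using 2
    omega
  calc ∫ y : Fin n → UnitAddCircle, rowInt (fun x => w x ^ 2) y ^ (m - 1)
      ≤ ∫ y : Fin n → UnitAddCircle, (rowInt (fun x => w x ^ 2) y ^ m / r
          + r ^ (m - 5) * rowInt (fun x => w x ^ 2) y ^ 4) := by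
        refine integral_mono (integrable_torus (hc.pow _)) (integrable_torus ?_)
          fun y => pow_pred_le (hnn y) hr hm
        exact ((hc.pow _).div_const _).add (continuous_const.mul (hc.pow _))
    _ = (∫ p, latticeProd m n (fun x => w x ^ 2) p) / r
          + r ^ (m - 5) * ∫ y : Fin n → UnitAddCircle, rowInt (fun x => w x ^ 2) y ^ 4 := by
        have i1 : Integrable fun y : Fin n → UnitAddCircle =>
            rowInt (fun x => w x ^ 2) y ^ m / r := integrable_torus ((hc.pow _).div_const _)
        have i2 : Integrable fun y : Fin n → UnitAddCircle =>
            r ^ (m - 5) * rowInt (fun x => w x ^ 2) y ^ 4 :=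
          integrable_torus (continuous_const.mul (hc.pow _))
        rw [integral_add i1 i2, integral_div, integral_const_mul, integral_latticeProd m n hvc]
    _ ≤ _ := by gcongr

lemma prod_le_exp_of_card {ι : Type*} [Fintype ι] {u : ι → ℝ} (hu : ∀ i, 0 < u i)
    (hu1 : ∀ i, u i ≤ 1) {β c : ℝ} (hβ : 0 ≤ β) (B : Finset ι) (hB : ∀ i ∈ B, u i ≤ exp (-β))
    (hc : c ≤ B.card) : ∏ i, u i ≤ exp (-(β * c)) := by
  classical
  calc ∏ i, u i = (∏ i ∈ B, u i) * ∏ i ∈ Bᶜ, u i := (Finset.prod_mul_prod_compl B u).symm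
    _ ≤ (∏ i ∈ B, exp (-β)) * 1 := by
        refine mul_le_mul (Finset.prod_le_prod (fun i _ => (hu i).le) hB)
          (Finset.prod_le_one (fun i _ => (hu i).le) fun i _ => hu1 i)
          (Finset.prod_nonneg fun i _ => (hu i).le) (Finset.prod_nonneg fun i _ => (exp_pos _).le)
    _ = exp (-(β * B.card)) := by
        rw [Finset.prod_const, ← exp_nat_mul, mul_one]; congr 1; ring
    _ ≤ _ := exp_le_exp.2 (by nlinarith)

lemma latticeProd_le_rowProd {m n : ℕ} (hn : 4 ≤ n) {w : UnitAddCircle → ℝ}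
    (hw : ∀ x, 0 < w x) (hw1 : ∀ x, w x ≤ 1) {β : ℝ} (hβ : 0 ≤ β)
    {p : (Fin m → UnitAddCircle) × (Fin n → UnitAddCircle)} (i : Fin m) (B : Finset (Fin n))
    (hB : ∀ k ∈ B, w (p.1 i + p.2 k) ≤ exp (-β)) (hc : (n : ℝ) / 2 ≤ B.card) :
    latticeProd m n (fun x => w x ^ 2) p ≤ exp (-(β * (n / 2))) * rowProd w i p := by
  have : Nonempty (Fin n) := ⟨⟨0, by omega⟩⟩
  have h1 : ∏ k, w (p.1 i + p.2 k) ^ 2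
      ≤ exp (-(β * (n / 2))) * ((∑ k, w (p.1 i + p.2 k) ^ 4) / n) := by
    have hnn : 0 ≤ ∏ k, w (p.1 i + p.2 k) := Finset.prod_nonneg fun k _ => (hw _).le
    rw [Finset.prod_pow, sq]
    refine mul_le_mul (prod_le_exp_of_card (fun k => hw _) (fun k => hw1 _) hβ B hB hc) ?_
      hnn (exp_pos _).le
    have h := le_mean_of_pow_le_prod (z := fun k => w (p.1 i + p.2 k) ^ 4)
      (P := ∏ k, w (p.1 i + p.2 k)) (d := 4) (fun k => pow_nonneg (hw _).le 4) hnn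
      (Finset.prod_le_one (fun k _ => (hw _).le) fun k _ => hw1 _) (by simpa using hn)
      (by rw [Finset.prod_pow])
    simpa using h
  unfold latticeProd rowProd
  rw [← Finset.mul_prod_erase _ _ (Finset.mem_univ i),
    ← Finset.mul_prod_erase Finset.univ (fun j => if j = i then _ else _) (Finset.mem_univ i),
    if_pos rfl, ← mul_assoc,
    Finset.prod_congr (g := fun j => if j = i then (∑ k, w (p.1 j + p.2 k) ^ 4) / (n : ℝ)
      else ∏ k, w (p.1 j + p.2 k) ^ 2) rfl
      fun j hj => (if_neg (Finset.ne_of_mem_erase hj)).symm]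
  refine mul_le_mul_of_nonneg_right h1 (Finset.prod_nonneg fun j _ => ?_)
  split_ifs
  · exact div_nonneg (Finset.sum_nonneg fun k _ => pow_nonneg (hw _).le _) (Nat.cast_nonneg n)
  · exact Finset.prod_nonneg fun k _ => pow_nonneg (hw _).le _

lemma latticeProd_swap (m n : ℕ) (v : UnitAddCircle → ℝ)
    (p : (Fin m → UnitAddCircle) × (Fin n → UnitAddCircle)) :
    latticeProd n m v p.swap = latticeProd m n v p := by
  unfold latticeProd
  rw [Finset.prod_comm]
  simp [add_comm]

lemma latticeProd_le_far {m n : ℕ} {w : UnitAddCircle → ℝ}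
    (hw : ∀ x, 0 < w x) (hw1 : ∀ x, w x ≤ 1) {β c : ℝ} (hβ : 0 ≤ β)
    {p : (Fin m → UnitAddCircle) × (Fin n → UnitAddCircle)} (B : Finset (Fin m × Fin n))
    (hB : ∀ q ∈ B, w (p.1 q.1 + p.2 q.2) ≤ exp (-β)) (hc : c ≤ B.card) :
    latticeProd m n (fun x => w x ^ 2) p ≤ exp (-(β * c)) * latticeProd m n w p := by
  have h := prod_le_exp_of_card (u := fun q : Fin m × Fin n => w (p.1 q.1 + p.2 q.2))
    (fun q => hw _) (fun q => hw1 _) hβ B hB hc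
  rw [← Finset.univ_product_univ, Finset.prod_product] at h
  have h2 : latticeProd m n (fun x => w x ^ 2) p = latticeProd m n w p * latticeProd m n w p := by
    simp only [latticeProd, ← Finset.prod_mul_distrib, sq]
  rw [h2]
  exact mul_le_mul_of_nonneg_right h
    (Finset.prod_nonneg fun j _ => Finset.prod_nonneg fun k _ => (hw _).le)

/-- If some sum of coordinates is not small, then half of a row, half of a column, or a quarter
of all sums are not small. -/
lemma latticeProd_le_of_notMem_box {m n : ℕ} (hm : 4 ≤ m) (hn : 4 ≤ n) {w : UnitAddCircle → ℝ}
    (hw : ∀ x, 0 < w x) (hw1 : ∀ x, w x ≤ 1) {β d : ℝ} (hβ : 0 ≤ β)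
    (hwd : ∀ x : UnitAddCircle, d / 3 ≤ ‖x‖ → w x ≤ exp (-β))
    {p : (Fin m → UnitAddCircle) × (Fin n → UnitAddCircle)} {i : Fin m} {l : Fin n}
    (hil : d < ‖p.1 i + p.2 l‖) :
    latticeProd m n (fun x => w x ^ 2) p
      ≤ exp (-(β * (n / 2))) * ∑ j, rowProd w j p
        + exp (-(β * (m / 2))) * ∑ k, rowProd w k p.swap
        + exp (-(β * (m * n / 4))) * latticeProd m n w p := by
  classical
  have e1 : 0 ≤ exp (-(β * (n / 2))) * ∑ j, rowProd w j p :=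
    mul_nonneg (exp_pos _).le (Finset.sum_nonneg fun j _ => rowProd_nonneg hw j p)
  have e2 : 0 ≤ exp (-(β * (m / 2))) * ∑ k, rowProd w k p.swap :=
    mul_nonneg (exp_pos _).le (Finset.sum_nonneg fun j _ => rowProd_nonneg hw j _)
  have e3 : 0 ≤ exp (-(β * (m * n / 4))) * latticeProd m n w p :=
    mul_nonneg (exp_pos _).le
      (Finset.prod_nonneg fun j _ => Finset.prod_nonneg fun k _ => (hw _).le)
  set R := Finset.univ.filter fun k => d / 3 ≤ ‖p.1 i + p.2 k‖ with hR
  set S := Finset.univ.filter fun j => d / 3 ≤ ‖p.1 j + p.2 l‖ with hS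
  by_cases h1 : (n : ℝ) / 2 ≤ R.card
  · have h := latticeProd_le_rowProd hn hw hw1 hβ i R
      (fun k hk => hwd _ (Finset.mem_filter.1 hk).2) h1
    have h' : rowProd w i p ≤ ∑ j, rowProd w j p :=
      Finset.single_le_sum (fun j _ => rowProd_nonneg hw j p) (Finset.mem_univ i)
    have := mul_le_mul_of_nonneg_left h' (exp_pos (-(β * (n / 2)))).le
    linarith
  by_cases h2 : (m : ℝ) / 2 ≤ S.card
  · have h := latticeProd_le_rowProd (p := p.swap) hm hw hw1 hβ l S
      (fun j hj => hwd _ (by simpa [add_comm] using (Finset.mem_filter.1 hj).2)) h2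
    rw [latticeProd_swap] at h
    have h' : rowProd w l p.swap ≤ ∑ k, rowProd w k p.swap :=
      Finset.single_le_sum (fun j _ => rowProd_nonneg hw j _) (Finset.mem_univ l)
    have := mul_le_mul_of_nonneg_left h' (exp_pos (-(β * (m / 2)))).le
    linarith
  · have hRc : (n : ℝ) / 2 ≤ (Rᶜ).card := by
      rw [Finset.card_compl, Fintype.card_fin, Nat.cast_sub (by simpa using Finset.card_le_univ R)]
      linarith
    have hSc : (m : ℝ) / 2 ≤ (Sᶜ).card := by
      rw [Finset.card_compl, Fintype.card_fin, Nat.cast_sub (by simpa using Finset.card_le_univ S)]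
      linarith
    have h := latticeProd_le_far (p := p) (c := m * n / 4) hw hw1 hβ (Sᶜ ×ˢ Rᶜ) ?_ ?_
    · linarith
    · intro q hq
      rw [Finset.mem_product] at hq
      have ha : ‖p.1 q.1 + p.2 l‖ < d / 3 := by
        have := hq.1; simpa [hS] using this
      have hb : ‖p.1 i + p.2 q.2‖ < d / 3 := by
        have := hq.2; simpa [hR] using this
      refine hwd _ ?_
      have hid : p.1 i + p.2 l = (p.1 q.1 + p.2 l) + (p.1 i + p.2 q.2) - (p.1 q.1 + p.2 q.2) := by
        abel
      have h3 := norm_sub_le ((p.1 q.1 + p.2 l) + (p.1 i + p.2 q.2)) (p.1 q.1 + p.2 q.2)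
      have h4 := norm_add_le (p.1 q.1 + p.2 l) (p.1 i + p.2 q.2)
      rw [← hid] at h3
      linarith
    · rw [Finset.card_product]
      push_cast
      calc (m * n / 4 : ℝ) = (m / 2) * (n / 2) := by ring
        _ ≤ _ := mul_le_mul hSc hRc (by positivity) (by positivity)

/-- The part of the torus on which all sums of coordinates are small. -/
def torusBox (m n : ℕ) (d : ℝ) : Set ((Fin m → UnitAddCircle) × (Fin n → UnitAddCircle)) :=
  {p | ∀ j k, ‖p.1 j + p.2 k‖ ≤ d}

lemma isClosed_torusBox (m n : ℕ) (d : ℝ) : IsClosed (torusBox m n d) := by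
  have : torusBox m n d = ⋂ j, ⋂ k, {p | ‖p.1 j + p.2 k‖ ≤ d} := by
    ext p; simp [torusBox]
  rw [this]
  exact isClosed_iInter fun j => isClosed_iInter fun k =>
    isClosed_le (by fun_prop) continuous_const

lemma integral_swap_torus {m n : ℕ}
    (f : (Fin n → UnitAddCircle) × (Fin m → UnitAddCircle) → ℝ) :
    ∫ p : (Fin m → UnitAddCircle) × (Fin n → UnitAddCircle), f p.swap = ∫ p, f p := by
  rw [Measure.volume_eq_prod, Measure.volume_eq_prod]
  exact integral_prod_swap f

lemma mul_div_mul_exp_add {h K : ℝ} (hh : 0 < h) (X : ℝ) {m n : ℕ} (hm : 5 ≤ m) :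
    h * (K / (h * exp (-X)) + (h * exp (-X)) ^ (m - 5) * h ^ (n + 3))
      = exp X * K + exp (-(X * (m - 5))) * h ^ (m + n - 1) := by
  obtain ⟨k, rfl⟩ := Nat.exists_eq_add_of_le hm
  have h1 : 5 + k - 5 = k := by omega
  have h2 : 5 + k + n - 1 = k + (n + 3) + 1 := by omega
  have h3 : exp (-(X * (((5 + k : ℕ) : ℝ) - 5))) = exp (-X) ^ k := by
    rw [← exp_nat_mul]; congr 1; push_cast; ring
  rw [h1, h2, h3, mul_pow, mul_add, exp_neg X, pow_succ, pow_add]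
  have := exp_pos X
  field_simp
  ring

/-- The mass of the product outside of the box. -/
lemma integral_compl_torusBox_le {m n : ℕ} (hm : 5 ≤ m) (hn : 5 ≤ n)
    (hmn : 4 * (m + n - 1) ≤ m * n) {w : UnitAddCircle → ℝ} (hwc : Continuous w)
    (hw : ∀ x, 0 < w x) (hw1 : ∀ x, w x ≤ 1) {β d : ℝ} (hβ : 0 ≤ β)
    (hwd : ∀ x : UnitAddCircle, d / 3 ≤ ‖x‖ → w x ≤ exp (-β)) (X : ℝ) :
    ∫ p in (torusBox m n d)ᶜ, latticeProd m n (fun x => w x ^ 2) p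
      ≤ exp (-(β * (n / 2))) * (m * (exp X * (∫ p, latticeProd m n (fun x => w x ^ 2) p)
            + exp (-(X * (m - 5))) * (∫ x, w x ^ 4) ^ (m + n - 1)))
        + exp (-(β * (m / 2))) * (n * (exp X * (∫ p, latticeProd m n (fun x => w x ^ 2) p)
            + exp (-(X * (n - 5))) * (∫ x, w x ^ 4) ^ (m + n - 1)))
        + exp (-(β * (m * n / 4))) * (∫ x, w x ^ 4) ^ (m + n - 1) := by
  set h := ∫ x, w x ^ 4 with hh
  set K := ∫ p, latticeProd m n (fun x => w x ^ 2) p with hK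
  have hpos : 0 < h := by
    have hc : Continuous fun x => w x ^ 4 := hwc.pow 4
    exact hc.integral_pos_of_hasCompactSupport_nonneg_nonzero
      (HasCompactSupport.of_compactSpace _) (fun x => pow_nonneg (hw x).le 4)
      (x := 0) (pow_pos (hw 0) 4).ne'
  have hr : 0 < h * exp (-X) := mul_pos hpos (exp_pos _)
  have c1 : ∀ j, Continuous (rowProd w j : (Fin m → UnitAddCircle) × (Fin n → UnitAddCircle) → ℝ) :=
    fun j => continuous_rowProd hwc j
  have c2 : ∀ k, Continuous fun p : (Fin m → UnitAddCircle) × (Fin n → UnitAddCircle) =>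
      rowProd w k p.swap := fun k => (continuous_rowProd hwc k).comp continuous_swap
  have c3 := continuous_latticeProd m n hwc
  have i1 : Integrable fun p : (Fin m → UnitAddCircle) × (Fin n → UnitAddCircle) =>
      exp (-(β * (n / 2))) * ∑ j, rowProd w j p :=
    integrable_torus (continuous_const.mul (continuous_finsetSum _ fun j _ => c1 j))
  have i2 : Integrable fun p : (Fin m → UnitAddCircle) × (Fin n → UnitAddCircle) =>
      exp (-(β * (m / 2))) * ∑ k, rowProd w k p.swap :=
    integrable_torus (continuous_const.mul (continuous_finsetSum _ fun k _ => c2 k))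
  have i3 : Integrable fun p : (Fin m → UnitAddCircle) × (Fin n → UnitAddCircle) =>
      exp (-(β * (m * n / 4))) * latticeProd m n w p :=
    integrable_torus (continuous_const.mul c3)
  have hnn : ∀ p : (Fin m → UnitAddCircle) × (Fin n → UnitAddCircle),
      0 ≤ exp (-(β * (n / 2))) * ∑ j, rowProd w j p
        + exp (-(β * (m / 2))) * ∑ k, rowProd w k p.swap
        + exp (-(β * (m * n / 4))) * latticeProd m n w p := fun p =>
    add_nonneg (add_nonneg
      (mul_nonneg (exp_pos _).le (Finset.sum_nonneg fun j _ => rowProd_nonneg hw j p))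
      (mul_nonneg (exp_pos _).le (Finset.sum_nonneg fun j _ => rowProd_nonneg hw j _)))
      (mul_nonneg (exp_pos _).le
        (Finset.prod_nonneg fun j _ => Finset.prod_nonneg fun k _ => (hw _).le))
  have s1 : ∫ p : (Fin m → UnitAddCircle) × (Fin n → UnitAddCircle), ∑ j, rowProd w j p
      ≤ m * (exp X * K + exp (-(X * (m - 5))) * h ^ (m + n - 1)) := by
    rw [integral_finsetSum _ fun j _ => integrable_torus (c1 j), ← mul_div_mul_exp_add hpos X hm]
    refine (Finset.sum_le_card_nsmul _ _ _ fun j _ =>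
      integral_rowProd_le hm (by omega) hwc hw hw1 hr j).trans_eq ?_
    simp [hK, hh]
  have s2 : ∫ p : (Fin m → UnitAddCircle) × (Fin n → UnitAddCircle), ∑ k, rowProd w k p.swap
      ≤ n * (exp X * K + exp (-(X * (n - 5))) * h ^ (m + n - 1)) := by
    rw [integral_finsetSum _ fun k _ => integrable_torus (c2 k), add_comm m n,
      ← mul_div_mul_exp_add hpos X hn]
    refine (Finset.sum_le_card_nsmul _ _ (h * (K / (h * exp (-X))
      + (h * exp (-X)) ^ (n - 5) * h ^ (m + 3))) fun k _ => ?_).trans_eq ?_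
    · have hKs : K = ∫ p, latticeProd n m (fun x => w x ^ 2) p := by
        rw [hK, ← integral_swap_torus (latticeProd n m _)]
        simp only [latticeProd_swap]
      rw [integral_swap_torus (rowProd w k), hKs]
      exact integral_rowProd_le hn (by omega) hwc hw hw1 hr k
    · simp
  have s3 : ∫ p, latticeProd m n w p ≤ h ^ (m + n - 1) :=
    integral_latticeProd_le (by omega) (by omega) hmn hwc hw hw1
  calc ∫ p in (torusBox m n d)ᶜ, latticeProd m n (fun x => w x ^ 2) p
      ≤ ∫ p in (torusBox m n d)ᶜ, (exp (-(β * (n / 2))) * ∑ j, rowProd w j p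
        + exp (-(β * (m / 2))) * ∑ k, rowProd w k p.swap
        + exp (-(β * (m * n / 4))) * latticeProd m n w p) := by
        refine setIntegral_mono_on (integrable_torus
          (continuous_latticeProd m n (hwc.pow 2))).integrableOn
          ((i1.add i2).add i3).integrableOn (isClosed_torusBox m n d).measurableSet.compl
          fun p hp => ?_
        have hp' : ¬ ∀ j k, ‖p.1 j + p.2 k‖ ≤ d := hp
        push Not at hp'
        obtain ⟨i, l, hil⟩ := hp'
        exact latticeProd_le_of_notMem_box (by omega) (by omega) hw hw1 hβ hwd hil
    _ ≤ ∫ p, (exp (-(β * (n / 2))) * ∑ j, rowProd w j p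
        + exp (-(β * (m / 2))) * ∑ k, rowProd w k p.swap
        + exp (-(β * (m * n / 4))) * latticeProd m n w p) :=
        setIntegral_le_integral ((i1.add i2).add i3) (ae_of_all _ hnn)
    _ = exp (-(β * (n / 2))) * (∫ p : (Fin m → UnitAddCircle) × (Fin n → UnitAddCircle),
            ∑ j, rowProd w j p)
        + exp (-(β * (m / 2))) * (∫ p : (Fin m → UnitAddCircle) × (Fin n → UnitAddCircle),
            ∑ k, rowProd w k p.swap)
        + exp (-(β * (m * n / 4))) * ∫ p, latticeProd m n w p := by
        rw [integral_add, integral_add i1 i2, integral_const_mul, integral_const_mul,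
          integral_const_mul]
        · exact i1.add i2
        · exact i3
    _ ≤ _ := by gcongr

end Outside

section Gauge

/-- Integrating out a one-parameter symmetry. -/
lemma integral_gauge {X : Type*} [AddCommGroup X] [MeasureSpace X] [MeasurableAdd₂ X]
    [MeasurableNeg X] [SigmaFinite (volume : Measure X)]
    [(volume : Measure X).IsAddLeftInvariant] {m n : ℕ}
    (G : (Fin m → X) → (Fin (n + 1) → X) → ℂ) (W : (Fin (n + 1) → X) → ℂ) (κ : ℂ)
    (hG : ∀ x y c, G (fun j => -c + x j) (fun k => c + y k) = G x y)
    (hW : ∀ y : Fin n → X, ∫ c, W (Fin.cons c fun k => c + y k) = κ)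
    (hint : Integrable fun p : (Fin m → X) × (Fin (n + 1) → X) => G p.1 p.2 * W p.2) :
    ∫ p : (Fin m → X) × (Fin (n + 1) → X), G p.1 p.2 * W p.2
      = κ * ∫ y : Fin n → X, ∫ x, G x (Fin.cons 0 y) := by
  rw [Measure.volume_eq_prod] at hint ⊢
  rw [integral_prod_symm _ hint]
  set f : (Fin (n + 1) → X) → ℂ := fun y => ∫ x, G x y * W y with hf
  have hfi : Integrable f := hint.integral_prod_right
  set e := MeasurableEquiv.piFinSuccAbove (fun _ : Fin (n + 1) => X) 0
  have he := (volume_preserving_piFinSuccAbove (fun _ : Fin (n + 1) => X) 0).symm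
  have hei : Integrable (fun q : X × (Fin n → X) => f (e.symm q)) (volume.prod volume) :=
    he.integrable_comp_of_integrable hfi
  have h1 : ∫ y, f y = ∫ c, ∫ y, f (e.symm (c, y)) := by
    rw [← integral_prod _ hei]
    exact (he.integral_comp' f).symm
  have h2 : ∀ (c : X) (y : Fin n → X), e.symm (c, y) = Fin.cons c y := by
    intro c y
    exact Fin.insertNth_zero' c y
  have hS : MeasurePreserving (fun q : X × (Fin n → X) => (q.1, (fun _ => q.1) + q.2))
      (volume.prod volume) (volume.prod volume) := by
    refine (MeasurePreserving.id volume).skew_product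
      (g := fun (c : X) (y : Fin n → X) => (fun _ => c) + y) ?_
      (ae_of_all _ fun c => map_add_left_eq_self volume _)
    exact (measurable_pi_lambda _ fun k => by
      exact measurable_fst.add ((measurable_pi_apply k).comp measurable_snd))
  have hSi := hS.integrable_comp_of_integrable hei
  have h3 : ∀ (c : X) (y : Fin n → X), f (e.symm (c, (fun _ => c) + y))
      = (∫ x, G x (Fin.cons 0 y)) * W (Fin.cons c fun k => c + y k) := by
    intro c y
    rw [h2]
    simp only [hf]
    rw [integral_mul_const]
    congr 1
    have h4 : (Fin.cons c ((fun _ => c) + y) : Fin (n + 1) → X)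
        = fun k => c + (Fin.cons 0 y : Fin (n + 1) → X) k := by
      funext k
      refine Fin.cases ?_ (fun i => ?_) k <;> simp
    rw [h4, ← integral_add_left_eq_self _ (fun _ : Fin m => -c)]
    refine integral_congr_ae (ae_of_all _ fun x => hG x _ c)
  have h5 : ∫ c, ∫ y, f (e.symm (c, y)) = ∫ c, ∫ y, f (e.symm (c, (fun _ => c) + y)) := by
    refine integral_congr_ae (ae_of_all _ fun c => ?_)
    exact (integral_add_left_eq_self (fun y => f (e.symm (c, y))) _).symm
  rw [h1, h5, integral_integral_swap
    (f := fun (c : X) (y : Fin n → X) => f (e.symm (c, (fun _ => c) + y))) hSi]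
  simp only [h3, integral_const_mul, hW]
  rw [integral_mul_const, mul_comm]

end Gauge

section Density

lemma stdGPi_eq_withDensity (n : ℕ) : stdGPi n
    = volume.withDensity fun u : Fin n → ℝ => ENNReal.ofReal (∏ i, gaussianPDFReal 0 1 (u i)) := by
  have hg := integrable_gaussianPDFReal 0 1
  have hm : Measurable fun u : Fin n → ℝ => ENNReal.ofReal (∏ i, gaussianPDFReal 0 1 (u i)) := by
    have := measurable_gaussianPDFReal 0 1
    fun_prop
  refine Measure.pi_eq fun s hs => ?_
  have hsu : MeasurableSet (Set.univ.pi s) := MeasurableSet.univ_pi hs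
  rw [withDensity_apply _ hsu, volume_pi, Measure.restrict_pi_pi]
  rw [← ofReal_integral_eq_lintegral_ofReal
    (Integrable.fintype_prod fun i => hg.mono_measure Measure.restrict_le_self)
    (ae_of_all _ fun u => Finset.prod_nonneg fun i _ => gaussianPDFReal_nonneg 0 1 _)]
  rw [integral_fintype_prod_eq_prod (f := fun _ => gaussianPDFReal 0 1),
    ENNReal.ofReal_prod_of_nonneg fun i _ => integral_nonneg (gaussianPDFReal_nonneg 0 1)]
  refine Finset.prod_congr rfl fun i _ => ?_
  rw [stdG, gaussianReal_apply_eq_integral _ one_ne_zero]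

lemma prod_gaussianPDFReal (n : ℕ) (u : Fin n → ℝ) :
    ∏ i, gaussianPDFReal 0 1 (u i) = (√(2 * π))⁻¹ ^ n * exp (-(∑ i, u i ^ 2) / 2) := by
  simp only [stdG_pdf, Finset.prod_mul_distrib, ← exp_sum, ← Finset.mul_sum]
  simp only [Finset.prod_const, Finset.card_univ, Fintype.card_fin]
  congr 2; ring

lemma gaussPair_eq_withDensity (m n : ℕ) : gaussPair m n
    = volume.withDensity fun p : (Fin m → ℝ) × (Fin n → ℝ) => ENNReal.ofReal
      ((√(2 * π))⁻¹ ^ (m + n) * exp (-(∑ i, p.1 i ^ 2 + ∑ k, p.2 k ^ 2) / 2)) := by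
  have hm : ∀ n, Measurable fun u : Fin n → ℝ =>
      ENNReal.ofReal (∏ i, gaussianPDFReal 0 1 (u i)) := by
    have := measurable_gaussianPDFReal 0 1
    fun_prop
  rw [gaussPair, stdGPi_eq_withDensity, stdGPi_eq_withDensity, prod_withDensity (hm m) (hm n),
    Measure.volume_eq_prod]
  congr 1
  funext p
  rw [← ENNReal.ofReal_mul (Finset.prod_nonneg fun i _ => gaussianPDFReal_nonneg 0 1 _),
    prod_gaussianPDFReal, prod_gaussianPDFReal, pow_add]
  congr 1
  rw [neg_add, add_div, exp_add]
  ring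

lemma integral_gaussPair_eq (m n : ℕ) (f : (Fin m → ℝ) × (Fin n → ℝ) → ℂ) :
    ∫ p, f p ∂gaussPair m n = ((√(2 * π))⁻¹ ^ (m + n) : ℝ)
      * ∫ p : (Fin m → ℝ) × (Fin n → ℝ),
          Complex.exp (-(∑ i, (p.1 i : ℂ) ^ 2 + ∑ k, (p.2 k : ℂ) ^ 2) / 2) * f p := by
  rw [gaussPair_eq_withDensity, integral_withDensity_eq_integral_toReal_smul (by fun_prop)
    (ae_of_all _ fun _ => ENNReal.ofReal_lt_top), ← integral_const_mul]
  refine integral_congr_ae (ae_of_all _ fun p => ?_)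
  dsimp only
  rw [ENNReal.toReal_ofReal (by positivity), Complex.real_smul, Complex.ofReal_mul, mul_assoc]
  push_cast
  rfl

end Density

section Slice

variable {m n : ℕ} {L ζ : ℝ} {Φ : ℝ → ℂ}

/-- The pairs of vectors whose coordinate sums are bounded by `ζ`. -/
def strip (m n : ℕ) (ζ : ℝ) : Set ((Fin m → ℝ) × (Fin n → ℝ)) :=
  {p | ∀ j k, |p.1 j + p.2 k| ≤ ζ}

/-- The truncated integrand on Euclidean space. -/
noncomputable def stripFun (m n : ℕ) (Φ : ℝ → ℂ) (ζ : ℝ) :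
    (Fin m → ℝ) × (Fin n → ℝ) → ℂ :=
  (strip m n ζ).indicator fun p =>
    Complex.exp (∑ j, ∑ k, (Φ (p.1 j + p.2 k) - ((p.1 j + p.2 k : ℝ) : ℂ) ^ 2 / 2))

/-- The truncated Gaussian weight breaking the translation symmetry. -/
noncomputable def avgWeight (m n : ℕ) (L : ℝ) (c : ℝ) : ℂ :=
  {c : ℝ | √m * |c| ≤ L / √n}.indicator (fun c => Complex.exp (-(n * m * (c : ℂ) ^ 2) / 2)) c

/-- The coordinates in which the quadratic form is diagonal. -/
noncomputable def unscale (m n : ℕ) (p : (Fin m → ℝ) × (Fin n → ℝ)) :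
    (Fin m → ℝ) × (Fin n → ℝ) :=
  (fun j => p.1 j / √n - avg p.2 / √m, fun k => p.2 k / √m)

lemma isClosed_strip (m n : ℕ) (ζ : ℝ) : IsClosed (strip m n ζ) := by
  have h : strip m n ζ = ⋂ j, ⋂ k, {p | |p.1 j + p.2 k| ≤ ζ} := by
    ext p; simp [strip]
  rw [h]
  exact isClosed_iInter fun j => isClosed_iInter fun k =>
    isClosed_le (by fun_prop) continuous_const

lemma continuous_unscale : Continuous (unscale m n) := by
  have := continuous_avg (n := n)
  unfold unscale; fun_prop

lemma unscale_add (p : (Fin m → ℝ) × (Fin n → ℝ)) (j : Fin m) (k : Fin n) :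
    (unscale m n p).1 j + (unscale m n p).2 k = cell p.1 p.2 j k := by
  simp only [unscale, cell]; ring

lemma avg_unscale (p : (Fin m → ℝ) × (Fin n → ℝ)) :
    avg (unscale m n p).2 = avg p.2 / √m := by
  simp only [unscale, avg, ← Finset.sum_div]
  ring

lemma unscale_mem_iff (hm : 0 < m) (p : (Fin m → ℝ) × (Fin n → ℝ)) :
    (unscale m n p ∈ strip m n (L ^ 3 / √n) ∧ √m * |avg (unscale m n p).2| ≤ L / √n)
      ↔ p ∈ boxSet m n L := by
  have hsm : 0 < √(m : ℝ) := by positivity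
  have e : √m * |avg p.2 / √m| = |avg p.2| := by
    rw [abs_div, abs_of_pos hsm]; field_simp
  simp only [strip, boxSet, Set.mem_ofPred_eq, unscale_add, avg_unscale, e]

lemma exists_unscale (hm : 0 < m) (hn : 0 < n) (p : (Fin m → ℝ) × (Fin n → ℝ)) :
    ∃ q, unscale m n q = p := by
  have hsm : 0 < √(m : ℝ) := by positivity
  have hsn : 0 < √(n : ℝ) := by positivity
  refine ⟨(fun j => √n * (p.1 j + avg p.2), fun k => √m * p.2 k), ?_⟩
  have h : avg (fun k => √m * p.2 k) = √m * avg p.2 := by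
    simp only [avg, ← Finset.mul_sum]; ring
  refine Prod.ext ?_ ?_
  · funext j
    simp only [unscale, h]; field_simp; ring
  · funext k
    simp only [unscale]; field_simp

lemma sum_sum_cell_sq (hm : 0 < m) (hn : 0 < n) (u : Fin m → ℝ) (y : Fin n → ℝ) :
    ∑ j, ∑ k, cell u y j k ^ 2 = ∑ j, u j ^ 2 + ∑ k, y k ^ 2 - n * avg y ^ 2 := by
  have hsm : √(m : ℝ) ^ 2 = m := Real.sq_sqrt (by positivity)
  have hsn : √(n : ℝ) ^ 2 = n := Real.sq_sqrt (by positivity)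
  have hm' : (m : ℝ) ≠ 0 := by positivity
  have hn' : (n : ℝ) ≠ 0 := by positivity
  have e : ∀ j k, cell u y j k ^ 2
      = u j ^ 2 / n + 2 * (u j / √n) / √m * (y k - avg y) + (y k - avg y) ^ 2 / m := by
    intro j k
    unfold cell
    rw [add_sq, div_pow, div_pow, hsm, hsn]; ring
  simp only [e, Finset.sum_add_distrib, ← Finset.mul_sum, ← Finset.sum_div, sum_sub_avg hn,
    sum_sub_avg_sq hn]
  simp only [Finset.sum_const, Finset.card_univ, Fintype.card_fin, nsmul_eq_mul,
    ← Finset.mul_sum, mul_zero, add_zero]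
  field_simp
  ring

lemma stripFun_mul_avgWeight_unscale (hm : 0 < m) (hn : 0 < n)
    (p : (Fin m → ℝ) × (Fin n → ℝ)) :
    stripFun m n Φ (L ^ 3 / √n) (unscale m n p) * avgWeight m n L (avg (unscale m n p).2)
      = (boxSet m n L).indicator (fun p =>
          Complex.exp (-(∑ i, (p.1 i : ℂ) ^ 2 + ∑ k, (p.2 k : ℂ) ^ 2) / 2)
            * Complex.exp (∑ j, ∑ k, Φ (cell p.1 p.2 j k))) p := by
  have hiff := unscale_mem_iff (L := L) (n := n) hm p
  by_cases hp : p ∈ boxSet m n L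
  · obtain ⟨h1, h2⟩ := hiff.2 hp
    rw [Set.indicator_of_mem hp, stripFun, avgWeight, Set.indicator_of_mem h1,
      Set.indicator_of_mem (s := {c : ℝ | √m * |c| ≤ L / √n}) h2]
    rw [← Complex.exp_add, ← Complex.exp_add]
    congr 1
    simp only [unscale_add, avg_unscale]
    have h3 := congrArg (fun x : ℝ => (x : ℂ)) (sum_sum_cell_sq hm hn p.1 p.2)
    push_cast at h3
    simp only [Finset.sum_sub_distrib, ← Finset.sum_div]
    rw [h3]
    have hsm : ((√(m : ℝ) : ℝ) : ℂ) ^ 2 = m := by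
      rw [← Complex.ofReal_pow, Real.sq_sqrt (by positivity)]; simp
    have hm' : (m : ℂ) ≠ 0 := by exact_mod_cast hm.ne'
    push_cast
    rw [div_pow, hsm]
    field_simp
    ring
  · rw [Set.indicator_of_notMem hp]
    by_cases h1 : unscale m n p ∈ strip m n (L ^ 3 / √n)
    · have h2 : avg (unscale m n p).2 ∉ {c : ℝ | √m * |c| ≤ L / √n} :=
        fun h2 => hp (hiff.1 ⟨h1, h2⟩)
      rw [avgWeight, Set.indicator_of_notMem h2, mul_zero]
    · rw [stripFun, Set.indicator_of_notMem h1, zero_mul]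

lemma integrable_stripFun_mul_avgWeight (hm : 0 < m) (hn : 0 < n) (hL : 1 ≤ L)
    (hmn : (m : ℝ) ≤ L * n) (hΦ : Continuous Φ) :
    Integrable fun p : (Fin m → ℝ) × (Fin n → ℝ) =>
      stripFun m n Φ (L ^ 3 / √n) p * avgWeight m n L (avg p.2) := by
  set S : Set ((Fin m → ℝ) × (Fin n → ℝ)) :=
    strip m n (L ^ 3 / √n) ∩ {p | √m * |avg p.2| ≤ L / √n} with hS
  have hca := continuous_avg (n := n)
  have hSc : IsClosed S := (isClosed_strip _ _ _).inter
    (isClosed_le (by fun_prop) continuous_const)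
  have hSk : IsCompact S := by
    refine ((isCompact_boxSet hm hn hL hmn).image continuous_unscale).of_isClosed_subset hSc ?_
    intro p hp
    obtain ⟨q, rfl⟩ := exists_unscale hm hn p
    exact ⟨q, (unscale_mem_iff hm q).1 hp, rfl⟩
  have e : (fun p : (Fin m → ℝ) × (Fin n → ℝ) =>
      stripFun m n Φ (L ^ 3 / √n) p * avgWeight m n L (avg p.2))
      = S.indicator fun p =>
        Complex.exp (∑ j, ∑ k, (Φ (p.1 j + p.2 k) - ((p.1 j + p.2 k : ℝ) : ℂ) ^ 2 / 2))
          * Complex.exp (-(n * m * ((avg p.2 : ℝ) : ℂ) ^ 2) / 2) := by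
    funext p
    rw [hS, Set.inter_indicator_mul]
    rfl
  rw [e, integrable_indicator_iff hSc.measurableSet]
  refine ContinuousOn.integrableOn_compact hSk (Continuous.continuousOn ?_)
  fun_prop

lemma integral_unscale (hm : 0 < m) (hn : 0 < n) (H : (Fin m → ℝ) × (Fin n → ℝ) → ℂ) :
    ∫ y : Fin n → ℝ, ∫ x : Fin m → ℝ, H (x, y)
      = (((√n)⁻¹ ^ m * (√m)⁻¹ ^ n : ℝ) : ℂ)
        * ∫ y : Fin n → ℝ, ∫ x : Fin m → ℝ, H (unscale m n (x, y)) := by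
  have hsm : 0 < √(m : ℝ) := by positivity
  have hsn : 0 < √(n : ℝ) := by positivity
  have inner : ∀ w : Fin n → ℝ, ∫ x : Fin m → ℝ, H (unscale m n (x, w))
      = (((√n)⁻¹ ^ m)⁻¹ : ℝ) * ∫ x : Fin m → ℝ, H (x, (√m)⁻¹ • w) := by
    intro w
    have h1 : ∀ x : Fin m → ℝ, H (unscale m n (x, w))
        = (fun z => H (z + (fun _ => - (avg w / √m)), (√m)⁻¹ • w)) ((√n)⁻¹ • x) := by
      intro x
      dsimp only
      congr 1
      refine Prod.ext ?_ ?_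
      · funext j
        simp only [unscale, Pi.add_apply, Pi.smul_apply, smul_eq_mul]; ring
      · funext k
        simp only [unscale, Pi.smul_apply, smul_eq_mul]; ring
    simp only [h1]
    rw [Measure.integral_comp_smul volume
      (fun z => H (z + (fun _ => - (avg w / √m)), (√m)⁻¹ • w))]
    rw [integral_add_right_eq_self (fun z => H (z, (√m)⁻¹ • w))]
    rw [Module.finrank_fin_fun, abs_of_pos (by positivity), Complex.real_smul]
  simp only [inner]
  rw [integral_const_mul, Measure.integral_comp_smul volume
    (fun y : Fin n → ℝ => ∫ x : Fin m → ℝ, H (x, y)), Module.finrank_fin_fun,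
    abs_of_pos (by positivity), Complex.real_smul, ← mul_assoc, ← mul_assoc,
    ← Complex.ofReal_mul, ← Complex.ofReal_mul]
  rw [show (√n)⁻¹ ^ m * (√m)⁻¹ ^ n * ((√n)⁻¹ ^ m)⁻¹ * ((√m)⁻¹ ^ n)⁻¹ = (1 : ℝ) by field_simp]
  simp

lemma integral_stripFun_mul_avgWeight (hm : 0 < m) (hn : 0 < n) (hL : 1 ≤ L)
    (hmn : (m : ℝ) ≤ L * n) (hΦ : Continuous Φ) :
    ∫ p : (Fin m → ℝ) × (Fin n → ℝ), stripFun m n Φ (L ^ 3 / √n) p * avgWeight m n L (avg p.2)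
      = (((√n)⁻¹ ^ m * (√m)⁻¹ ^ n * √(2 * π) ^ (m + n) : ℝ) : ℂ)
        * ∫ p in boxSet m n L, Complex.exp (∑ j, ∑ k, Φ (cell p.1 p.2 j k)) ∂gaussPair m n := by
  have hint := integrable_stripFun_mul_avgWeight hm hn hL hmn hΦ
  have hs := sqrt_pos.2 two_pi_pos
  rw [← integral_indicator measurableSet_boxSet, integral_gaussPair_eq]
  rw [Measure.volume_eq_prod] at hint ⊢
  rw [integral_prod_symm _ hint,
    integral_unscale hm hn fun p => stripFun m n Φ (L ^ 3 / √n) p * avgWeight m n L (avg p.2)]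
  simp only [stripFun_mul_avgWeight_unscale hm hn]
  have hi : Integrable ((boxSet m n L).indicator fun p =>
      Complex.exp (-(∑ i, (p.1 i : ℂ) ^ 2 + ∑ k, (p.2 k : ℂ) ^ 2) / 2)
        * Complex.exp (∑ j, ∑ k, Φ (cell p.1 p.2 j k)))
      ((volume : Measure (Fin m → ℝ)).prod (volume : Measure (Fin n → ℝ))) := by
    rw [integrable_indicator_iff measurableSet_boxSet]
    refine ContinuousOn.integrableOn_compact (isCompact_boxSet hm hn hL hmn)
      (Continuous.continuousOn ?_)
    have := fun j k => continuous_cell (m := m) (n := n) j k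
    fun_prop
  rw [← integral_prod_symm _ hi]
  rw [← mul_assoc, ← Complex.ofReal_mul,
    show (√n)⁻¹ ^ m * (√m)⁻¹ ^ n * √(2 * π) ^ (m + n) * (√(2 * π))⁻¹ ^ (m + n)
      = (√n)⁻¹ ^ m * (√m)⁻¹ ^ n by rw [inv_pow (√(2 * π))]; field_simp]
  congr 1
  refine integral_congr_ae (ae_of_all _ fun p => ?_)
  by_cases hp : p ∈ boxSet m n L <;> simp [hp]

end Slice

section Lift

variable {m n : ℕ} {L ζ : ℝ} {Φ : ℝ → ℂ}

/-- The image of a real vector in the torus. -/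
def toTorus {N : ℕ} (x : Fin N → ℝ) : Fin N → UnitAddCircle := fun j => (x j : UnitAddCircle)

/-- The fundamental cube of the torus. -/
def cube (N : ℕ) : Set (Fin N → ℝ) := Set.univ.pi fun _ => Set.Ioc (-(1 / 2)) (-(1 / 2) + 1)

lemma measurableSet_cube (N : ℕ) : MeasurableSet (cube N) :=
  MeasurableSet.univ_pi fun _ => measurableSet_Ioc

lemma measurePreserving_toTorus (N : ℕ) :
    MeasurePreserving (toTorus (N := N)) (volume.restrict (cube N)) volume := by
  rw [cube, volume_pi, volume_pi, Measure.restrict_pi_pi]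
  exact measurePreserving_pi _ _ fun _ => UnitAddCircle.measurePreserving_mk (-(1 / 2))

lemma integral_torus_eq_cube {N : ℕ} {f : (Fin N → UnitAddCircle) → ℂ}
    (hf : AEStronglyMeasurable f volume) :
    ∫ x, f x = ∫ x in cube N, f (toTorus x) := by
  have h := measurePreserving_toTorus N
  rw [← h.map_eq] at hf ⊢
  exact integral_map h.measurable.aemeasurable hf

lemma exists_toTorus {N : ℕ} (x : Fin N → UnitAddCircle) : ∃ y, toTorus y = x := by
  choose y hy using fun j => QuotientAddGroup.mk_surjective (x j)
  exact ⟨y, funext hy⟩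

lemma norm_coe_eq_abs {x : ℝ} (hx : |x| ≤ 1 / 2) : ‖(x : UnitAddCircle)‖ = |x| := by
  rw [AddCircle.norm_coe_eq_abs_iff 1 one_ne_zero]
  simpa using hx

lemma abs_le_of_mem_cube {N : ℕ} {x : Fin N → ℝ} (hx : x ∈ cube N) (j : Fin N) :
    |x j| ≤ 1 / 2 := by
  have := hx j (Set.mem_univ j)
  rw [Set.mem_Ioc] at this
  rw [abs_le]; constructor <;> linarith [this.1, this.2]

lemma mem_cube_of_abs_lt {N : ℕ} {x : Fin N → ℝ} (hx : ∀ j, |x j| < 1 / 2) : x ∈ cube N := by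
  intro j _
  have := abs_lt.1 (hx j)
  rw [Set.mem_Ioc]; constructor <;> linarith [this.1, this.2]

/-- The point whose second component starts with zero. -/
def pin {X : Type*} [Zero X] (x : Fin m → X) (y : Fin n → X) :
    (Fin m → X) × (Fin (n + 1) → X) := (x, Fin.cons 0 y)

lemma abs_le_of_pin_mem_strip {d : ℝ} {x : Fin m → ℝ} {y : Fin n → ℝ}
    (h : pin x y ∈ strip m (n + 1) d) : (∀ j, |x j| ≤ d) ∧ (∀ j k, |x j + y k| ≤ d) := by
  refine ⟨fun j => by simpa [pin] using h j 0, fun j k => by simpa [pin] using h j k.succ⟩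

lemma toTorus_pin (x : Fin m → ℝ) (y : Fin n → ℝ) :
    pin (toTorus x) (toTorus y)
      = (toTorus (pin x y).1, toTorus (pin x y).2) := by
  refine Prod.ext rfl ?_
  funext k
  refine Fin.cases ?_ (fun i => ?_) k <;> simp [pin, toTorus]

lemma toTorus_pin_mem_iff {d : ℝ} (hm : 0 < m) (hd : d < 1 / 6) {x : Fin m → ℝ} {y : Fin n → ℝ}
    (hx : x ∈ cube m) (hy : y ∈ cube n) :
    pin (toTorus x) (toTorus y) ∈ torusBox m (n + 1) d ↔ pin x y ∈ strip m (n + 1) d := by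
  have hz : ∀ j k, (pin (toTorus x) (toTorus y)).1 j + (pin (toTorus x) (toTorus y)).2 k
      = (((pin x y).1 j + (pin x y).2 k : ℝ) : UnitAddCircle) := by
    intro j k
    rw [toTorus_pin]; simp [toTorus]
  constructor
  · intro h j k
    have hxj : ∀ j, |x j| ≤ d := fun j => by
      have h1 := h j 0
      rw [hz] at h1
      simp only [pin, Fin.cons_zero, add_zero] at h1
      rwa [norm_coe_eq_abs (abs_le_of_mem_cube hx j)] at h1
    have hyk : ∀ k, |y k| ≤ 2 * d := fun k => by
      have h1 := h ⟨0, hm⟩ k.succ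
      have h2 : ‖(y k : UnitAddCircle)‖ ≤ 2 * d := by
        rw [hz] at h1
        simp only [pin, Fin.cons_succ] at h1
        calc ‖(y k : UnitAddCircle)‖
            = ‖((x ⟨0, hm⟩ + y k : ℝ) : UnitAddCircle) - (x ⟨0, hm⟩ : UnitAddCircle)‖ := by
              simp
          _ ≤ d + d := (norm_sub_le _ _).trans (add_le_add h1
              (by rw [norm_coe_eq_abs (abs_le_of_mem_cube hx _)]; exact hxj _))
          _ = 2 * d := by ring
      rwa [norm_coe_eq_abs (abs_le_of_mem_cube hy k)] at h2
    have hb : |(pin x y).1 j + (pin x y).2 k| ≤ 1 / 2 := by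
      refine (abs_add_le _ _).trans ?_
      have h1 := hxj j
      have h0 := (abs_nonneg _).trans h1
      have h2 : |(pin x y).2 k| ≤ 2 * d := by
        refine Fin.cases ?_ (fun i => ?_) k
        · simp only [pin, Fin.cons_zero, abs_zero]; linarith
        · simpa only [pin, Fin.cons_succ] using hyk i
      have h3 : |(pin x y).1 j| ≤ d := h1
      linarith
    have h1 := h j k
    rwa [hz, norm_coe_eq_abs hb] at h1
  · intro h j k
    rw [hz]
    have h1 := h j k
    exact (le_of_eq (norm_coe_eq_abs (by linarith))).trans h1

/-- Integrals over the torus box with one pinned coordinate lift to Euclidean space. -/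
lemma integral_pin_lift {d : ℝ} (hm : 0 < m) (hd : d < 1 / 6)
    {F : (Fin m → UnitAddCircle) × (Fin (n + 1) → UnitAddCircle) → ℂ} (hFc : Continuous F)
    {H : (Fin m → ℝ) × (Fin (n + 1) → ℝ) → ℂ}
    (hF : ∀ x y, F (toTorus x, toTorus y) = H (x, y)) :
    ∫ y : Fin n → UnitAddCircle, ∫ x : Fin m → UnitAddCircle,
        (torusBox m (n + 1) d).indicator F (pin x y)
      = ∫ y : Fin n → ℝ, ∫ x : Fin m → ℝ, (strip m (n + 1) d).indicator H (pin x y) := by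
  have hpc : Continuous fun q : (Fin m → UnitAddCircle) × (Fin n → UnitAddCircle) =>
      pin q.1 q.2 := by
    refine continuous_fst.prodMk (continuous_pi fun k => ?_)
    refine Fin.cases ?_ (fun i => ?_) k
    · simpa using continuous_const
    · simp only [Fin.cons_succ]; fun_prop
  have hme : Measurable fun q : (Fin m → UnitAddCircle) × (Fin n → UnitAddCircle) =>
      (torusBox m (n + 1) d).indicator F (pin q.1 q.2) :=
    (hFc.measurable.indicator (isClosed_torusBox _ _ _).measurableSet).comp hpc.measurable
  have hout : ∀ x y, x ∉ cube m ∨ y ∉ cube n →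
      (strip m (n + 1) d).indicator H (pin x y) = 0 := by
    intro x y hxy
    refine Set.indicator_of_notMem (fun h => ?_) _
    obtain ⟨h1, h2⟩ := abs_le_of_pin_mem_strip h
    have hx : x ∈ cube m := mem_cube_of_abs_lt fun j => by linarith [h1 j]
    have hy : y ∈ cube n := mem_cube_of_abs_lt fun k => by
      have h3 := h1 ⟨0, hm⟩
      have h4 := h2 ⟨0, hm⟩ k
      calc |y k| = |(x ⟨0, hm⟩ + y k) - x ⟨0, hm⟩| := by congr 1; ring
        _ ≤ |x ⟨0, hm⟩ + y k| + |x ⟨0, hm⟩| := abs_sub _ _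
        _ < 1 / 2 := by linarith
    exact hxy.elim (fun h => h hx) fun h => h hy
  rw [integral_torus_eq_cube]
  swap
  · exact (hme.stronglyMeasurable.integral_prod_left (μ := volume)).aestronglyMeasurable
  rw [← setIntegral_eq_integral_of_forall_compl_eq_zero (s := cube n)
    (f := fun y => ∫ x : Fin m → ℝ, (strip m (n + 1) d).indicator H (pin x y))]
  swap
  · intro y hy
    simp [hout _ _ (Or.inr hy)]
  refine setIntegral_congr_fun (measurableSet_cube n) fun y hy => ?_
  rw [integral_torus_eq_cube
    (f := fun x => (torusBox m (n + 1) d).indicator F (pin x (toTorus y)))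
    (hme.comp (measurable_id.prodMk measurable_const)).aestronglyMeasurable]
  rw [← setIntegral_eq_integral_of_forall_compl_eq_zero (s := cube m)
    (f := fun x : Fin m → ℝ => (strip m (n + 1) d).indicator H (pin x y))
    fun x hx => hout _ _ (Or.inl hx)]
  refine setIntegral_congr_fun (measurableSet_cube m) fun x hx => ?_
  have hiff := toTorus_pin_mem_iff hm hd hx hy
  by_cases h : pin x y ∈ strip m (n + 1) d
  · rw [Set.indicator_of_mem h, Set.indicator_of_mem (hiff.2 h), toTorus_pin, hF]
  · rw [Set.indicator_of_notMem h, Set.indicator_of_notMem fun h' => h (hiff.1 h')]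

lemma integral_pin_scale {a : ℝ} (ha : 0 < a) (H : (Fin m → ℝ) × (Fin (n + 1) → ℝ) → ℂ) :
    ∫ y : Fin n → ℝ, ∫ x : Fin m → ℝ, H (pin x y)
      = (a ^ (m + n) : ℝ)
        * ∫ y : Fin n → ℝ, ∫ x : Fin m → ℝ, H (pin (a • x) (a • y)) := by
  have inner : ∀ y : Fin n → ℝ, ∫ x : Fin m → ℝ, H (pin (a • x) (a • y))
      = ((a ^ m)⁻¹ : ℝ) * ∫ x : Fin m → ℝ, H (pin x (a • y)) := by
    intro y
    rw [Measure.integral_comp_smul volume (fun x => H (pin x (a • y))),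
      Module.finrank_fin_fun, abs_of_pos (by positivity), Complex.real_smul]
  simp only [inner]
  rw [integral_const_mul, Measure.integral_comp_smul volume
    (fun y : Fin n → ℝ => ∫ x : Fin m → ℝ, H (pin x y)), Module.finrank_fin_fun,
    abs_of_pos (by positivity), Complex.real_smul, ← mul_assoc, ← mul_assoc,
    ← Complex.ofReal_mul, ← Complex.ofReal_mul]
  rw [show a ^ (m + n) * (a ^ m)⁻¹ * (a ^ n)⁻¹ = (1 : ℝ) by rw [pow_add]; field_simp]
  simp

lemma integral_avgWeight (hm : 0 < m) (hn : 0 < n) (L : ℝ) :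
    ∫ c, avgWeight m n L c
      = ((√(2 * π) * (√m)⁻¹ * (√n)⁻¹ * stdG.real {x | |x| ≤ L} : ℝ) : ℂ) := by
  have hsm : 0 < √(m : ℝ) := by positivity
  have hsn : 0 < √(n : ℝ) := by positivity
  have hs := sqrt_pos.2 two_pi_pos
  have h1 : ∀ c, avgWeight m n L c = (fun x : ℝ => (({x | |x| ≤ L}.indicator
      (fun x => √(2 * π) * gaussianPDFReal 0 1 x) x : ℝ) : ℂ)) ((√m * √n) * c) := by
    intro c
    have e : |√m * √n * c| ≤ L ↔ √m * |c| ≤ L / √n := by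
      rw [abs_mul, abs_of_pos (by positivity), le_div_iff₀ hsn]
      constructor <;> intro h <;> linarith
    by_cases hc : √m * |c| ≤ L / √n
    · rw [avgWeight, Set.indicator_of_mem (s := {c : ℝ | √m * |c| ≤ L / √n}) hc]
      dsimp only
      rw [Set.indicator_of_mem (s := {x : ℝ | |x| ≤ L}) (e.2 hc), stdG_pdf,
        ← mul_assoc, mul_inv_cancel₀ hs.ne', one_mul, mul_pow, mul_pow,
        Real.sq_sqrt (by positivity), Real.sq_sqrt (by positivity), Complex.ofReal_exp]
      congr 1
      push_cast; ring
    · rw [avgWeight, Set.indicator_of_notMem (s := {c : ℝ | √m * |c| ≤ L / √n}) hc]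
      dsimp only
      rw [Set.indicator_of_notMem (s := {x : ℝ | |x| ≤ L}) (fun h => hc (e.1 h))]
      simp
  simp only [h1]
  rw [Measure.integral_comp_mul_left (fun x : ℝ => (({x | |x| ≤ L}.indicator
      (fun x => √(2 * π) * gaussianPDFReal 0 1 x) x : ℝ) : ℂ)), abs_of_pos (by positivity),
    integral_complex_ofReal, Complex.real_smul, ← Complex.ofReal_mul]
  congr 1
  have hms : MeasurableSet {x : ℝ | |x| ≤ L} :=
    (isClosed_le continuous_abs continuous_const).measurableSet
  rw [integral_indicator hms, integral_const_mul, measureReal_def, stdG,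
    gaussianReal_apply_eq_integral _ one_ne_zero, ENNReal.toReal_ofReal
      (integral_nonneg (gaussianPDFReal_nonneg 0 1))]
  rw [mul_inv]; ring

/-- The pinned integral over Euclidean space as a Gaussian integral. -/
lemma integral_pin_stripFun (hm : 0 < m) (hL : 1 ≤ L) (hmn : (m : ℝ) ≤ L * (n + 1 : ℕ))
    (hΦ : Continuous Φ) :
    ((√(2 * π) * (√m)⁻¹ * (√(n + 1 : ℕ))⁻¹ * stdG.real {x | |x| ≤ L} : ℝ) : ℂ)
        * ∫ y : Fin n → ℝ, ∫ x : Fin m → ℝ,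
            stripFun m (n + 1) Φ (L ^ 3 / √(n + 1 : ℕ)) (pin x y)
      = (((√(n + 1 : ℕ))⁻¹ ^ m * (√m)⁻¹ ^ (n + 1) * √(2 * π) ^ (m + (n + 1)) : ℝ) : ℂ)
        * ∫ p in boxSet m (n + 1) L,
            Complex.exp (∑ j, ∑ k, Φ (cell p.1 p.2 j k)) ∂gaussPair m (n + 1) := by
  rw [← integral_stripFun_mul_avgWeight hm n.succ_pos hL hmn hΦ]
  rw [← integral_avgWeight hm n.succ_pos]
  refine (integral_gauge (fun x y => stripFun m (n + 1) Φ (L ^ 3 / √(n + 1 : ℕ)) (x, y))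
    (fun y => avgWeight m (n + 1) L (avg y)) _ ?_ ?_
    (integrable_stripFun_mul_avgWeight hm n.succ_pos hL hmn hΦ)).symm
  · intro x y c
    have h : ∀ j k, -c + x j + (c + y k) = x j + y k := fun j k => by ring
    simp only [stripFun, Set.indicator, strip, Set.mem_ofPred_eq, h]
  · intro y
    have h : ∀ c : ℝ, avg (Fin.cons c fun k => c + y k : Fin (n + 1) → ℝ)
        = c + (∑ k, y k) / (n + 1 : ℕ) := by
      intro c
      have : ((n + 1 : ℕ) : ℝ) ≠ 0 := by positivity
      rw [avg, Fin.sum_univ_succ]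
      simp only [Fin.cons_zero, Fin.cons_succ, Finset.sum_add_distrib, Finset.sum_const,
        Finset.card_univ, Fintype.card_fin, nsmul_eq_mul]
      field_simp
      push_cast
      ring
    simp only [h]
    exact integral_add_right_eq_self _ _

/-- The reference mass of the torus box. -/
noncomputable def boxMass (a : ℝ) (m n : ℕ) : ℝ :=
  (a * √(2 * π)) ^ (m + n - 1) * (√n)⁻¹ ^ (m - 1) * (√m)⁻¹ ^ (n - 1)

/-- The integral over the torus box as a Gaussian integral. -/
lemma integral_torusBox_eq {a : ℝ} (hm : 0 < m) (hn : 0 < n) (hL : 1 ≤ L)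
    (hmn : (m : ℝ) ≤ L * n) (hΦ : Continuous Φ) (ha : 0 < a) (had : a * (L ^ 3 / √n) < 1 / 6)
    {F : (Fin m → UnitAddCircle) × (Fin n → UnitAddCircle) → ℂ} (hFc : Continuous F)
    (hF : ∀ x y, F (toTorus x, toTorus y)
      = Complex.exp (∑ j, ∑ k, (Φ ((x j + y k) / a) - (((x j + y k) / a : ℝ) : ℂ) ^ 2 / 2))) :
    (stdG.real {x | |x| ≤ L} : ℂ) * ∫ q in torusBox m n (a * (L ^ 3 / √n)), F q
      = (boxMass a m n : ℂ) * ∫ p in boxSet m n L,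
          Complex.exp (∑ j, ∑ k, Φ (cell p.1 p.2 j k)) ∂gaussPair m n := by
  obtain ⟨n, rfl⟩ : ∃ n', n = n' + 1 := ⟨n - 1, by omega⟩
  set d := a * (L ^ 3 / √(n + 1 : ℕ)) with hd
  set G := (torusBox m (n + 1) d).indicator F with hG
  have hGi : Integrable G := (hFc.integrable_of_hasCompactSupport
    (HasCompactSupport.of_compactSpace _)).indicator (isClosed_torusBox _ _ _).measurableSet
  have hs := sqrt_pos.2 two_pi_pos
  have hsm : 0 < √(m : ℝ) := by positivity
  have hsn : 0 < √((n + 1 : ℕ) : ℝ) := by positivity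
  have h1 : ∫ q in torusBox m (n + 1) d, F q
      = ∫ y : Fin n → UnitAddCircle, ∫ x : Fin m → UnitAddCircle, G (pin x y) := by
    rw [← integral_indicator (isClosed_torusBox _ _ _).measurableSet]
    have := integral_gauge (fun x y => G (x, y)) (fun _ => 1) 1 ?_ (fun _ => by simp)
      (by simpa using hGi)
    · simp only [mul_one, one_mul] at this
      exact this
    · intro x y c
      have hbox : ((fun j => -c + x j, fun k => c + y k) ∈ torusBox m (n + 1) d)
          ↔ ((x, y) ∈ torusBox m (n + 1) d) := by
        have h : ∀ j k, -c + x j + (c + y k) = x j + y k := fun j k => by abel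
        simp only [torusBox, Set.mem_ofPred_eq, h]
      have hFF : F (fun j => -c + x j, fun k => c + y k) = F (x, y) := by
        obtain ⟨c, rfl⟩ := QuotientAddGroup.mk_surjective c
        obtain ⟨x, rfl⟩ := exists_toTorus x
        obtain ⟨y, rfl⟩ := exists_toTorus y
        have h2 := hF (fun j => -c + x j) (fun k => c + y k)
        have h3 : ∀ j k, -c + x j + (c + y k) = x j + y k := fun j k => by ring
        simp only [h3] at h2
        rw [hF, ← h2]
        rfl
      by_cases h : (x, y) ∈ torusBox m (n + 1) d
      · rw [hG, Set.indicator_of_mem h, Set.indicator_of_mem (hbox.2 h), hFF]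
      · rw [hG, Set.indicator_of_notMem h, Set.indicator_of_notMem fun h' => h (hbox.1 h')]
  have h2 := integral_pin_lift (m := m) (n := n) (d := d) hm had hFc
    (H := fun p => Complex.exp (∑ j, ∑ k, (Φ ((p.1 j + p.2 k) / a)
      - (((p.1 j + p.2 k) / a : ℝ) : ℂ) ^ 2 / 2))) hF
  have h3 : ∀ (x : Fin m → ℝ) (y : Fin n → ℝ),
      (strip m (n + 1) d).indicator (fun p => Complex.exp (∑ j, ∑ k,
        (Φ ((p.1 j + p.2 k) / a) - (((p.1 j + p.2 k) / a : ℝ) : ℂ) ^ 2 / 2)))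
        (pin (a • x) (a • y))
      = stripFun m (n + 1) Φ (L ^ 3 / √(n + 1 : ℕ)) (pin x y) := by
    intro x y
    have e : ∀ j k, (pin (a • x) (a • y)).1 j + (pin (a • x) (a • y)).2 k
        = a * ((pin x y).1 j + (pin x y).2 k) := by
      intro j k
      refine Fin.cases ?_ (fun i => ?_) k <;> simp [pin, mul_add]
    have e2 : ∀ z, a * z / a = z := fun z => by field_simp
    have e3 : ∀ z, |a * z| ≤ d ↔ |z| ≤ L ^ 3 / √(n + 1 : ℕ) := fun z => by
      rw [abs_mul, abs_of_pos ha, hd, mul_le_mul_iff_right₀ ha]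
    have hst : pin (a • x) (a • y) ∈ strip m (n + 1) d
        ↔ pin x y ∈ strip m (n + 1) (L ^ 3 / √(n + 1 : ℕ)) := by
      simp only [strip, Set.mem_ofPred_eq, e, e3]
    by_cases h : pin x y ∈ strip m (n + 1) (L ^ 3 / √(n + 1 : ℕ))
    · rw [stripFun, Set.indicator_of_mem h, Set.indicator_of_mem (hst.2 h)]
      simp only [e, e2]
    · rw [stripFun, Set.indicator_of_notMem h, Set.indicator_of_notMem fun h' => h (hst.1 h')]
  have h4 := integral_pin_scale (m := m) (n := n) ha ((strip m (n + 1) d).indicator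
    (fun p => Complex.exp (∑ j, ∑ k, (Φ ((p.1 j + p.2 k) / a)
      - (((p.1 j + p.2 k) / a : ℝ) : ℂ) ^ 2 / 2))))
  simp only [h3] at h4
  have h5 := integral_pin_stripFun (n := n) hm hL hmn hΦ
  rw [h1, h2, h4]
  set T := ∫ y : Fin n → ℝ, ∫ x : Fin m → ℝ,
    stripFun m (n + 1) Φ (L ^ 3 / √(n + 1 : ℕ)) (pin x y)
  set J := ∫ p in boxSet m (n + 1) L,
    Complex.exp (∑ j, ∑ k, Φ (cell p.1 p.2 j k)) ∂gaussPair m (n + 1)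
  have hk : ((√(2 * π) * (√m)⁻¹ * (√(n + 1 : ℕ))⁻¹ : ℝ) : ℂ) ≠ 0 :=
    Complex.ofReal_ne_zero.2 (by positivity)
  refine mul_left_cancel₀ hk ?_
  rw [Complex.ofReal_mul] at h5
  calc _ = ((a ^ (m + n) : ℝ) : ℂ) * (((√(2 * π) * (√m)⁻¹ * (√(n + 1 : ℕ))⁻¹ : ℝ) : ℂ)
        * (stdG.real {x | |x| ≤ L} : ℂ) * T) := by ring
    _ = ((a ^ (m + n) * ((√(n + 1 : ℕ))⁻¹ ^ m * (√m)⁻¹ ^ (n + 1) * √(2 * π) ^ (m + (n + 1))) : ℝ)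
        : ℂ) * J := by
          rw [h5, Complex.ofReal_mul (a ^ (m + n)) (_ * _), mul_assoc (Complex.ofReal _)]
    _ = _ := by
        rw [← mul_assoc (Complex.ofReal _) (Complex.ofReal _), ← Complex.ofReal_mul]
        congr 2
        obtain ⟨m, rfl⟩ : ∃ m', m = m' + 1 := ⟨m - 1, by omega⟩
        rw [boxMass, show m + 1 + (n + 1) - 1 = m + n + 1 by omega, Nat.add_sub_cancel,
          Nat.add_sub_cancel]
        ring

end Lift

section Coefficients

variable {l : ℝ}

/-- The normalized cumulant generating function without its quadratic term. -/
noncomputable def devFun (l z : ℝ) : ℂ := cgf l (z / √(l * (1 + l))) + (z : ℂ) ^ 2 / 2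

/-- The normalized third cumulant. -/
noncomputable def cubicCoeff (l : ℝ) : ℝ := (1 + 2 * l) / (6 * √(l * (1 + l)))

/-- The normalized fourth cumulant. -/
noncomputable def quarticCoeff (l : ℝ) : ℝ := (1 + 6 * (l * (1 + l))) / (24 * (l * (1 + l)))

/-- The coefficient of the fifth-order remainder. -/
noncomputable def quinticCoeff (l : ℝ) : ℝ :=
  (1 + 2 * l) * (1 + 12 * (l * (1 + l))) / √(l * (1 + l)) ^ 3

/-- The size of the variance correction. -/
noncomputable def varCoeff (l : ℝ) : ℝ := (1 + 2 * l) ^ 2 / (4 * l * (1 + l))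

lemma continuous_devFun (hl : 0 < l) : Continuous (devFun l) := by
  have h : Continuous (cgf l) := continuous_iff_continuousAt.2 fun x =>
    (hasDerivAt_cgf hl x).continuousAt
  unfold devFun; fun_prop

lemma norm_devFun_sub_le (hl : 0 < l) (z : ℝ) :
    ‖devFun l z + Complex.I * cubicCoeff l * (z : ℂ) ^ 3 - quarticCoeff l * (z : ℂ) ^ 4‖
      ≤ quinticCoeff l * |z| ^ 5 := by
  have hv : 0 < l * (1 + l) := by positivity
  have hs : 0 < √(l * (1 + l)) := by positivity
  have hs2 : √(l * (1 + l)) ^ 2 = l * (1 + l) := Real.sq_sqrt hv.le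
  have h := cgf_taylor hl (z / √(l * (1 + l)))
  simp only [devFun, cubicCoeff, quarticCoeff, quinticCoeff]
  generalize √(l * (1 + l)) = s at *
  have hs2' : (l : ℂ) * (1 + l) = (s : ℂ) ^ 2 := by
    rw [← Complex.ofReal_pow, hs2]; push_cast; ring
  have hsc : (s : ℂ) ≠ 0 := by exact_mod_cast hs.ne'
  rw [← hs2, hs2'] at h
  rw [← hs2]
  refine le_trans (le_of_eq ?_) (h.trans (le_of_eq ?_))
  · congr 1
    push_cast
    field_simp
    ring
  · rw [abs_div, abs_of_pos hs]
    field_simp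

lemma varCoeff_eq (hl : 0 < l) : varCoeff l = 1 + 1 / (4 * (l * (1 + l))) := by
  unfold varCoeff; field_simp; ring

lemma one_le_varCoeff (hl : 0 < l) : 1 ≤ varCoeff l := by
  rw [varCoeff_eq hl]
  have : 0 < 1 / (4 * (l * (1 + l))) := by positivity
  linarith

lemma cubicCoeff_sq (hl : 0 < l) : cubicCoeff l ^ 2 = varCoeff l / 9 := by
  rw [cubicCoeff, varCoeff, div_pow, mul_pow, Real.sq_sqrt (by positivity)]
  field_simp; ring

lemma cubicCoeff_pos (hl : 0 < l) : 0 < cubicCoeff l := by unfold cubicCoeff; positivity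

lemma quarticCoeff_pos (hl : 0 < l) : 0 < quarticCoeff l := by unfold quarticCoeff; positivity

lemma quarticCoeff_eq (hl : 0 < l) : quarticCoeff l = (2 * varCoeff l + 1) / 12 := by
  rw [quarticCoeff, varCoeff_eq hl]; field_simp; ring

lemma quinticCoeff_le (hl : 0 < l) : quinticCoeff l ≤ 24 * varCoeff l ^ 2 := by
  have hv : 0 < l * (1 + l) := by positivity
  have hs : 0 < √(l * (1 + l)) := by positivity
  have hq := one_le_varCoeff hl
  have h1 : quinticCoeff l = (6 * cubicCoeff l) * ((1 + 12 * (l * (1 + l))) / (l * (1 + l))) := by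
    rw [quinticCoeff, cubicCoeff, pow_succ, Real.sq_sqrt hv.le]; field_simp
  have h2 : (1 + 12 * (l * (1 + l))) / (l * (1 + l)) ≤ 12 * varCoeff l := by
    rw [varCoeff_eq hl, div_le_iff₀ hv]
    field_simp; linarith
  have h3 : 6 * cubicCoeff l ≤ 2 * varCoeff l := by
    refine abs_le_of_sq_le_sq' ?_ (by positivity) |>.2
    rw [mul_pow, cubicCoeff_sq hl]; nlinarith
  rw [h1]
  calc _ ≤ (2 * varCoeff l) * (12 * varCoeff l) := by
        have := cubicCoeff_pos hl
        gcongr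
    _ = _ := by ring

lemma coeff_bounds (hl : 0 < l) {L : ℝ} (h : 5 * varCoeff l ≤ L) :
    |cubicCoeff l| ≤ L ∧ quarticCoeff l ≤ L ∧ quinticCoeff l ≤ L ^ 2 ∧ (√(l * (1 + l)))⁻¹ ≤ L := by
  have hq := one_le_varCoeff hl
  have hv : 0 < l * (1 + l) := by positivity
  refine ⟨?_, ?_, ?_, ?_⟩
  · refine abs_le_of_sq_le_sq ?_ (by linarith)
    rw [cubicCoeff_sq hl]; nlinarith
  · rw [quarticCoeff_eq hl]; linarith
  · refine (quinticCoeff_le hl).trans ?_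
    nlinarith
  · refine abs_le_of_sq_le_sq' ?_ (by linarith) |>.2
    rw [inv_pow, Real.sq_sqrt hv.le]
    have := varCoeff_eq hl
    have h2 : (l * (1 + l))⁻¹ = 4 * (varCoeff l - 1) := by rw [this]; field_simp; ring
    rw [h2]; nlinarith

/-- The linear scale which normalizes the quadratic term. -/
noncomputable def scale (l : ℝ) : ℝ := 1 / (2 * π * √(l * (1 + l)))

lemma scale_pos (hl : 0 < l) : 0 < scale l := by unfold scale; positivity

lemma scale_le (hl : 0 < l) {L : ℝ} (h : 5 * varCoeff l ≤ L) : scale l ≤ L := by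
  have h1 := (coeff_bounds hl h).2.2.2
  have h2 : 0 < (√(l * (1 + l)))⁻¹ := by positivity
  have hp : 1 ≤ 2 * π := by linarith [pi_gt_three]
  calc scale l = (√(l * (1 + l)))⁻¹ / (2 * π) := by rw [scale]; field_simp
    _ ≤ (√(l * (1 + l)))⁻¹ := div_le_self h2.le hp
    _ ≤ L := h1

lemma scale_mul_sqrt (hl : 0 < l) :
    scale l * √(2 * π) = (√(4 * π * (l * (1 + l) / 2)))⁻¹ := by
  rw [show 4 * π * (l * (1 + l) / 2) = (2 * π) * (l * (1 + l)) by ring,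
    Real.sqrt_mul (show (0 : ℝ) ≤ 2 * π by positivity) (l * (1 + l)), scale]
  have h : √(2 * π) * √(2 * π) = 2 * π := Real.mul_self_sqrt (by positivity)
  have h0 := sqrt_pos.2 two_pi_pos
  have hs : 0 < √(l * (1 + l)) := by positivity
  rw [mul_inv]
  have h2 : √(2 * π) / (2 * π) = (√(2 * π))⁻¹ := by
    rw [div_eq_iff (by positivity), eq_inv_mul_iff_mul_eq₀ h0.ne', h]
  rw [← h2]
  field_simp

end Coefficients

section Lift

variable {m n s t : ℕ}

lemma torusFun_toTorus (hn : 0 < n) (hs : 0 < s) (hms : m * s = n * t)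
    (x : Fin m → ℝ) (y : Fin n → ℝ) :
    torusFun m n ((s : ℝ) / n) s t (toTorus x, toTorus y)
      = Complex.exp (∑ j, ∑ k, (devFun ((s : ℝ) / n) ((x j + y k) / scale ((s : ℝ) / n))
          - (((x j + y k) / scale ((s : ℝ) / n) : ℝ) : ℂ) ^ 2 / 2)) := by
  have hl : 0 < (s : ℝ) / n := by positivity
  have h := torusFun_coe hn hs hms x y
  have hs : 0 < √((s : ℝ) / n * (1 + (s : ℝ) / n)) := by positivity
  have e : ∀ z : ℝ, z / scale ((s : ℝ) / n) / √((s : ℝ) / n * (1 + (s : ℝ) / n))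
      = 2 * π * z := fun z => by
    rw [scale]; field_simp
  simp only [devFun, e, add_sub_cancel_right]
  simp only [Complex.exp_sum]
  exact h

lemma norm_torusFun_toTorus (hn : 0 < n) (hs : 0 < s) (hms : m * s = n * t)
    (x : Fin m → ℝ) (y : Fin n → ℝ) :
    ((‖torusFun m n ((s : ℝ) / n) s t (toTorus x, toTorus y)‖ : ℝ) : ℂ)
      = Complex.exp (∑ j, ∑ k,
          (((devFun ((s : ℝ) / n) ((x j + y k) / scale ((s : ℝ) / n))).re : ℂ)
          - (((x j + y k) / scale ((s : ℝ) / n) : ℝ) : ℂ) ^ 2 / 2)) := by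
  rw [torusFun_toTorus hn hs hms, Complex.norm_exp, Complex.ofReal_exp]
  congr 1
  rw [Complex.re_sum, Complex.ofReal_sum]
  refine Finset.sum_congr rfl fun j _ => ?_
  rw [Complex.re_sum, Complex.ofReal_sum]
  refine Finset.sum_congr rfl fun k _ => ?_
  rw [Complex.sub_re, Complex.ofReal_sub]
  congr 1
  rw [← Complex.ofReal_pow, ← Complex.ofReal_ofNat, ← Complex.ofReal_div, Complex.ofReal_re]

end Lift

section Outside

/-- The size conditions under which the estimates are carried out. -/
structure Regime (m n : ℕ) (l L : ℝ) : Prop where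
  hl : 0 < l
  hm : 20 ≤ m
  hn : 20 ≤ n
  hL : 40 ≤ L
  hlog : Real.log n ≤ L
  hmn : (m : ℝ) ≤ L * n
  hnm : (n : ℝ) ≤ L * m
  hq : 5 * varCoeff l ≤ L
  hLn : 20002 * L ^ 21 ≤ √n

namespace Regime

variable {m n : ℕ} {l L : ℝ}

lemma m_pos (h : Regime m n l L) : 0 < m := by have := h.hm; omega

lemma n_pos (h : Regime m n l L) : 0 < n := by have := h.hn; omega

lemma n_le_exp (h : Regime m n l L) : (n : ℝ) ≤ exp L := by
  have hn : (0 : ℝ) < n := by exact_mod_cast h.n_pos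
  exact (Real.log_le_iff_le_exp hn).1 h.hlog

lemma m_le_exp (h : Regime m n l L) : (m : ℝ) ≤ exp (2 * L) := by
  have h1 := h.n_le_exp
  have h2 : L ≤ exp L := by linarith [add_one_le_exp L]
  have h3 := h.hL
  calc (m : ℝ) ≤ L * n := h.hmn
    _ ≤ exp L * exp L := by gcongr
    _ = exp (2 * L) := by rw [← exp_add]; ring_nf

lemma exp_neg_le (h : Regime m n l L) : exp (-L) ≤ 1 / n := by
  have hn : (0 : ℝ) < n := by exact_mod_cast h.n_pos
  rw [exp_neg, one_div]
  exact inv_anti₀ hn h.n_le_exp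

lemma one_div_le (h : Regime m n l L) : (1 : ℝ) / n ≤ 1 / √n := by
  have hn : (20 : ℝ) ≤ n := by exact_mod_cast h.hn
  have h1 : √(n : ℝ) ≤ n := Real.sqrt_le_self_iff.2 (Or.inr (by linarith))
  exact one_div_le_one_div_of_le (by positivity) h1

lemma forty_one_le_exp (h : Regime m n l L) : 41 ≤ exp L := by
  have := h.hL
  linarith [add_one_le_exp L]

lemma tail_le (h : Regime m n l L) :
    (m + n + 1) * (2 * exp (-(L ^ 2 / 2))) ≤ 1 / √n := by
  have hL := h.hL
  have h1 := h.n_le_exp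
  have h2 := h.m_le_exp
  have h3 := h.forty_one_le_exp
  have h4 : exp L ≤ exp (2 * L) := exp_le_exp.2 (by linarith)
  have h5 : (m : ℝ) + n + 1 ≤ 3 * exp (2 * L) := by linarith [one_le_exp (show 0 ≤ L by linarith)]
  calc ((m : ℝ) + n + 1) * (2 * exp (-(L ^ 2 / 2)))
      ≤ 3 * exp (2 * L) * (2 * exp (-(L ^ 2 / 2))) := by gcongr
    _ = 6 * (exp (2 * L) * exp (-(L ^ 2 / 2))) := by ring
    _ ≤ exp L * (exp (2 * L) * exp (-(L ^ 2 / 2))) := by gcongr; linarith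
    _ = exp (L + (2 * L + -(L ^ 2 / 2))) := by rw [exp_add, exp_add]
    _ ≤ exp (-L) := exp_le_exp.2 (by nlinarith)
    _ ≤ 1 / n := h.exp_neg_le
    _ ≤ 1 / √n := h.one_div_le

lemma two_exp_le (h : Regime m n l L) : 2 * exp (-(L ^ 2 / 2)) ≤ 1 / √n := by
  refine le_trans ?_ h.tail_le
  have : (0 : ℝ) ≤ (m + n) * (2 * exp (-(L ^ 2 / 2))) := by positivity
  linarith

lemma row_decay (h : Regime m n l L) :
    exp (-((L ^ 6 / n / 200) * (n / 2))) * (m * exp (L ^ 3)) ≤ exp (-(3 * L)) := by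
  have hL := h.hL
  have hn : (0 : ℝ) < n := by exact_mod_cast h.n_pos
  have e : L ^ 6 / n / 200 * (n / 2) = L ^ 6 / 400 := by field_simp; ring
  rw [e]
  have h1 : 1600 * L ^ 3 ≤ L ^ 6 := by
    have : 1600 * L ^ 3 ≤ L ^ 3 * L ^ 3 := by gcongr; nlinarith [sq_nonneg (L - 40)]
    linarith [show L ^ 3 * L ^ 3 = L ^ 6 by ring]
  have h2 : 1600 * L ≤ L ^ 3 := by nlinarith [sq_nonneg (L - 40)]
  calc _ ≤ exp (-(L ^ 6 / 400)) * (exp (2 * L) * exp (L ^ 3)) := by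
        gcongr; exact h.m_le_exp
    _ = exp (-(L ^ 6 / 400) + (2 * L + L ^ 3)) := by rw [exp_add, exp_add]
    _ ≤ exp (-(3 * L)) := exp_le_exp.2 (by linarith)

lemma col_decay (h : Regime m n l L) :
    exp (-((L ^ 6 / n / 200) * (m / 2))) * (n * exp (L ^ 3)) ≤ exp (-(3 * L)) := by
  have hL := h.hL
  have hn : (0 : ℝ) < n := by exact_mod_cast h.n_pos
  have e : L ^ 5 / 400 ≤ L ^ 6 / n / 200 * (m / 2) := by
    have h1 : (n : ℝ) / n ≤ L * m / n := by gcongr; exact h.hnm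
    rw [div_self hn.ne'] at h1
    have h2 : L ^ 5 * 1 ≤ L ^ 5 * (L * m / n) := by gcongr
    have h3 : L ^ 6 / n / 200 * (m / 2) = L ^ 5 * (L * m / n) / 400 := by field_simp; ring
    rw [h3]; linarith
  have h2 : 1600 * L ≤ L ^ 3 := by nlinarith [sq_nonneg (L - 40)]
  have h1 : 1600 * L ^ 3 ≤ L ^ 5 := by
    have : 1600 * L ^ 3 ≤ L ^ 2 * L ^ 3 := by gcongr; nlinarith
    linarith [show L ^ 2 * L ^ 3 = L ^ 5 by ring]
  calc _ ≤ exp (-(L ^ 5 / 400)) * (exp (2 * L) * exp (L ^ 3)) := by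
        gcongr
        exact h.n_le_exp.trans (exp_le_exp.2 (by linarith))
    _ = exp (-(L ^ 5 / 400) + (2 * L + L ^ 3)) := by rw [exp_add, exp_add]
    _ ≤ exp (-(3 * L)) := exp_le_exp.2 (by linarith)

lemma boxMass_pos (h : Regime m n l L) : 0 < boxMass (scale l) m n := by
  have h1 := scale_pos h.hl
  have h2 := h.m_pos
  have h3 := h.n_pos
  have h4 := sqrt_pos.2 two_pi_pos
  unfold boxMass
  positivity

lemma pow_le_boxMass (h : Regime m n l L) :
    (1 / (1 + 2 * l)) ^ (m + n - 1)
      ≤ exp (m + n + L * m + 2 * L * n) * boxMass (scale l) m n := by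
  have hl := h.hl
  have hm : (20 : ℝ) ≤ m := by exact_mod_cast h.hm
  have hn : (20 : ℝ) ≤ n := by exact_mod_cast h.hn
  have hs := scale_pos hl
  have hp := sqrt_pos.2 two_pi_pos
  have hsm : 0 < √(m : ℝ) := by positivity
  have hsn : 0 < √(n : ℝ) := by positivity
  have h0 : 1 / (1 + 2 * l) ≤ exp 1 * (scale l * √(2 * π)) := by
    rw [scale_mul_sqrt hl, ← div_eq_mul_inv]
    have hv : 0 < √(4 * π * (l * (1 + l) / 2)) := by positivity
    have he : 2 ≤ exp 1 := by linarith [add_one_le_exp (1 : ℝ)]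
    have hb : √(4 * π * (l * (1 + l) / 2)) ≤ 2 * (1 + 2 * l) := by
      refine Real.sqrt_le_iff.2 ⟨by positivity, ?_⟩
      have : 0 < l * (1 + l) := by positivity
      nlinarith [pi_lt_four]
    rw [div_le_div_iff₀ (by positivity) hv]
    nlinarith
  have h1 : √(n : ℝ) ^ (m - 1) ≤ exp (L * m) := by
    have h2 : √(n : ℝ) ≤ exp L :=
      (Real.sqrt_le_self_iff.2 (Or.inr (by linarith))).trans h.n_le_exp
    calc √(n : ℝ) ^ (m - 1) ≤ exp L ^ (m - 1) := by gcongr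
      _ ≤ exp L ^ m := pow_le_pow_right₀ (by linarith [h.forty_one_le_exp]) (Nat.sub_le _ _)
      _ = exp (L * m) := by rw [← exp_nat_mul, mul_comm]
  have h2 : √(m : ℝ) ^ (n - 1) ≤ exp (2 * L * n) := by
    have h2 : √(m : ℝ) ≤ exp (2 * L) :=
      (Real.sqrt_le_self_iff.2 (Or.inr (by linarith))).trans h.m_le_exp
    have h3 : 1 ≤ exp (2 * L) := one_le_exp (by linarith [h.hL])
    calc √(m : ℝ) ^ (n - 1) ≤ exp (2 * L) ^ (n - 1) := by gcongr
      _ ≤ exp (2 * L) ^ n := pow_le_pow_right₀ h3 (Nat.sub_le _ _)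
      _ = exp (2 * L * n) := by rw [← exp_nat_mul, mul_comm]
  have h3 : exp 1 ^ (m + n - 1) ≤ exp (m + n) := by
    calc exp 1 ^ (m + n - 1) ≤ exp 1 ^ (m + n) :=
          pow_le_pow_right₀ (one_le_exp zero_le_one) (Nat.sub_le _ _)
      _ = exp (m + n) := by rw [← exp_nat_mul]; push_cast; ring_nf
  have e : (scale l * √(2 * π)) ^ (m + n - 1)
      = √(n : ℝ) ^ (m - 1) * √(m : ℝ) ^ (n - 1) * boxMass (scale l) m n := by
    rw [boxMass, inv_pow, inv_pow]; field_simp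
  have hM := h.boxMass_pos
  calc (1 / (1 + 2 * l)) ^ (m + n - 1) ≤ (exp 1 * (scale l * √(2 * π))) ^ (m + n - 1) := by gcongr
    _ = exp 1 ^ (m + n - 1) * (√(n : ℝ) ^ (m - 1) * √(m : ℝ) ^ (n - 1)
        * boxMass (scale l) m n) := by rw [mul_pow, e]
    _ ≤ exp (m + n) * (exp (L * m) * exp (2 * L * n) * boxMass (scale l) m n) := by gcongr
    _ = _ := by rw [exp_add (m + n + L * m), exp_add (m + n : ℝ)]; ring

lemma star_bound (h : Regime m n l L) :
    exp (-(L ^ 3 * (m - 5))) * (1 / (1 + 2 * l)) ^ (m + n - 1) ≤ boxMass (scale l) m n ∧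
    exp (-(L ^ 3 * (n - 5))) * (1 / (1 + 2 * l)) ^ (m + n - 1) ≤ boxMass (scale l) m n ∧
    exp (-((L ^ 6 / n / 200) * (m * n / 4))) * (1 / (1 + 2 * l)) ^ (m + n - 1)
      ≤ exp (-(3 * L)) * boxMass (scale l) m n := by
  have hL := h.hL
  have hm : (20 : ℝ) ≤ m := by exact_mod_cast h.hm
  have hn : (20 : ℝ) ≤ n := by exact_mod_cast h.hn
  have hM := h.boxMass_pos
  have hp := h.pow_le_boxMass
  have hmn := h.hmn
  have hnm := h.hnm
  have gen : ∀ x y : ℝ, -x + (m + n + L * m + 2 * L * n) ≤ -y →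
      exp (-x) * (1 / (1 + 2 * l)) ^ (m + n - 1) ≤ exp (-y) * boxMass (scale l) m n := by
    intro x y hxy
    calc _ ≤ exp (-x) * (exp (m + n + L * m + 2 * L * n) * boxMass (scale l) m n) := by gcongr
      _ = exp (-x + (m + n + L * m + 2 * L * n)) * boxMass (scale l) m n := by
          rw [← mul_assoc, ← exp_add]
      _ ≤ _ := by gcongr
  have hL2 : 40 * L ≤ L ^ 2 := by nlinarith
  have hL3 : 40 * L ^ 2 ≤ L ^ 3 := by nlinarith
  have b1 : (m : ℝ) + n + L * m + 2 * L * n ≤ 6 * L ^ 2 * m := by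
    have h1 : L * n ≤ L ^ 2 * m := by nlinarith
    have h2 : L * m ≤ L ^ 2 * m := by nlinarith
    have h3 : (m : ℝ) ≤ L * m := by nlinarith
    linarith
  have b2 : (m : ℝ) + n + L * m + 2 * L * n ≤ 6 * L ^ 2 * n := by
    have h1 : L * m ≤ L ^ 2 * n := by nlinarith
    have h2 : L * n ≤ L ^ 2 * n := by nlinarith
    have h3 : (n : ℝ) ≤ L * n := by nlinarith
    linarith
  refine ⟨?_, ?_, ?_⟩
  · have := gen (L ^ 3 * (m - 5)) 0 ?_
    · simpa using this
    · have h1 : 40 * L ^ 2 * (m - 5) ≤ L ^ 3 * (m - 5) := by gcongr; linarith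
      nlinarith
  · have := gen (L ^ 3 * (n - 5)) 0 ?_
    · simpa using this
    · have h1 : 40 * L ^ 2 * (n - 5) ≤ L ^ 3 * (n - 5) := by gcongr; linarith
      nlinarith
  · refine gen _ _ ?_
    have e : L ^ 6 / n / 200 * (m * n / 4) = L ^ 6 / 800 * m := by field_simp; ring
    rw [e]
    have h6 : 20 * L ^ 2 ≤ L ^ 6 / 800 := by
      have h7 : (40 * L) * (40 * L) ≤ L ^ 2 * L ^ 2 := by gcongr
      have h8 : L ^ 2 * (1600 * 40) ≤ L ^ 2 * (L ^ 2 * L ^ 2) := by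
        gcongr <;> nlinarith
      nlinarith [show L ^ 2 * (L ^ 2 * L ^ 2) = L ^ 6 by ring]
    have h9 : 20 * L ^ 2 * m ≤ L ^ 6 / 800 * m := by gcongr
    have h10 : L * 1 ≤ L ^ 2 * m := by nlinarith
    nlinarith

end Regime

end Outside

section Core

variable {m n s t : ℕ} {l L : ℝ}

namespace Regime

lemma side_lt (h : Regime m n l L) : scale l * (L ^ 3 / √n) < 1 / 6 := by
  have hL := h.hL
  have hn : (0 : ℝ) < n := by exact_mod_cast h.n_pos
  have hs : 0 < √(n : ℝ) := by positivity
  have h1 : scale l * (L ^ 3 / √n) ≤ L * (L ^ 3 / √n) := by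
    gcongr; exact scale_le h.hl h.hq
  have h2 : L ^ 4 ≤ L ^ 21 := pow_le_pow_right₀ (by linarith) (by norm_num)
  have h3 : L * (L ^ 3 / √n) < 1 / 6 := by
    rw [← mul_div_assoc, div_lt_iff₀ hs]
    have : 0 < L ^ 4 := by positivity
    nlinarith [h.hLn]
  linarith

lemma sq_side_le (h : Regime m n l L) : L ^ 6 / n ≤ 1 := by
  have hL := h.hL
  have hn : (0 : ℝ) < n := by exact_mod_cast h.n_pos
  have h1 : L ^ 3 ≤ L ^ 21 := pow_le_pow_right₀ (by linarith) (by norm_num)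
  have h2 : L ^ 3 ≤ √n := by
    have : 0 < L ^ 21 := by positivity
    linarith [h.hLn]
  rw [div_le_one hn]
  calc L ^ 6 = L ^ 3 * L ^ 3 := by ring
    _ ≤ √n * √n := by gcongr
    _ = n := Real.mul_self_sqrt hn.le

/-- Outside the box the absolute value of the integrand has negligible mass. -/
lemma integral_norm_compl_le (h : Regime m n l L) (s t : ℕ) :
    ∫ p in (torusBox m n (scale l * (L ^ 3 / √n)))ᶜ, ‖torusFun m n l s t p‖
      ≤ exp (-(3 * L)) * (2 * (∫ p, ‖torusFun m n l s t p‖) + 3 * boxMass (scale l) m n) := by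
  have hl := h.hl
  have hL := h.hL
  have hm := h.hm
  have hn := h.hn
  have hn0 : (0 : ℝ) < n := by exact_mod_cast h.n_pos
  have hsn : 0 < √(n : ℝ) := by positivity
  set w : UnitAddCircle → ℝ := fun x => √‖geomKernel l x‖ with hw
  have hwsq : ∀ x, w x ^ 2 = ‖geomKernel l x‖ := fun x => Real.sq_sqrt (norm_nonneg _)
  have hprod : latticeProd m n (fun x => w x ^ 2) = fun p => ‖torusFun m n l s t p‖ := by
    funext p
    simp only [hwsq, norm_torusFun, latticeProd]
  have h4 : ∫ x, w x ^ 4 = 1 / (1 + 2 * l) := by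
    rw [← integral_sq_norm_geomKernel hl]
    congr 1; funext x
    rw [← hwsq]; ring
  have hz : (L ^ 3 / √n) ^ 2 = L ^ 6 / n := by
    rw [div_pow, Real.sq_sqrt hn0.le]; ring
  have hwd : ∀ x : UnitAddCircle, scale l * (L ^ 3 / √n) / 3 ≤ ‖x‖ →
      w x ≤ exp (-(L ^ 6 / n / 200)) := by
    intro x hx
    have h1 := norm_geomKernel_le_exp hl (z := L ^ 3 / √n) (by rw [hz]; exact h.sq_side_le)
      (d := scale l * (L ^ 3 / √n)) (by have := scale_pos hl; positivity) ?_ hx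
    · rw [hw]
      refine Real.sqrt_le_iff.2 ⟨(exp_pos _).le, h1.trans (le_of_eq ?_)⟩
      rw [hz, ← Real.exp_nat_mul]; congr 1; push_cast; ring
    · have h2 : 0 < l * (1 + l) := by positivity
      rw [scale, mul_pow, div_pow 1, mul_pow (2 * π), Real.sq_sqrt h2.le]
      field_simp
      ring
  have key := integral_compl_torusBox_le (m := m) (n := n) (by omega) (by omega)
    (by
      have h5 : 4 * (m + n) ≤ m * n := by nlinarith
      omega) (w := w) ((continuous_geomKernel hl).norm.sqrt)
    (fun x => sqrt_pos.2 (norm_geomKernel_pos hl x))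
    (fun x => Real.sqrt_le_one.2 (norm_geomKernel_le_one hl x)) (β := L ^ 6 / n / 200)
    (by positivity) hwd (L ^ 3)
  rw [hprod, h4] at key
  refine key.trans ?_
  set K := ∫ p, ‖torusFun m n l s t p‖
  set M := boxMass (scale l) m n
  have hK : 0 ≤ K := integral_nonneg fun _ => norm_nonneg _
  have hM : 0 < M := h.boxMass_pos
  obtain ⟨s1, s2, s3⟩ := h.star_bound
  have hX : 1 ≤ exp (L ^ 3) := one_le_exp (by positivity)
  have gen : ∀ e k S : ℝ, 0 ≤ e → 0 ≤ k → S ≤ M → e * (k * exp (L ^ 3)) ≤ exp (-(3 * L)) →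
      e * (k * (exp (L ^ 3) * K + S)) ≤ exp (-(3 * L)) * (K + M) := by
    intro e k S he hk hS hd
    calc e * (k * (exp (L ^ 3) * K + S)) ≤ e * (k * (exp (L ^ 3) * K + exp (L ^ 3) * M)) := by
          gcongr; nlinarith
      _ = e * (k * exp (L ^ 3)) * (K + M) := by ring
      _ ≤ _ := by gcongr
  have g1 := gen _ m _ (exp_pos _).le (Nat.cast_nonneg m) s1 h.row_decay
  have g2 := gen _ n _ (exp_pos _).le (Nat.cast_nonneg n) s2 h.col_decay
  linarith

end Regime

lemma integral_norm_box_eq (h : Regime m n ((s : ℝ) / n) L) (hs : 0 < s) (hms : m * s = n * t) :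
    stdG.real {x | |x| ≤ L} * ∫ q in torusBox m n (scale ((s : ℝ) / n) * (L ^ 3 / √n)),
        ‖torusFun m n ((s : ℝ) / n) s t q‖
      = boxMass (scale ((s : ℝ) / n)) m n * ∫ p in boxSet m n L,
          exp (∑ j, ∑ k, devFun ((s : ℝ) / n) (cell p.1 p.2 j k)).re ∂gaussPair m n := by
  have hl := h.hl
  have := integral_torusBox_eq (Φ := fun z => ((devFun ((s : ℝ) / n) z).re : ℂ)) h.m_pos h.n_pos
    (by linarith [h.hL]) h.hmn
    (Complex.continuous_ofReal.comp (Complex.continuous_re.comp (continuous_devFun hl)))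
    (scale_pos hl) h.side_lt
    (F := fun q => ((‖torusFun m n ((s : ℝ) / n) s t q‖ : ℝ) : ℂ))
    (Complex.continuous_ofReal.comp (continuous_torusFun m n hl s t).norm)
    (norm_torusFun_toTorus h.n_pos hs hms)
  rw [integral_complex_ofReal] at this
  have e : ∀ p : (Fin m → ℝ) × (Fin n → ℝ),
      Complex.exp (∑ j, ∑ k, ((devFun ((s : ℝ) / n) (cell p.1 p.2 j k)).re : ℂ))
        = ((exp (∑ j, ∑ k, devFun ((s : ℝ) / n) (cell p.1 p.2 j k)).re : ℝ) : ℂ) := by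
    intro p
    push_cast [Complex.re_sum]
    rfl
  simp only [e] at this
  rw [integral_complex_ofReal] at this
  exact_mod_cast this

lemma stdG_real_abs_le (hL : 0 ≤ L) :
    1 - 2 * exp (-(L ^ 2 / 2)) ≤ stdG.real {x | |x| ≤ L} ∧ stdG.real {x | |x| ≤ L} ≤ 1 := by
  have : IsProbabilityMeasure stdG := by unfold stdG; infer_instance
  refine ⟨?_, measureReal_le_one⟩
  have h1 := stdG_tail hL
  have e : {x : ℝ | L < |x|} = {x : ℝ | |x| ≤ L}ᶜ := by ext x; simp
  rw [e, measureReal_compl (measurableSet_le (by fun_prop) (by fun_prop)), probReal_univ] at h1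
  linarith

/-- The part of the integral over the box, in absolute value. -/
lemma integral_norm_box_le (h : Regime m n ((s : ℝ) / n) L) (hs : 0 < s) (hms : m * s = n * t)
    {c : ℝ} (hc : c = quarticCoeff ((s : ℝ) / n) * (3 * m / n + 6 + 3 * n / m)) :
    ∫ q in torusBox m n (scale ((s : ℝ) / n) * (L ^ 3 / √n)), ‖torusFun m n ((s : ℝ) / n) s t q‖
      ≤ 4 * (boxMass (scale ((s : ℝ) / n)) m n * exp c) := by
  have hl := h.hl
  have hL := h.hL
  obtain ⟨-, hb4, hb5, -⟩ := coeff_bounds hl h.hq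
  have h1 := integral_re_box_le h.m_pos h.n_pos (by linarith) h.hmn h.hnm (continuous_devFun hl)
    (norm_devFun_sub_le hl) (quarticCoeff_pos hl).le hb4 hb5 h.hLn
  rw [← hc] at h1
  have h2 := integral_norm_box_eq h hs hms
  obtain ⟨h3, -⟩ := stdG_real_abs_le (L := L) (by linarith)
  have hn : (20 : ℝ) ≤ n := by exact_mod_cast h.hn
  have hsn : 0 < √(n : ℝ) := by positivity
  have h4 : 2 * exp (-(L ^ 2 / 2)) ≤ 1 / 2 := by
    have h5 := h.two_exp_le
    have h6 : (2 : ℝ) ≤ √n := Real.le_sqrt_of_sq_le (by linarith)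
    exact h5.trans (one_div_le_one_div_of_le (by norm_num) h6)
  have h5 : 20002 * L ^ 21 / √n ≤ 1 := (div_le_one hsn).2 h.hLn
  have hM := h.boxMass_pos
  set K := ∫ q in torusBox m n (scale ((s : ℝ) / n) * (L ^ 3 / √n)),
    ‖torusFun m n ((s : ℝ) / n) s t q‖
  have hK : 0 ≤ K := integral_nonneg fun _ => norm_nonneg _
  set M := boxMass (scale ((s : ℝ) / n)) m n
  set I := ∫ p in boxSet m n L,
    exp (∑ j, ∑ k, devFun ((s : ℝ) / n) (cell p.1 p.2 j k)).re ∂gaussPair m n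
  have h6 : I ≤ exp c * 2 := h1.trans (by gcongr; linarith)
  have h7 : M * I ≤ M * (exp c * 2) := by gcongr
  nlinarith

/-- The integral of `torusFun` up to a relative error of order `L ^ 21 / √n`. -/
lemma norm_integral_torusFun_sub_le (h : Regime m n ((s : ℝ) / n) L) (hs : 0 < s)
    (hms : m * s = n * t) {c : ℝ}
    (hc : c = quarticCoeff ((s : ℝ) / n) * (3 * m / n + 6 + 3 * n / m)) :
    ‖(∫ q, torusFun m n ((s : ℝ) / n) s t q) - ((boxMass (scale ((s : ℝ) / n)) m n
        * exp (c - cubicCoeff ((s : ℝ) / n) ^ 2 * (15 * m / n + 18 + 15 * n / m) / 2) : ℝ) : ℂ)‖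
      ≤ boxMass (scale ((s : ℝ) / n)) m n * exp c * (300000000 * L ^ 21 / √n) := by
  have hl := h.hl
  have hL := h.hL
  obtain ⟨hb3, hb4, hb5, -⟩ := coeff_bounds hl h.hq
  have h1 := norm_gauss_box_sub_le h.m_pos h.n_pos (by linarith) h.hmn h.hnm
    (continuous_devFun hl) (norm_devFun_sub_le hl) hb3 (quarticCoeff_pos hl).le hb4 hb5 h.hLn
    h.tail_le hc
  have h2 := integral_torusBox_eq h.m_pos h.n_pos (by linarith) h.hmn (continuous_devFun hl)
    (scale_pos hl) h.side_lt (continuous_torusFun m n hl s t)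
    (torusFun_toTorus h.n_pos hs hms)
  have h3 := integral_norm_box_le h hs hms hc
  have h4 := h.integral_norm_compl_le s t
  obtain ⟨h5, h6⟩ := stdG_real_abs_le (L := L) (by linarith)
  have hB := (isClosed_torusBox m n (scale ((s : ℝ) / n) * (L ^ 3 / √n))).measurableSet
  have hFn := integrable_torus (continuous_torusFun m n hl s t).norm
  have hF : Integrable (torusFun m n ((s : ℝ) / n) s t) :=
    (continuous_torusFun m n hl s t).integrable_of_hasCompactSupport
      (HasCompactSupport.of_compactSpace _)
  rw [← integral_add_compl hB hFn] at h4
  rw [← integral_add_compl hB hF]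
  have h7 := norm_integral_le_integral_norm (μ := volume.restrict
    (torusBox m n (scale ((s : ℝ) / n) * (L ^ 3 / √n)))) (torusFun m n ((s : ℝ) / n) s t)
  have h8 := norm_integral_le_integral_norm (μ := volume.restrict
    (torusBox m n (scale ((s : ℝ) / n) * (L ^ 3 / √n)))ᶜ) (torusFun m n ((s : ℝ) / n) s t)
  have hM := h.boxMass_pos
  have h9 := h.two_exp_le
  have hc0 : 0 ≤ c := by
    rw [hc]; have := quarticCoeff_pos hl; positivity
  have hec : 1 ≤ exp c := one_le_exp hc0
  have htau : exp (-(3 * L)) * 12 ≤ 1 / √n := by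
    have h10 := h.forty_one_le_exp
    calc exp (-(3 * L)) * 12 ≤ exp (-(3 * L)) * exp L := by gcongr; linarith
      _ = exp (-(2 * L)) := by rw [← exp_add]; ring_nf
      _ ≤ exp (-L) := exp_le_exp.2 (by linarith)
      _ ≤ 1 / √n := h.exp_neg_le.trans h.one_div_le
  have htau' : exp (-(3 * L)) ≤ 1 / 41 := by
    have h10 := h.forty_one_le_exp
    calc exp (-(3 * L)) ≤ exp (-L) := exp_le_exp.2 (by linarith)
      _ = 1 / exp L := by rw [exp_neg, one_div]
      _ ≤ 1 / 41 := one_div_le_one_div_of_le (by norm_num) h10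
  have hsn : 0 < √(n : ℝ) := by have := h.n_pos; positivity
  have hL21 : 1 ≤ L ^ 21 := one_le_pow₀ (by linarith)
  generalize cubicCoeff ((s : ℝ) / n) ^ 2 * (15 * m / n + 18 + 15 * n / m) / 2 = V at *
  generalize boxMass (scale ((s : ℝ) / n)) m n = M at *
  generalize (∫ q in torusBox m n (scale ((s : ℝ) / n) * (L ^ 3 / √n)),
    ‖torusFun m n ((s : ℝ) / n) s t q‖) = Ki at *
  generalize (∫ q in (torusBox m n (scale ((s : ℝ) / n) * (L ^ 3 / √n)))ᶜ,
    ‖torusFun m n ((s : ℝ) / n) s t q‖) = Ko at *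
  generalize (∫ q in torusBox m n (scale ((s : ℝ) / n) * (L ^ 3 / √n)),
    torusFun m n ((s : ℝ) / n) s t q) = Pi at *
  generalize (∫ q in (torusBox m n (scale ((s : ℝ) / n) * (L ^ 3 / √n)))ᶜ,
    torusFun m n ((s : ℝ) / n) s t q) = Po at *
  generalize (∫ p in boxSet m n L, Complex.exp (∑ j, ∑ k,
    devFun ((s : ℝ) / n) (cell p.1 p.2 j k)) ∂gaussPair m n) = I at *
  generalize stdG.real {x | |x| ≤ L} = P at *
  have hMe : 0 < M * exp c := by positivity
  have hMc : M ≤ M * exp c := le_mul_of_one_le_right hM.le hec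
  have ht0 := exp_pos (-(3 * L))
  have hKi : 0 ≤ Ki := (norm_nonneg _).trans h7
  have hKo : Ko ≤ M * exp c * (1 / √n) := by
    have a1 : exp (-(3 * L)) * Ki ≤ exp (-(3 * L)) * (4 * (M * exp c)) := by gcongr
    have a2 : exp (-(3 * L)) * M ≤ exp (-(3 * L)) * (M * exp c) := by gcongr
    have hKo0 : 0 ≤ Ko := (norm_nonneg _).trans h8
    have a3 : exp (-(3 * L)) * Ko ≤ 1 / 41 * Ko := by gcongr
    have a4 : M * exp c * (exp (-(3 * L)) * 12) ≤ M * exp c * (1 / √n) := by gcongr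
    nlinarith
  have e : Pi + Po - ((M * exp (c - V) : ℝ) : ℂ)
      = Po + (((1 - P : ℝ) : ℂ) * Pi + (M : ℂ) * (I - (exp (c - V) : ℝ))) := by
    rw [mul_sub, ← h2]; push_cast; ring
  rw [e]
  have b1 : ‖((1 - P : ℝ) : ℂ) * Pi‖ ≤ 1 / √n * (4 * (M * exp c)) := by
    rw [norm_mul, Complex.norm_real, Real.norm_of_nonneg (by linarith)]
    gcongr
    · linarith
    · exact h7.trans h3
  have b2 : ‖(M : ℂ) * (I - (exp (c - V) : ℝ))‖
      ≤ M * (exp c * (200000000 * L ^ 21 / √n)) := by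
    rw [norm_mul, Complex.norm_real, Real.norm_of_nonneg hM.le]
    gcongr
  have b3 : M * exp c * (5 / √n) ≤ M * exp c * (100000000 * L ^ 21 / √n) := by
    gcongr; linarith
  calc _ ≤ ‖Po‖ + (‖((1 - P : ℝ) : ℂ) * Pi‖ + ‖(M : ℂ) * (I - (exp (c - V) : ℝ))‖) :=
        (norm_add_le _ _).trans (add_le_add le_rfl (norm_add_le _ _))
    _ ≤ M * exp c * (1 / √n) + (1 / √n * (4 * (M * exp c))
        + M * (exp c * (200000000 * L ^ 21 / √n))) := by
        gcongr; exact h8.trans hKo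
    _ = M * exp c * (5 / √n) + M * exp c * (200000000 * L ^ 21 / √n) := by ring
    _ ≤ _ := by
        have : M * exp c * (300000000 * L ^ 21 / √n) = M * exp c * (100000000 * L ^ 21 / √n)
          + M * exp c * (200000000 * L ^ 21 / √n) := by ring
        linarith

end Core

section Final

variable {m n s t : ℕ} {l : ℝ}

lemma matCount_eq (hn : 0 < n) (hs : 0 < s) :
    (matCount m s n t : ℝ)
      = (((s : ℝ) / n) ^ (-((s : ℝ) / n)) * (1 + (s : ℝ) / n) ^ (1 + (s : ℝ) / n)) ^ (m * n)
        * (∫ p, torusFun m n ((s : ℝ) / n) s t p).re := by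
  have hl : 0 < (s : ℝ) / n := by positivity
  have hn' : (0 : ℝ) < n := by exact_mod_cast hn
  have e1 : (s : ℝ) / n * (m * n : ℕ) = (m * s : ℕ) := by push_cast; field_simp
  rw [integral_torusFun m n s t hl, Complex.ofReal_re]
  generalize (s : ℝ) / n = l at *
  have h1 : (l ^ (-l) * (1 + l) ^ (1 + l)) ^ (m * n)
      = (l ^ (m * s))⁻¹ * ((1 + l) ^ (m * n) * (1 + l) ^ (m * s)) := by
    have h1l : 0 < 1 + l := by positivity
    rw [mul_pow, ← rpow_mul_natCast hl.le, ← rpow_mul_natCast h1l.le, neg_mul, add_mul, e1,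
      one_mul, rpow_neg hl.le, rpow_add h1l, rpow_natCast, rpow_natCast, rpow_natCast]
  rw [h1, div_pow, div_pow, one_pow]
  field_simp

lemma boxMass_scale_eq (hl : 0 < l) (hm : 0 < m) (hn : 0 < n) :
    boxMass (scale l) m n = ((4 * π * (l * (1 + l) / 2)) ^ (((m : ℝ) + n - 1) / 2)
      * (m : ℝ) ^ (((n : ℝ) - 1) / 2) * (n : ℝ) ^ (((m : ℝ) - 1) / 2))⁻¹ := by
  have h : ∀ (x : ℝ) (k : ℕ), 0 ≤ x → (√x)⁻¹ ^ k = (x ^ ((k : ℝ) / 2))⁻¹ := by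
    intro x k hx
    rw [inv_pow, sqrt_eq_rpow, ← rpow_mul_natCast hx]
    congr 2; ring
  rw [boxMass, scale_mul_sqrt hl, h _ _ (by positivity), h _ _ (by positivity),
    h _ _ (by positivity), Nat.cast_sub (by omega), Nat.cast_sub (by omega),
    Nat.cast_sub (by omega)]
  push_cast
  rw [mul_inv, mul_inv]; ring

lemma cubic_exponent_eq (hl : 0 < l) (m n : ℕ) :
    cubicCoeff l ^ 2 * (15 * m / n + 18 + 15 * n / m) / 2
      = varCoeff l * (1 + 5 * (m : ℝ) / (6 * n) + 5 * (n : ℝ) / (6 * m)) := by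
  rw [cubicCoeff_sq hl, mul_div_mul_comm, mul_div_mul_comm, mul_div_assoc, mul_div_assoc]; ring

lemma exponent_eq (hl : 0 < l) (m n : ℕ) :
    quarticCoeff l * (3 * m / n + 6 + 3 * n / m)
        - cubicCoeff l ^ 2 * (15 * m / n + 18 + 15 * n / m) / 2
      = 1 / 2 - (1 + 2 * (l * (1 + l) / 2)) / (24 * (l * (1 + l) / 2))
          * ((m : ℝ) / n + (n : ℝ) / m) := by
  rw [cubicCoeff_sq hl, quarticCoeff_eq hl, varCoeff_eq hl, mul_div_assoc 3, mul_div_assoc 3,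
    mul_div_assoc 15 (m : ℝ), mul_div_assoc 15 (n : ℝ)]
  generalize (m : ℝ) / n = x
  generalize (n : ℝ) / m = y
  field_simp
  ring

lemma abs_log_le {x : ℝ} (h : |x - 1| ≤ 1 / 2) : |Real.log x| ≤ 2 * |x - 1| := by
  obtain ⟨h1, h2⟩ := abs_le.1 h
  have hx : 0 < x := by linarith
  have h3 := Real.log_le_sub_one_of_pos hx
  have h4 := Real.one_sub_inv_le_log_of_pos hx
  have h5 : -(2 * |x - 1|) ≤ 1 - x⁻¹ := by
    have h6 : 1 - x⁻¹ = (x - 1) * x⁻¹ := by field_simp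
    have h7 : x⁻¹ ≤ 2 := by
      rw [inv_le_comm₀ hx (by norm_num)]; linarith
    have h8 : |x - 1| * x⁻¹ ≤ |x - 1| * 2 := by gcongr
    have h9 : -|x - 1| * x⁻¹ ≤ (x - 1) * x⁻¹ := by gcongr; exact neg_abs_le _
    rw [h6]; linarith
  exact abs_le.2 ⟨h5.trans h4, h3.trans (by linarith [le_abs_self (x - 1), abs_nonneg (x - 1)])⟩

/-- All requirements on the size of `n`. -/
lemma exists_threshold {e b : ℝ} (he : 0 < e) (hb : 0 < b) (heb : 21 * e < 1 / 2) :
    ∃ N : ℕ, 20 ≤ N ∧ ∀ n : ℕ, N ≤ n → 40 ≤ (n : ℝ) ^ e ∧ 3 * Real.log n ≤ (n : ℝ) ^ e ∧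
      20002 * ((n : ℝ) ^ e) ^ 21 ≤ √n ∧ 300000000 * (n : ℝ) ^ (-b) ≤ 1 / 2 := by
  have h1 := (tendsto_rpow_atTop he).eventually_ge_atTop 40
  have h2 : ∀ᶠ x : ℝ in Filter.atTop, 3 * Real.log x ≤ x ^ e := by
    have := (isLittleO_log_rpow_atTop he).bound (show (0 : ℝ) < 1 / 3 by norm_num)
    filter_upwards [this, Filter.eventually_ge_atTop 1] with x hx hx1
    rw [Real.norm_of_nonneg (Real.log_nonneg hx1), Real.norm_of_nonneg (by positivity)] at hx
    linarith
  have h3 : ∀ᶠ x : ℝ in Filter.atTop, 20002 * (x ^ e) ^ 21 ≤ √x := by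
    filter_upwards [(tendsto_rpow_atTop (sub_pos.2 heb)).eventually_ge_atTop 20002,
      Filter.eventually_gt_atTop 0] with x hx hx0
    rw [← rpow_mul_natCast hx0.le, sqrt_eq_rpow]
    calc 20002 * x ^ (e * (21 : ℕ)) ≤ x ^ (1 / 2 - 21 * e) * x ^ (e * (21 : ℕ)) := by gcongr
      _ = x ^ (1 / 2 : ℝ) := by rw [← rpow_add hx0]; congr 1; push_cast; ring
  have h4 : ∀ᶠ x : ℝ in Filter.atTop, 300000000 * x ^ (-b) ≤ 1 / 2 := by
    have := (tendsto_rpow_neg_atTop hb).const_mul 300000000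
    rw [mul_zero] at this
    exact this.eventually_le_const (by norm_num)
  have h5 := tendsto_natCast_atTop_atTop.eventually (h1.and (h2.and (h3.and h4)))
  obtain ⟨N, hN⟩ := Filter.eventually_atTop.1 h5
  exact ⟨max N 20, le_max_right _ _, fun n hn => hN n ((le_max_left _ _).trans hn)⟩

lemma regime_of_hyp {a L : ℝ} (ha : a < 1 / 2) (hl : 0 < l) (hm : 20 ≤ m) (hn : 20 ≤ n)
    (hL : 40 ≤ L) (hlog : 3 * Real.log n ≤ L) (hLn : 20002 * L ^ 21 ≤ √n)
    (hyp : varCoeff l * (1 + 5 * (m : ℝ) / (6 * n) + 5 * (n : ℝ) / (6 * m)) ≤ a * Real.log n) :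
    Regime m n l L := by
  have hm' : (20 : ℝ) ≤ m := by exact_mod_cast hm
  have hn' : (20 : ℝ) ≤ n := by exact_mod_cast hn
  have hln : 0 ≤ Real.log n := Real.log_nonneg (by linarith)
  have hal : a * Real.log n ≤ 1 / 2 * Real.log n := by gcongr
  have hv := one_le_varCoeff hl
  have x0 : 0 ≤ 5 * (m : ℝ) / (6 * n) := by positivity
  have y0 : 0 ≤ 5 * (n : ℝ) / (6 * m) := by positivity
  have hx : 5 * (m : ℝ) / (6 * n) ≤ L / 6 := by nlinarith
  have hy : 5 * (n : ℝ) / (6 * m) ≤ L / 6 := by nlinarith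
  rw [div_le_iff₀ (by positivity)] at hx hy
  exact ⟨hl, hm, hn, hL, by linarith, by nlinarith, by nlinarith, by nlinarith, hLn⟩

lemma matCount_eq_exp {a b L : ℝ} (h : Regime m n ((s : ℝ) / n) L) (hs : 0 < s)
    (hms : m * s = n * t)
    (hyp : varCoeff ((s : ℝ) / n) * (1 + 5 * (m : ℝ) / (6 * n) + 5 * (n : ℝ) / (6 * m))
      ≤ a * Real.log n)
    (hLab : (n : ℝ) ^ a * (L ^ 21 / √n) ≤ (n : ℝ) ^ (-b))
    (hb : 300000000 * (n : ℝ) ^ (-b) ≤ 1 / 2) :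
    ∃ E : ℝ, |E| ≤ 600000000 * (n : ℝ) ^ (-b) ∧
      (matCount m s n t : ℝ)
        = (((s : ℝ) / n) ^ (-((s : ℝ) / n)) * (1 + (s : ℝ) / n) ^ (1 + (s : ℝ) / n)) ^ (m * n)
          / ((4 * π * (((s : ℝ) / n) * (1 + (s : ℝ) / n) / 2)) ^ (((m : ℝ) + n - 1) / 2)
              * (m : ℝ) ^ (((n : ℝ) - 1) / 2) * (n : ℝ) ^ (((m : ℝ) - 1) / 2))
          * exp (1 / 2 - (1 + 2 * (((s : ℝ) / n) * (1 + (s : ℝ) / n) / 2))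
              / (24 * (((s : ℝ) / n) * (1 + (s : ℝ) / n) / 2)) * ((m : ℝ) / n + (n : ℝ) / m)
            + E) := by
  have hl := h.hl
  have hn : (0 : ℝ) < n := by exact_mod_cast h.n_pos
  have hM := h.boxMass_pos
  have key := norm_integral_torusFun_sub_le h hs hms rfl
  rw [cubic_exponent_eq hl] at key
  have hexp := exponent_eq hl m n
  rw [cubic_exponent_eq hl] at hexp
  rw [matCount_eq h.n_pos hs, div_eq_mul_inv _ (_ * _ * _), ← boxMass_scale_eq hl h.m_pos h.n_pos,
    ← hexp]
  set M := boxMass (scale ((s : ℝ) / n)) m n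
  set c := quarticCoeff ((s : ℝ) / n) * (3 * m / n + 6 + 3 * n / m)
  set V := varCoeff ((s : ℝ) / n) * (1 + 5 * (m : ℝ) / (6 * n) + 5 * (n : ℝ) / (6 * m))
  have hr := (Complex.abs_re_le_norm _).trans key
  rw [Complex.sub_re, Complex.ofReal_re] at hr
  set r := (∫ p, torusFun m n ((s : ℝ) / n) s t p).re
  set Q := M * exp (c - V)
  have hQ : 0 < Q := by positivity
  have hV : exp V ≤ (n : ℝ) ^ a := by
    rw [rpow_def_of_pos hn]
    exact exp_le_exp.2 (by linarith)
  have hL0 : 0 ≤ L ^ 21 / √n := by have := h.hL; positivity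
  have hrel : |r / Q - 1| ≤ 300000000 * (n : ℝ) ^ (-b) := by
    have e : r / Q - 1 = (r - Q) / Q := by field_simp
    rw [e, abs_div, abs_of_pos hQ, div_le_iff₀ hQ]
    calc |r - Q| ≤ M * exp c * (300000000 * L ^ 21 / √n) := hr
      _ = 300000000 * (exp V * (L ^ 21 / √n)) * Q := by
          rw [show exp c = exp V * exp (c - V) by rw [← exp_add]; ring_nf]; ring
      _ ≤ 300000000 * ((n : ℝ) ^ a * (L ^ 21 / √n)) * Q := by gcongr
      _ ≤ _ := by gcongr
  have hhalf := hrel.trans hb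
  have hpos : 0 < r / Q := by linarith [(abs_le.1 hhalf).1]
  refine ⟨Real.log (r / Q), (abs_log_le hhalf).trans (by linarith), ?_⟩
  rw [exp_add, exp_log hpos, mul_assoc, ← mul_assoc M]
  congr 1
  exact (mul_div_cancel₀ r hQ.ne').symm

end Final

end ContingencyTable

/-- Theorem 1 of the paper, in the explicit form (1.3): with `λ = s/n = t/m` and
`A = λ(1+λ)/2`,
`M(m,s;n,t) = (λ^{−λ}(1+λ)^{1+λ})^{mn} / ((4πA)^{(m+n−1)/2} m^{(n−1)/2} n^{(m−1)/2})
  · exp(1/2 − ((1+2A)/(24A))(m/n + n/m) + O(n^{−b}))`. -/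
theorem stmt_1 (a b : ℝ) (ha : 0 < a) (hb : 0 < b) (hab : a + b < 1 / 2) :
    ∃ C : ℝ, 0 < C ∧ ∃ N₀ : ℕ, ∀ m s n t : ℕ,
      0 < m → 0 < s → 0 < n → 0 < t → N₀ ≤ m → N₀ ≤ n → m * s = n * t →
      (1 + 2 * ((s : ℝ) / n)) ^ 2 / (4 * ((s : ℝ) / n) * (1 + (s : ℝ) / n))
          * (1 + 5 * (m : ℝ) / (6 * n) + 5 * (n : ℝ) / (6 * m)) ≤ a * Real.log n →
      ∃ E : ℝ, |E| ≤ C * (n : ℝ) ^ (-b) ∧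
        (matCount m s n t : ℝ)
          = (((s : ℝ) / n) ^ (-((s : ℝ) / n)) * (1 + (s : ℝ) / n) ^ (1 + (s : ℝ) / n))
                ^ (m * n)
              / ((4 * π * (((s : ℝ) / n) * (1 + (s : ℝ) / n) / 2))
                    ^ (((m : ℝ) + n - 1) / 2)
                  * (m : ℝ) ^ (((n : ℝ) - 1) / 2) * (n : ℝ) ^ (((m : ℝ) - 1) / 2))
              * Real.exp (1 / 2
                  - (1 + 2 * (((s : ℝ) / n) * (1 + (s : ℝ) / n) / 2))
                      / (24 * (((s : ℝ) / n) * (1 + (s : ℝ) / n) / 2))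
                      * ((m : ℝ) / n + (n : ℝ) / m)
                  + E) := by
  set e := (1 / 2 - a - b) / 21 with he
  have he0 : 0 < e := by rw [he]; linarith
  obtain ⟨N, hN, hNn⟩ := ContingencyTable.exists_threshold he0 hb (by linarith)
  refine ⟨600000000, by norm_num, N, fun m s n t _ hs hn _ hNm hNn' hms hyp => ?_⟩
  obtain ⟨h1, h2, h3, h4⟩ := hNn n hNn'
  have hn' : (0 : ℝ) < n := by exact_mod_cast hn
  have hreg := ContingencyTable.regime_of_hyp (l := (s : ℝ) / n) (m := m) (n := n) (a := a)
    (by linarith) (by positivity) (hN.trans hNm) (hN.trans hNn') h1 h2 h3 hyp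
  refine ContingencyTable.matCount_eq_exp hreg hs hms hyp (le_of_eq ?_) h4
  rw [← rpow_mul_natCast hn'.le, sqrt_eq_rpow, ← rpow_sub hn', ← rpow_add hn']
  congr 1
  rw [he]; push_cast; ring
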